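/- arXiv:1410.5063 — 2 statements merged into one kernel-verified Lean document; each statement's English description precedes it below -/
import Mathlib

section
/- Let Ω ⊂ ℝⁿ be a bounded open set, and let u, w : closure(Ω) → ℝ be C¹ on the closure of Ω, with u a C² solution of the graphic translator equation on Ω and u = w on ∂Ω. Then ∫_Ω e^{u(x)} √(1+|∇u(x)|²) dx ≤ ∫_Ω e^{w(x)} √(1+|∇w(x)|²) dx, with equality if and only if w = u on Ω. -/
open MeasureTheory

/-- A `C¹` function on the closure of a bounded open set has bounded gradient inside. -/
lemma fderiv_bdd_aux {n : ℕ} {Ω : Set (Fin n → ℝ)} (hΩo : IsOpen Ω)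
    (hΩb : Bornology.IsBounded Ω) {u : (Fin n → ℝ) → ℝ}
    (hu : ContDiffOn ℝ 1 u (closure Ω)) :
    ∃ C : ℝ, ∀ x ∈ Ω, ‖fderiv ℝ u x‖ ≤ C := by
  have hK : IsCompact (closure Ω) := hΩb.isCompact_closure
  have key : ∃ C : ℝ, ∀ x ∈ closure Ω, x ∈ Ω → ‖fderiv ℝ u x‖ ≤ C := by
    refine hK.induction_on (p := fun s => ∃ C : ℝ, ∀ x ∈ s, x ∈ Ω → ‖fderiv ℝ u x‖ ≤ C)
      ⟨0, by simp⟩ ?_ ?_ ?_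
    · rintro s t hst ⟨C, hC⟩
      exact ⟨C, fun x hx => hC x (hst hx)⟩
    · rintro s t ⟨C, hC⟩ ⟨D, hD⟩
      refine ⟨max C D, ?_⟩
      rintro x (hx | hx) hxΩ
      · exact (hC x hx hxΩ).trans (le_max_left _ _)
      · exact (hD x hx hxΩ).trans (le_max_right _ _)
    · intro x hx
      have h1 : ContDiffWithinAt ℝ (0 + 1) u (closure Ω) x := by simpa using hu x hx
      rw [contDiffWithinAt_succ_iff_hasFDerivWithinAt (by simp)] at h1
      obtain ⟨v, hv, -, f', hf', hc⟩ := h1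
      rw [Set.insert_eq_of_mem hx] at hv
      have hc' : ContinuousWithinAt f' v x := hc.continuousWithinAt
      have hev : ∀ᶠ y in nhdsWithin x v, ‖f' y‖ < ‖f' x‖ + 1 :=
        hc'.norm.eventually_lt continuousWithinAt_const (lt_add_one _)
      have hev2 : ∀ᶠ y in nhdsWithin x (closure Ω), ‖f' y‖ < ‖f' x‖ + 1 :=
        nhdsWithin_le_of_mem hv hev
      obtain ⟨O, hOo, hxO, hO⟩ := mem_nhdsWithin.1 hv
      refine ⟨{y | ‖f' y‖ < ‖f' x‖ + 1} ∩ v ∩ O,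
        Filter.inter_mem (Filter.inter_mem hev2 hv)
          (mem_nhdsWithin_of_mem_nhds (hOo.mem_nhds hxO)), ‖f' x‖ + 1, ?_⟩
      rintro y ⟨⟨hy1, hy2⟩, hy3⟩ hyΩ
      have hvy : v ∈ nhds y := Filter.mem_of_superset ((hOo.inter hΩo).mem_nhds ⟨hy3, hyΩ⟩)
        (fun z hz => hO ⟨hz.1, subset_closure hz.2⟩)
      rw [((hf' y hy2).hasFDerivAt hvy).fderiv]
      exact le_of_lt hy1
  obtain ⟨C, hC⟩ := key
  exact ⟨C, fun x hx => hC x (subset_closure hx) hx⟩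

/-- The integral of a directional derivative of a compactly supported `C¹` function vanishes. -/
lemma integral_fderiv_zero_aux {n : ℕ} {Ω K : Set (Fin n → ℝ)} (hΩo : IsOpen Ω)
    (hK : IsCompact K) (hKΩ : K ⊆ Ω) {g : (Fin n → ℝ) → ℝ}
    (hg : ContDiffOn ℝ 1 g Ω) (hg0 : ∀ x ∈ Ω, x ∉ K → g x = 0) (v : Fin n → ℝ) :
    IntegrableOn (fun x => fderiv ℝ g x v) Ω ∧ ∫ x in Ω, fderiv ℝ g x v = 0 := by
  classical
  set f : (Fin n → ℝ) → ℝ := Ω.indicator g with hf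
  have hf0 : ∀ x, x ∉ K → f x = 0 := by
    intro x hx
    by_cases hxΩ : x ∈ Ω
    · rw [hf, Set.indicator_of_mem hxΩ, hg0 x hxΩ hx]
    · rw [hf, Set.indicator_of_notMem hxΩ]
  have hfg : ∀ x ∈ Ω, f =ᶠ[nhds x] g := by
    intro x hx
    filter_upwards [hΩo.mem_nhds hx] with y hy
    rw [hf, Set.indicator_of_mem hy]
  have hfK : ∀ x, x ∉ K → f =ᶠ[nhds x] fun _ => 0 := by
    intro x hx
    filter_upwards [hK.isClosed.isOpen_compl.mem_nhds hx] with y hy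
    exact hf0 y hy
  have hfC : ContDiff ℝ 1 f := by
    rw [contDiff_iff_contDiffAt]
    intro x
    by_cases hx : x ∈ K
    · exact (hg.contDiffAt (hΩo.mem_nhds (hKΩ hx))).congr_of_eventuallyEq (hfg x (hKΩ hx))
    · exact contDiffAt_const.congr_of_eventuallyEq (hfK x hx)
  have hfs : HasCompactSupport f := HasCompactSupport.intro hK hf0
  have hfi : Integrable f := hfC.continuous.integrable_of_hasCompactSupport hfs
  have hdc : Continuous (fun x => fderiv ℝ f x v) :=
    (hfC.continuous_fderiv (by norm_num)).clm_apply continuous_const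
  have hds : HasCompactSupport (fun x => fderiv ℝ f x v) := by
    refine HasCompactSupport.intro hK ?_
    intro x hx
    rw [(hfK x hx).fderiv_eq]
    simp
  have hdi : Integrable (fun x => fderiv ℝ f x v) := hdc.integrable_of_hasCompactSupport hds
  have hz : ∫ x, fderiv ℝ f x v = 0 := by
    have := integral_mul_fderiv_eq_neg_fderiv_mul_of_integrable (𝕜 := ℝ) (μ := volume)
      (f := fun _ : Fin n → ℝ => (1 : ℝ)) (g := f) (v := v) (by simp) (by simpa using hdi)
      (by simpa using hfi) (fun x _ => by fun_prop)
      (fun x _ => (hfC.differentiable (by norm_num)) x)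
    simpa using this
  have heq : ∀ x ∈ Ω, fderiv ℝ f x v = fderiv ℝ g x v := fun x hx => by
    rw [(hfg x hx).fderiv_eq]
  refine ⟨(hdi.integrableOn).congr_fun heq hΩo.measurableSet, ?_⟩
  rw [← setIntegral_congr_fun hΩo.measurableSet heq, ← hz]
  refine setIntegral_eq_integral_of_forall_compl_eq_zero ?_
  intro x hx
  rw [(hfK x (fun h => hx (hKΩ h))).fderiv_eq]
  simp

/-- A smooth truncation. -/
lemma exists_trunc_aux : ∃ (η : ℝ → ℝ) (C : ℝ), ContDiff ℝ 1 η ∧ (∀ t, |t| ≤ 1 → η t = 0) ∧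
    (∀ t, |η t| ≤ |t|) ∧ (∀ t, |deriv η t| ≤ C) ∧ (∀ t, 2 < |t| → η t = t ∧ deriv η t = 1) := by
  have hc : ContDiff ℝ 1 (fun t : ℝ => t * Real.smoothTransition (t ^ 2 - 1)) :=
    contDiff_id.mul (Real.smoothTransition.contDiff.comp (by fun_prop))
  have hbig : ∀ t : ℝ, 2 < |t| → t * Real.smoothTransition (t ^ 2 - 1) = t := by
    intro t ht
    have : (2 : ℝ) ^ 2 < |t| ^ 2 := by gcongr
    rw [sq_abs] at this
    rw [Real.smoothTransition.one_of_one_le (by linarith), mul_one]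
  have hbig' : ∀ t : ℝ, 2 < |t| →
      deriv (fun t : ℝ => t * Real.smoothTransition (t ^ 2 - 1)) t = 1 := by
    intro t ht
    have : (fun t : ℝ => t * Real.smoothTransition (t ^ 2 - 1)) =ᶠ[nhds t] fun t => t := by
      filter_upwards [(isOpen_lt continuous_const continuous_abs).mem_nhds ht] with s hs
      exact hbig s hs
    rw [this.deriv_eq]
    simp
  obtain ⟨C, hC⟩ := (isCompact_Icc (a := (-2 : ℝ)) (b := 2)).exists_bound_of_continuousOn
    (hc.continuous_deriv (by norm_num)).continuousOn
  refine ⟨_, max C 1, hc, ?_, ?_, ?_, fun t ht => ⟨hbig t ht, hbig' t ht⟩⟩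
  · intro t ht
    have : |t| ^ 2 ≤ 1 ^ 2 := by gcongr
    rw [sq_abs] at this
    simp only [Real.smoothTransition.zero_of_nonpos (show t ^ 2 - 1 ≤ 0 by linarith), mul_zero]
  · intro t
    simp only [abs_mul]
    rw [abs_of_nonneg (Real.smoothTransition.nonneg _)]
    exact mul_le_of_le_one_right (abs_nonneg _) (Real.smoothTransition.le_one _)
  · intro t
    by_cases ht : 2 < |t|
    · rw [hbig' t ht]; simp
    · exact (hC t (abs_le.1 (not_lt.1 ht))).trans (le_max_left _ _)

/-- The gradient vanishes almost everywhere on the zero set. -/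
lemma fderiv_zero_ae_aux {n : ℕ} {Ω : Set (Fin n → ℝ)} (hΩo : IsOpen Ω)
    {φ : (Fin n → ℝ) → ℝ} (hφ : ContDiffOn ℝ 1 φ Ω) :
    ∀ᵐ x ∂(volume.restrict Ω), φ x = 0 → fderiv ℝ φ x = 0 := by
  rcases Nat.eq_zero_or_pos n with hn | hn
  · subst hn
    exact Filter.Eventually.of_forall fun x _ => Subsingleton.elim _ _
  have : Nonempty (Fin n) := ⟨⟨0, hn⟩⟩
  obtain ⟨v, hv⟩ := exists_ne (0 : Fin n → ℝ)
  set s : Set (Fin n → ℝ) := Ω ∩ φ ⁻¹' {0} with hs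
  have hsm : MeasurableSet s := by
    have : s = Ω \ (Ω ∩ φ ⁻¹' {0}ᶜ) := by
      ext x; simp [hs]
    rw [this]
    exact hΩo.measurableSet.diff
      (hφ.continuousOn.isOpen_inter_preimage hΩo isOpen_compl_singleton).measurableSet
  have happ : ApproximatesLinearOn (fun x => φ x • v) (0 : (Fin n → ℝ) →L[ℝ] (Fin n → ℝ)) s 0 := by
    intro x hx y hy
    have h1 : φ x = 0 := hx.2
    have h2 : φ y = 0 := hy.2
    simp [h1, h2]
  have hder : ∀ x ∈ s, HasFDerivWithinAt (fun x => φ x • v) ((fderiv ℝ φ x).smulRight v) s x := by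
    intro x hx
    exact (((hφ.differentiableOn (by norm_num)).differentiableAt
      (hΩo.mem_nhds hx.1)).hasFDerivAt.smul_const v).hasFDerivWithinAt
  have := happ.norm_fderiv_sub_le volume hsm _ hder
  rw [ae_restrict_iff' hsm] at this
  rw [ae_restrict_iff' hΩo.measurableSet]
  filter_upwards [this] with x hx hxΩ hφx
  have h := hx ⟨hxΩ, hφx⟩
  simp only [sub_zero, nonpos_iff_eq_zero, nnnorm_eq_zero] at h
  ext y
  have := congrArg (fun L => L y) h
  simpa [hv] using this

/-- Divergence theorem for a field vanishing on the boundary, with no regularity of it. -/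
lemma integral_div_zero_aux {n : ℕ} {Ω : Set (Fin n → ℝ)} (hΩo : IsOpen Ω)
    (hΩb : Bornology.IsBounded Ω) {φ : (Fin n → ℝ) → ℝ} (hφc : ContinuousOn φ (closure Ω))
    (hφ : ContDiffOn ℝ 1 φ Ω) (hφ0 : ∀ x ∈ frontier Ω, φ x = 0)
    {C : ℝ} (hC : ∀ x ∈ Ω, ‖fderiv ℝ φ x‖ ≤ C)
    {V : Fin n → (Fin n → ℝ) → ℝ} (hV : ∀ i, ContDiffOn ℝ 1 (V i) Ω)
    (hV1 : ∀ i, ∀ x ∈ Ω, |V i x| ≤ 1) {D : (Fin n → ℝ) → ℝ}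
    (hD : ∀ x ∈ Ω, ∑ i, fderiv ℝ (V i) x (Pi.single i 1) = D x)
    (hD1 : ∀ x ∈ Ω, |D x| ≤ 1) :
    ∫ x in Ω, ((∑ i, fderiv ℝ φ x (Pi.single i 1) * V i x) + φ x * D x) = 0 := by
  obtain ⟨η, Cη, hη, hη0, hηle, hη', hηbig⟩ := exists_trunc_aux
  have hK : IsCompact (closure Ω) := hΩb.isCompact_closure
  obtain ⟨Cφ, hCφ⟩ := hK.exists_bound_of_continuousOn hφc
  have hηd : Differentiable ℝ η := hη.differentiable (by norm_num)
  set k : ℕ → ℝ := fun m => (m : ℝ) + 1 with hk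
  have hkpos : ∀ m, 0 < k m := fun m => by positivity
  set P : (Fin n → ℝ) → ℝ := fun x => ∑ i, fderiv ℝ φ x (Pi.single i 1) * V i x with hP
  set F : ℕ → (Fin n → ℝ) → ℝ := fun m x =>
    deriv η (k m * φ x) * P x + (η (k m * φ x) / k m) * D x with hF
  have hFint : ∀ m, IntegrableOn (F m) Ω ∧ ∫ x in Ω, F m x = 0 := by
    intro m
    set K : Set (Fin n → ℝ) := closure Ω ∩ (fun x => |k m * φ x|) ⁻¹' Set.Ici 1 with hKdef
    have hKc : IsCompact K := by
      refine hK.of_isClosed_subset ?_ Set.inter_subset_left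
      exact ((continuousOn_const.mul hφc).abs).preimage_isClosed_of_isClosed isClosed_closure
        isClosed_Ici
    have hKΩ : K ⊆ Ω := by
      rintro x ⟨hx1, hx2⟩
      by_contra hx
      have : x ∈ frontier Ω := by
        rw [hΩo.frontier_eq]; exact ⟨hx1, hx⟩
      have h0 := hφ0 x this
      simp only [Set.mem_preimage, h0, mul_zero, abs_zero, Set.mem_Ici] at hx2
      linarith
    have hgi : ∀ i, ContDiffOn ℝ 1 (fun x => (η (k m * φ x) / k m) * V i x) Ω := by
      intro i
      exact ((hη.comp_contDiffOn (contDiffOn_const.mul hφ)).div_const _).mul (hV i)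
    have hg0 : ∀ i, ∀ x ∈ Ω, x ∉ K → (η (k m * φ x) / k m) * V i x = 0 := by
      intro i x hx hxK
      have : |k m * φ x| ≤ 1 := by
        by_contra h
        exact hxK ⟨subset_closure hx, le_of_lt (not_le.1 h)⟩
      rw [hη0 _ this]; simp
    have hA := fun i => integral_fderiv_zero_aux hΩo hKc hKΩ (hgi i) (hg0 i) (Pi.single i 1)
    have hsum : ∀ x ∈ Ω, ∑ i, fderiv ℝ (fun x => (η (k m * φ x) / k m) * V i x) x
        (Pi.single i 1) = F m x := by
      intro x hx
      have hφx : HasFDerivAt φ (fderiv ℝ φ x) x := ((hφ.differentiableOn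
        (by norm_num)).differentiableAt (hΩo.mem_nhds hx)).hasFDerivAt
      have hVx : ∀ i, HasFDerivAt (V i) (fderiv ℝ (V i) x) x := fun i =>
        (((hV i).differentiableOn (by norm_num)).differentiableAt (hΩo.mem_nhds hx)).hasFDerivAt
      have h1 : HasFDerivAt (fun x => η (k m * φ x) / k m) (deriv η (k m * φ x) • fderiv ℝ φ x) x := by
        have h2 := ((hηd (k m * φ x)).hasDerivAt.comp_hasFDerivAt x
          (hφx.const_mul (k m))).mul_const (k m)⁻¹
        refine (h2.congr_fderiv ?_)
        ext y
        have := (hkpos m).ne'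
        simp
        field_simp
      have h3 : ∀ i, fderiv ℝ (fun x => (η (k m * φ x) / k m) * V i x) x (Pi.single i 1)
          = deriv η (k m * φ x) * (fderiv ℝ φ x (Pi.single i 1) * V i x)
            + (η (k m * φ x) / k m) * fderiv ℝ (V i) x (Pi.single i 1) := by
        intro i
        rw [(h1.fun_mul (hVx i)).fderiv]
        simp
        ring
      simp only [h3, Finset.sum_add_distrib, ← Finset.mul_sum, hD x hx, hF, hP]
    constructor
    · exact (integrable_finsetSum Finset.univ (fun i _ => (hA i).1)).congr
        ((ae_restrict_iff' hΩo.measurableSet).2 (Filter.Eventually.of_forall hsum))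
    · rw [← setIntegral_congr_fun hΩo.measurableSet hsum,
        integral_finsetSum _ (fun i _ => (hA i).1)]
      exact Finset.sum_eq_zero (fun i _ => (hA i).2)
  have hPb : ∀ x ∈ Ω, |P x| ≤ n * C := by
    intro x hx
    calc |P x| ≤ ∑ i, |fderiv ℝ φ x (Pi.single i 1) * V i x| := Finset.abs_sum_le_sum_abs _ _
      _ ≤ ∑ i : Fin n, C := by
        refine Finset.sum_le_sum fun i _ => ?_
        rw [abs_mul]
        have h1 : |fderiv ℝ φ x (Pi.single i 1)| ≤ C := by
          have := (fderiv ℝ φ x).le_opNorm (Pi.single i (1 : ℝ))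
          rw [Real.norm_eq_abs, Pi.norm_single] at this
          simp only [norm_one, mul_one] at this
          exact this.trans (hC x hx)
        have := hV1 i x hx
        calc _ ≤ C * 1 := mul_le_mul h1 this (abs_nonneg _) ((abs_nonneg _).trans h1)
          _ = C := mul_one C
      _ = n * C := by simp
  have hfin : volume Ω < ⊤ := hΩb.measure_lt_top
  have hlim := tendsto_integral_of_dominated_convergence (μ := volume.restrict Ω) (F := F)
    (f := fun x => P x + φ x * D x) (fun _ => Cη * (n * C) + Cφ * 1)
    (fun m => (hFint m).1.aestronglyMeasurable)
    (integrableOn_const hfin.ne)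
    (fun m => by
      rw [ae_restrict_iff' hΩo.measurableSet]
      refine Filter.Eventually.of_forall fun x hx => ?_
      simp only [hF, Real.norm_eq_abs]
      refine (abs_add_le _ _).trans ?_
      rw [abs_mul, abs_mul]
      have h1 : |η (k m * φ x) / k m| ≤ Cφ := by
        rw [abs_div, abs_of_pos (hkpos m), div_le_iff₀ (hkpos m)]
        refine (hηle _).trans ?_
        rw [abs_mul, abs_of_pos (hkpos m), mul_comm]
        exact mul_le_mul_of_nonneg_right (hCφ x (subset_closure hx)) (hkpos m).le
      exact add_le_add
        (mul_le_mul (hη' _) (hPb x hx) (abs_nonneg _) ((abs_nonneg _).trans (hη' 0)))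
        (mul_le_mul h1 (hD1 x hx) (abs_nonneg _) ((abs_nonneg _).trans h1)))
    (by
      filter_upwards [fderiv_zero_ae_aux hΩo hφ] with x hx
      by_cases h0 : φ x = 0
      · have hP0 : P x = 0 := by simp [hP, hx h0]
        have hη00 : η 0 = 0 := hη0 0 (by simp)
        simp [hF, hP0, h0, hη00]
      · refine tendsto_const_nhds.congr' ?_
        have hpos : 0 < |φ x| := abs_pos.2 h0
        obtain ⟨N, hN⟩ := exists_nat_gt (2 / |φ x|)
        filter_upwards [Filter.eventually_ge_atTop N] with m hm
        have hkm : 2 / |φ x| < k m := by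
          have : (N : ℝ) ≤ m := by exact_mod_cast hm
          simp only [hk]; linarith
        have hb : 2 < |k m * φ x| := by
          rw [abs_mul, abs_of_pos (hkpos m)]
          exact (div_lt_iff₀ hpos).1 hkm
        have := (hkpos m).ne'
        simp only [hF, (hηbig _ hb).1, (hηbig _ hb).2]
        field_simp)
  have hz : (fun m => ∫ x in Ω, F m x) = fun _ => 0 := funext fun m => (hFint m).2
  rw [hz] at hlim
  exact (tendsto_nhds_unique hlim tendsto_const_nhds)

/-- Cauchy-Schwarz for the upward normals, with the equality case. -/
lemma cs_aux {n : ℕ} (a b : Fin n → ℝ) :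
    (1 + ∑ i, b i * a i) / √(1 + ∑ i, a i ^ 2) ≤ √(1 + ∑ i, b i ^ 2) ∧
    ((1 + ∑ i, b i * a i) / √(1 + ∑ i, a i ^ 2) = √(1 + ∑ i, b i ^ 2) → a = b) := by
  have hA : 0 ≤ ∑ i, a i ^ 2 := Finset.sum_nonneg fun i _ => sq_nonneg _
  have hB : 0 ≤ ∑ i, b i ^ 2 := Finset.sum_nonneg fun i _ => sq_nonneg _
  have hCS : (∑ i, b i * a i) ^ 2 ≤ (∑ i, b i ^ 2) * ∑ i, a i ^ 2 :=
    Finset.sum_mul_sq_le_sq_mul_sq _ _ _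
  have hd : ∑ i, (b i - a i) ^ 2 = (∑ i, b i ^ 2) + (∑ i, a i ^ 2) - 2 * ∑ i, b i * a i := by
    rw [Finset.mul_sum, ← Finset.sum_add_distrib, ← Finset.sum_sub_distrib]
    exact Finset.sum_congr rfl fun i _ => by ring
  have hd0 : 0 ≤ ∑ i, (b i - a i) ^ 2 := Finset.sum_nonneg fun i _ => sq_nonneg _
  have hpos : 0 < √(1 + ∑ i, a i ^ 2) := Real.sqrt_pos.2 (by linarith)
  constructor
  · rw [div_le_iff₀ hpos, ← Real.sqrt_mul (by linarith)]
    apply Real.le_sqrt_of_sq_le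
    nlinarith
  · intro h
    rw [div_eq_iff hpos.ne', ← Real.sqrt_mul (by linarith)] at h
    have h2 : (1 + ∑ i, b i * a i) ^ 2 = (1 + ∑ i, b i ^ 2) * (1 + ∑ i, a i ^ 2) := by
      rw [h, Real.sq_sqrt (by positivity)]
    have h3 : ∑ i, (b i - a i) ^ 2 = 0 := by nlinarith
    rw [Finset.sum_eq_zero_iff_of_nonneg (fun i _ => sq_nonneg _)] at h3
    funext i
    have := h3 i (Finset.mem_univ i)
    have := pow_eq_zero_iff (two_ne_zero) |>.1 this
    linarith

/-- A function with vanishing gradient on a bounded open set and zero boundary values vanishes. -/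
lemma zero_of_fderiv_zero_aux {n : ℕ} (hn : 0 < n) {Ω : Set (Fin n → ℝ)} (hΩo : IsOpen Ω)
    (hΩb : Bornology.IsBounded Ω) {g : (Fin n → ℝ) → ℝ} (hgc : ContinuousOn g (closure Ω))
    (hg : DifferentiableOn ℝ g Ω) (hg' : ∀ x ∈ Ω, fderiv ℝ g x = 0)
    (hg0 : ∀ x ∈ frontier Ω, g x = 0) : ∀ x ∈ Ω, g x = 0 := by
  intro x hx
  by_contra hne
  have : Nonempty (Fin n) := ⟨⟨0, hn⟩⟩
  have ho : IsOpen (Ω ∩ g ⁻¹' {g x}) :=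
    hΩo.isOpen_inter_preimage_of_fderiv_eq_zero hg (fun y hy => hg' y hy) _
  have hEq : Ω ∩ g ⁻¹' {g x} = closure Ω ∩ g ⁻¹' {g x} := by
    ext y
    constructor
    · rintro ⟨h1, h2⟩
      exact ⟨subset_closure h1, h2⟩
    · rintro ⟨h1, h2⟩
      refine ⟨?_, h2⟩
      by_contra h3
      have hf : y ∈ frontier Ω := by
        rw [hΩo.frontier_eq]; exact ⟨h1, h3⟩
      have h4 : g y = g x := h2
      exact hne (by rw [← h4, hg0 y hf])
  have hcl : IsClosed (Ω ∩ g ⁻¹' {g x}) := by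
    rw [hEq]
    exact hgc.preimage_isClosed_of_isClosed isClosed_closure isClosed_singleton
  have huniv : Ω ∩ g ⁻¹' {g x} = Set.univ := IsClopen.eq_univ ⟨hcl, ho⟩ ⟨x, hx, rfl⟩
  have hb : Bornology.IsBounded (Set.univ : Set (Fin n → ℝ)) := by
    rw [← huniv]; exact hΩb.subset Set.inter_subset_left
  exact NormedSpace.unbounded_univ ℝ (Fin n → ℝ) hb


/-- A graphic translator is weighted-area-minimizing among graphs with the same boundary
values: if `u` is a `C²` solution of the graphic translator equation on a bounded open
`Ω ⊆ ℝⁿ`, `u, w` are `C¹` on `closure Ω` and `u = w` on `∂Ω`, then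
`∫_Ω e^u √(1+|∇u|²) ≤ ∫_Ω e^w √(1+|∇w|²)`, with equality iff `w = u` on `Ω`. -/
theorem graphic_translator_weighted_area_minimizing
    (n : ℕ) (Ω : Set (Fin n → ℝ)) (hΩo : IsOpen Ω) (hΩb : Bornology.IsBounded Ω)
    (u w : (Fin n → ℝ) → ℝ)
    (hu1 : ContDiffOn ℝ 1 u (closure Ω)) (hw1 : ContDiffOn ℝ 1 w (closure Ω))
    (hu2 : ContDiffOn ℝ 2 u Ω)
    (heq : ∀ x ∈ Ω,
      ∑ i, fderiv ℝ (fun y => fderiv ℝ u y (Pi.single i 1) /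
              Real.sqrt (1 + ∑ j, (fderiv ℝ u y (Pi.single j 1)) ^ 2)) x (Pi.single i 1)
        = 1 / Real.sqrt (1 + ∑ j, (fderiv ℝ u x (Pi.single j 1)) ^ 2))
    (hbd : ∀ x ∈ frontier Ω, u x = w x) :
    (∫ x in Ω, Real.exp (u x) * Real.sqrt (1 + ∑ i, (fderiv ℝ u x (Pi.single i 1)) ^ 2))
      ≤ (∫ x in Ω, Real.exp (w x) * Real.sqrt (1 + ∑ i, (fderiv ℝ w x (Pi.single i 1)) ^ 2))
    ∧ ((∫ x in Ω, Real.exp (u x) * Real.sqrt (1 + ∑ i, (fderiv ℝ u x (Pi.single i 1)) ^ 2))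
        = (∫ x in Ω, Real.exp (w x) * Real.sqrt (1 + ∑ i, (fderiv ℝ w x (Pi.single i 1)) ^ 2))
      ↔ ∀ x ∈ Ω, w x = u x) := by
  have hMS := hΩo.measurableSet
  rcases Nat.eq_zero_or_pos n with hn | hn
  · subst hn
    have hem : ∀ x, x ∉ Ω := by
      intro x hx
      have := heq x hx
      simp at this
    have : Ω = ∅ := Set.eq_empty_of_forall_notMem hem
    subst this
    simp
  have huO : ContDiffOn ℝ 1 u Ω := hu1.mono subset_closure
  have hwO : ContDiffOn ℝ 1 w Ω := hw1.mono subset_closure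
  have hK : IsCompact (closure Ω) := hΩb.isCompact_closure
  have hfin : volume Ω < ⊤ := hΩb.measure_lt_top
  have hud : ∀ x ∈ Ω, DifferentiableAt ℝ u x := fun x hx =>
    (huO.differentiableOn (by norm_num)).differentiableAt (hΩo.mem_nhds hx)
  have hwd : ∀ x ∈ Ω, DifferentiableAt ℝ w x := fun x hx =>
    (hwO.differentiableOn (by norm_num)).differentiableAt (hΩo.mem_nhds hx)
  set a : Fin n → (Fin n → ℝ) → ℝ := fun i x => fderiv ℝ u x (Pi.single i 1) with ha
  set b : Fin n → (Fin n → ℝ) → ℝ := fun i x => fderiv ℝ w x (Pi.single i 1) with hb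
  set W : (Fin n → ℝ) → ℝ := fun x => √(1 + ∑ j, a j x ^ 2) with hW
  set Z : (Fin n → ℝ) → ℝ := fun x => √(1 + ∑ j, b j x ^ 2) with hZ
  have hsa : ∀ x, 1 ≤ 1 + ∑ j, a j x ^ 2 := fun x =>
    le_add_of_nonneg_right (Finset.sum_nonneg fun i _ => sq_nonneg _)
  have hW1 : ∀ x, 1 ≤ W x := fun x => Real.one_le_sqrt.2 (hsa x)
  have hWsq : ∀ x, W x * W x = 1 + ∑ j, a j x ^ 2 := fun x =>
    Real.mul_self_sqrt (by linarith [hsa x])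
  obtain ⟨Cu, hCu⟩ := fderiv_bdd_aux hΩo hΩb hu1
  obtain ⟨Cw, hCw⟩ := fderiv_bdd_aux hΩo hΩb hw1
  obtain ⟨Bu, hBu⟩ := hK.exists_bound_of_continuousOn hu1.continuousOn
  obtain ⟨Bw, hBw⟩ := hK.exists_bound_of_continuousOn hw1.continuousOn
  have hab : ∀ i, ∀ x ∈ Ω, |a i x| ≤ Cu := fun i x hx => by
    have := (fderiv ℝ u x).le_opNorm (Pi.single i (1 : ℝ))
    rw [Real.norm_eq_abs, Pi.norm_single] at this
    simp only [norm_one, mul_one] at this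
    exact this.trans (hCu x hx)
  have hbb : ∀ i, ∀ x ∈ Ω, |b i x| ≤ Cw := fun i x hx => by
    have := (fderiv ℝ w x).le_opNorm (Pi.single i (1 : ℝ))
    rw [Real.norm_eq_abs, Pi.norm_single] at this
    simp only [norm_one, mul_one] at this
    exact this.trans (hCw x hx)
  have hac : ∀ i, ContinuousOn (a i) Ω := fun i =>
    (huO.continuousOn_fderiv_of_isOpen hΩo le_rfl).clm_apply continuousOn_const
  have hbc : ∀ i, ContinuousOn (b i) Ω := fun i =>
    (hwO.continuousOn_fderiv_of_isOpen hΩo le_rfl).clm_apply continuousOn_const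
  have ha1 : ∀ i, ContDiffOn ℝ 1 (a i) Ω := fun i =>
    (hu2.fderiv_of_isOpen hΩo (by norm_num)).clm_apply contDiffOn_const
  have hWC : ContDiffOn ℝ 1 W Ω := by
    refine ContDiffOn.sqrt ?_ (fun x _ => by linarith [hsa x])
    exact contDiffOn_const.add (ContDiffOn.sum fun i _ => (ha1 i).pow 2)
  have hWc : ContinuousOn W Ω := hWC.continuousOn
  have hZc : ContinuousOn Z Ω :=
    (continuousOn_const.add (continuousOn_finsetSum _ fun i _ => (hbc i).pow 2)).sqrt
  have hucO := huO.continuousOn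
  have hwcO := hwO.continuousOn
  -- integrands
  set Fu : (Fin n → ℝ) → ℝ := fun x => Real.exp (u x) * W x with hFu
  set Fw : (Fin n → ℝ) → ℝ := fun x => Real.exp (w x) * Z x with hFw
  set G : (Fin n → ℝ) → ℝ := fun x =>
    Real.exp (w x) * ((1 + ∑ i, b i x * a i x) / W x) with hG
  have hFuc : ContinuousOn Fu Ω := hucO.rexp.mul hWc
  have hFwc : ContinuousOn Fw Ω := hwcO.rexp.mul hZc
  have hGc : ContinuousOn G Ω := hwcO.rexp.mul
    ((continuousOn_const.add (continuousOn_finsetSum _ fun i _ => (hbc i).mul (hac i))).div hWc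
      (fun x _ => by linarith [hW1 x]))
  have hexpu : ∀ x ∈ Ω, Real.exp (u x) ≤ Real.exp Bu := fun x hx =>
    Real.exp_le_exp.2 ((le_abs_self _).trans (hBu x (subset_closure hx)))
  have hexpw : ∀ x ∈ Ω, Real.exp (w x) ≤ Real.exp Bw := fun x hx =>
    Real.exp_le_exp.2 ((le_abs_self _).trans (hBw x (subset_closure hx)))
  have hint : ∀ (f : (Fin n → ℝ) → ℝ) (M : ℝ), ContinuousOn f Ω → (∀ x ∈ Ω, |f x| ≤ M) →
      IntegrableOn f Ω := fun f M hf hM =>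
    IntegrableOn.of_bound hfin (hf.aestronglyMeasurable hMS) M
      ((ae_restrict_iff' hMS).2 (Filter.Eventually.of_forall hM))
  have hsum_le : ∀ (c : Fin n → ℝ) (M : ℝ), (∀ i, |c i| ≤ M) → ∑ i, c i ^ 2 ≤ n * M ^ 2 := by
    intro c M hc
    calc ∑ i, c i ^ 2 ≤ ∑ _i : Fin n, M ^ 2 :=
          Finset.sum_le_sum fun i _ => sq_le_sq' (abs_le.1 (hc i)).1 (abs_le.1 (hc i)).2
      _ = n * M ^ 2 := by simp
  have hFui : IntegrableOn Fu Ω := by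
    refine hint Fu (Real.exp Bu * √(1 + n * Cu ^ 2)) hFuc fun x hx => ?_
    rw [abs_of_nonneg (mul_nonneg (Real.exp_pos _).le (Real.sqrt_nonneg _))]
    refine mul_le_mul (hexpu x hx) (Real.sqrt_le_sqrt ?_) (Real.sqrt_nonneg _) (Real.exp_pos _).le
    linarith [hsum_le (fun i => a i x) Cu (fun i => hab i x hx)]
  have hFwi : IntegrableOn Fw Ω := by
    refine hint Fw (Real.exp Bw * √(1 + n * Cw ^ 2)) hFwc fun x hx => ?_
    rw [abs_of_nonneg (mul_nonneg (Real.exp_pos _).le (Real.sqrt_nonneg _))]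
    refine mul_le_mul (hexpw x hx) (Real.sqrt_le_sqrt ?_) (Real.sqrt_nonneg _) (Real.exp_pos _).le
    linarith [hsum_le (fun i => b i x) Cw (fun i => hbb i x hx)]
  have hGi : IntegrableOn G Ω := by
    refine hint G (Real.exp Bw * (1 + n * (Cw * Cu))) hGc fun x hx => ?_
    rw [hG, abs_mul, abs_of_pos (Real.exp_pos _)]
    refine mul_le_mul (hexpw x hx) ?_ (abs_nonneg _) (Real.exp_pos _).le
    rw [abs_div, abs_of_pos (show 0 < W x by linarith [hW1 x])]
    refine (div_le_self (abs_nonneg _) (hW1 x)).trans ?_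
    refine (abs_add_le _ _).trans ?_
    rw [abs_one]
    refine add_le_add le_rfl ((Finset.abs_sum_le_sum_abs _ _).trans ?_)
    calc ∑ i, |b i x * a i x| ≤ ∑ _i : Fin n, Cw * Cu := by
          refine Finset.sum_le_sum fun i _ => ?_
          rw [abs_mul]
          exact mul_le_mul (hbb i x hx) (hab i x hx) (abs_nonneg _)
            ((abs_nonneg _).trans (hbb i x hx))
      _ = n * (Cw * Cu) := by simp
  -- the flux identity
  set φ : (Fin n → ℝ) → ℝ := fun x => Real.exp (w x) - Real.exp (u x) with hφ
  have hφ1 : ContDiffOn ℝ 1 φ (closure Ω) := hw1.exp.sub hu1.exp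
  obtain ⟨Cφ, hCφ⟩ := fderiv_bdd_aux hΩo hΩb hφ1
  have hflux0 := integral_div_zero_aux hΩo hΩb (φ := φ) hφ1.continuousOn
    (hφ1.mono subset_closure) (fun x hx => by simp [hφ, hbd x hx]) hCφ
    (V := fun i x => a i x / W x)
    (fun i => (ha1 i).div hWC (fun x _ => by linarith [hW1 x]))
    (fun i x hx => by
      have hWp : 0 < W x := by linarith [hW1 x]
      rw [abs_div, abs_of_pos hWp, div_le_one hWp]
      apply Real.abs_le_sqrt
      have := Finset.single_le_sum (f := fun j => a j x ^ 2) (fun j _ => sq_nonneg _)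
        (Finset.mem_univ i)
      linarith)
    (D := fun x => 1 / W x) heq
    (fun x hx => by
      have hWp : 0 < W x := by linarith [hW1 x]
      rw [abs_of_pos (by positivity), div_le_one hWp]
      exact hW1 x)
  have hpt : ∀ x ∈ Ω, ((∑ i, fderiv ℝ φ x (Pi.single i 1) * (a i x / W x)) + φ x * (1 / W x))
      = G x - Fu x := by
    intro x hx
    have hWp : W x ≠ 0 := by linarith [hW1 x]
    have h1 : ∀ i, fderiv ℝ φ x (Pi.single i 1)
        = Real.exp (w x) * b i x - Real.exp (u x) * a i x := by
      intro i
      rw [((hwd x hx).hasFDerivAt.exp.fun_sub (hud x hx).hasFDerivAt.exp).fderiv]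
      simp [ha, hb]
    have h2 : ∑ i, fderiv ℝ φ x (Pi.single i 1) * (a i x / W x)
        = (Real.exp (w x) * (∑ i, b i x * a i x) - Real.exp (u x) * ∑ i, a i x ^ 2) / W x := by
      rw [Finset.mul_sum, Finset.mul_sum, ← Finset.sum_sub_distrib, Finset.sum_div]
      refine Finset.sum_congr rfl fun i _ => ?_
      rw [h1]; ring
    have h3 : W x = (1 + ∑ j, a j x ^ 2) / W x := by
      rw [← hWsq x]; field_simp
    have h4 : Fu x = Real.exp (u x) * ((1 + ∑ j, a j x ^ 2) / W x) := by
      rw [← h3]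
    rw [h2, h4, hG, hφ]
    field_simp
    ring
  rw [setIntegral_congr_fun hMS hpt, integral_sub hGi hFui] at hflux0
  have hle : ∀ x, G x ≤ Fw x := fun x =>
    mul_le_mul_of_nonneg_left (cs_aux (fun i => a i x) (fun i => b i x)).1 (Real.exp_pos _).le
  have hmono : ∫ x in Ω, G x ≤ ∫ x in Ω, Fw x := integral_mono hGi hFwi hle
  change (∫ x in Ω, Fu x) ≤ (∫ x in Ω, Fw x) ∧
    ((∫ x in Ω, Fu x) = (∫ x in Ω, Fw x) ↔ ∀ x ∈ Ω, w x = u x)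
  refine ⟨by linarith, ?_, ?_⟩
  · intro hE
    have hz : ∫ x in Ω, (Fw x - G x) = 0 := by
      rw [integral_sub hFwi hGi]; linarith
    rw [setIntegral_eq_zero_iff_of_nonneg_ae
      (Filter.Eventually.of_forall fun x => sub_nonneg.2 (hle x)) (hFwi.sub hGi)] at hz
    have hzz := Measure.eqOn_open_of_ae_eq hz hΩo (hFwc.sub hGc) continuousOn_const
    have hgrad : ∀ x ∈ Ω, fderiv ℝ u x = fderiv ℝ w x := by
      intro x hx
      have h1 : Fw x - G x = 0 := hzz hx
      have h2 : Real.exp (w x) * ((1 + ∑ i, b i x * a i x) / W x) = Real.exp (w x) * Z x := by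
        change G x = Fw x
        linarith
      have h3 := mul_left_cancel₀ (Real.exp_pos _).ne' h2
      have h4 := (cs_aux (fun i => a i x) (fun i => b i x)).2 h3
      apply ContinuousLinearMap.coe_injective
      refine LinearMap.pi_ext' fun i => ?_
      ext
      simpa using congrFun h4 i
    have := zero_of_fderiv_zero_aux hn hΩo hΩb (g := fun x => w x - u x)
      (hw1.continuousOn.sub hu1.continuousOn)
      (fun x hx => ((hwd x hx).sub (hud x hx)).differentiableWithinAt)
      (fun x hx => by rw [fderiv_fun_sub (hwd x hx) (hud x hx), hgrad x hx, sub_self])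
      (fun x hx => by rw [hbd x hx, sub_self])
    exact fun x hx => sub_eq_zero.1 (this x hx)
  · intro hE
    refine setIntegral_congr_fun hMS fun x hx => ?_
    have : w =ᶠ[nhds x] u := by
      filter_upwards [hΩo.mem_nhds hx] with y hy
      exact hE y hy
    simp only [hFu, hFw, hW, hZ, ha, hb, this.fderiv_eq, hE x hx]
end

section
/- Let n ≥ 1, m ≥ 2, and let u = (u¹, …, uᵐ) : ℝⁿ → ℝᵐ be a smooth map. For x ∈ ℝⁿ let g(x) be the n×n matrix with entries g_{ij}(x) = δ_{ij} + Σ_{α=1}^m ∂_i u^α(x)·∂_j u^α(x), and let g^{ij} denote the entries of g(x)⁻¹. Suppose there is a unit vector (V₁, …, V_n, V_{n+1}, …, V_{n+m}) ∈ ℝ^{n+m} such that for every α ∈ {1, …, m} and every x ∈ ℝⁿ: Σ_{i,j=1}^n g^{ij}(x) ∂_i∂_j u^α(x) = V_{n+α} − Σ_{i=1}^n ∂_i u^α(x)·V_i. If there is a constant v₁ < 2·3^{2/3}/(1 + 3^{2/3}) such that √(det g(x)) ≤ v₁ for all x ∈ ℝⁿ, then u is affine linear: there exist a constant m×n real matrix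 A and a vector b ∈ ℝᵐ with u(x) = A x + b for all x. -/
set_option linter.unusedSectionVars false

namespace GTB

section Alg

variable {R : Type*} [CommRing R] [Algebra ℝ R]
  {ι : Type*} [Fintype ι] [DecidableEq ι]

/-- entrywise derivative of a matrix -/
def mD {κ₁ κ₂ : Type*} (δ : Derivation ℝ R R) (M : Matrix κ₁ κ₂ R) : Matrix κ₁ κ₂ R := M.map δ

@[simp] lemma mD_apply {κ₁ κ₂ : Type*} (δ : Derivation ℝ R R) (M : Matrix κ₁ κ₂ R) (a : κ₁)
    (b : κ₂) : mD δ M a b = δ (M a b) := rfl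

lemma der_mul (δ : Derivation ℝ R R) (a b : R) : δ (a * b) = δ a * b + a * δ b := by
  rw [δ.leibniz]; simp only [smul_eq_mul]; ring

lemma mD_mul {κ₁ κ₂ κ₃ : Type*} [Fintype κ₂] (δ : Derivation ℝ R R) (M : Matrix κ₁ κ₂ R)
    (M' : Matrix κ₂ κ₃ R) : mD δ (M * M') = mD δ M * M' + M * mD δ M' := by
  ext a b
  simp only [mD_apply, Matrix.mul_apply, map_sum, Matrix.add_apply, der_mul,
    Finset.sum_add_distrib]

lemma mD_add {κ₁ κ₂ : Type*} (δ : Derivation ℝ R R) (M M' : Matrix κ₁ κ₂ R) :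
    mD δ (M + M') = mD δ M + mD δ M' := by
  ext a b; simp

lemma mD_sub {κ₁ κ₂ : Type*} (δ : Derivation ℝ R R) (M M' : Matrix κ₁ κ₂ R) :
    mD δ (M - M') = mD δ M - mD δ M' := by
  ext a b; simp

lemma mD_smul {κ₁ κ₂ : Type*} (δ : Derivation ℝ R R) (r : R) (M : Matrix κ₁ κ₂ R) :
    mD δ (r • M) = δ r • M + r • mD δ M := by
  ext a b; simp [mul_comm]; ring

lemma mD_sum {κ₁ κ₂ σ : Type*} (δ : Derivation ℝ R R) (s : Finset σ) (M : σ → Matrix κ₁ κ₂ R) :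
    mD δ (∑ i ∈ s, M i) = ∑ i ∈ s, mD δ (M i) := by
  ext a b; simp [Matrix.sum_apply]

lemma mD_transpose {κ₁ κ₂ : Type*} (δ : Derivation ℝ R R) (M : Matrix κ₁ κ₂ R) :
    mD δ M.transpose = (mD δ M).transpose := rfl

lemma mD_one (δ : Derivation ℝ R R) : mD δ (1 : Matrix ι ι R) = 0 := by
  ext a b
  by_cases h : a = b
  · subst h; simp
  · simp [Matrix.one_apply_ne h]

lemma mD_trace (δ : Derivation ℝ R R) (M : Matrix ι ι R) :
    δ M.trace = (mD δ M).trace := by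
  simp [Matrix.trace]

/-- Jacobi's formula for a derivation -/
lemma der_det (δ : Derivation ℝ R R) (M N : Matrix ι ι R) (h : M * N = 1) :
    δ M.det = M.det * (N * mD δ M).trace := by
  let φ : R →+* DualNumber R :=
    { toFun := fun a => TrivSqZeroExt.inl a + TrivSqZeroExt.inr (δ a)
      map_one' := by simp
      map_zero' := by simp
      map_mul' := by
        intro a b
        ext
        · simp
        · simp only [der_mul]; simp; ring
      map_add' := by
        intro a b
        ext <;> simp }
  have e1 : φ M.det = (φ.mapMatrix M).det := RingHom.map_det φ M
  have e2 : φ.mapMatrix M = (TrivSqZeroExt.inlHom R R).mapMatrix M *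
      (1 + (DualNumber.eps : DualNumber R) • (TrivSqZeroExt.inlHom R R).mapMatrix (N * mD δ M)) := by
    rw [mul_add, mul_one, Matrix.mul_smul, ← map_mul, ← mul_assoc, h, one_mul]
    ext a b
    · simp [φ]
    · simp [φ]
  have e3 : ((1 : Matrix ι ι (DualNumber R)) + (DualNumber.eps : DualNumber R) •
      (TrivSqZeroExt.inlHom R R).mapMatrix (N * mD δ M)).det
      = 1 + TrivSqZeroExt.inr ((N * mD δ M).trace) := by
    rw [Matrix.det_one_add_smul]
    have e4 : ((TrivSqZeroExt.inlHom R R).mapMatrix (N * mD δ M)).trace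
        = TrivSqZeroExt.inl ((N * mD δ M).trace) := by
      rw [Matrix.trace, Matrix.trace]
      exact (map_sum (TrivSqZeroExt.inlHom R R) _ _).symm
    rw [sq, DualNumber.eps_mul_eps, mul_zero, add_zero, e4]
    ext <;> simp
  rw [e2, Matrix.det_mul, e3, ← RingHom.map_det] at e1
  have := congrArg TrivSqZeroExt.snd e1
  simpa [φ] using this


/-- Data: commuting derivations, the projection `Pi`, the frame matrix `F`. -/
structure GData (R : Type*) [CommRing R] [Algebra ℝ R] (ι : Type*) [Fintype ι] [DecidableEq ι] where
  d : ι → Derivation ℝ R R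
  Pi : Matrix ι ι R
  F : Matrix ι ι R
  V : ι → R
  comm : ∀ i j a, d i (d j a) = d j (d i a)
  hV : ∀ i j, d i (V j) = 0
  symm : Pi.transpose = Pi
  idem : Pi * Pi = Pi
  PiF : Pi * F = F
  FPi : F * Pi = Pi
  FdF : ∀ i, F * mD (d i) F = 0
  cod : ∀ i j a, d i (F a j) = d j (F a i)
  LF : ∀ a k, ∑ i, ∑ j, Pi i j * d i (d j (F a k)) + ∑ i, V i * d i (F a k)
    = - ∑ i, ∑ j, d k (Pi i j) * d i (F a j)

namespace GData
variable (S : GData R ι)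

/-- the drift Laplacian -/
def L (a : R) : R := ∑ i, ∑ j, S.Pi i j * S.d i (S.d j a) + ∑ i, S.V i * S.d i a

/-- carré du champ -/
def Gam (a b : R) : R := ∑ i, ∑ j, S.Pi i j * (S.d i a * S.d j b)

/-- entrywise drift Laplacian -/
def mL (M : Matrix ι ι R) : Matrix ι ι R := M.map S.L

/-- derivative of the projection -/
def P (i : ι) : Matrix ι ι R := mD (S.d i) S.Pi

lemma mL_apply (M : Matrix ι ι R) (a b : ι) : S.mL M a b = S.L (M a b) := rfl

lemma L_add (a b : R) : S.L (a + b) = S.L a + S.L b := by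
  simp only [L, map_add, mul_add, Finset.sum_add_distrib]; ring

lemma L_zero : S.L 0 = 0 := by simp [L]

lemma L_sum {σ : Type*} (s : Finset σ) (f : σ → R) : S.L (∑ i ∈ s, f i) = ∑ i ∈ s, S.L (f i) := by
  classical
  induction s using Finset.induction_on with
  | empty => simp [L_zero]
  | insert a s ha ih => rw [Finset.sum_insert ha, Finset.sum_insert ha, L_add, ih]

lemma Pi_symm (i j : ι) : S.Pi i j = S.Pi j i := by
  conv_lhs => rw [← S.symm]
  rfl

lemma Gam_comm (a b : R) : S.Gam a b = S.Gam b a := by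
  rw [Gam, Gam, Finset.sum_comm]
  refine Finset.sum_congr rfl fun i _ => Finset.sum_congr rfl fun j _ => ?_
  rw [S.Pi_symm j i]; ring

lemma L_mul (a b : R) : S.L (a * b) = S.L a * b + a * S.L b + 2 * S.Gam a b := by
  have h1 : S.L (a * b) = S.L a * b + a * S.L b + S.Gam a b + S.Gam b a := by
    simp only [L, Gam, der_mul, map_add, mul_add, Finset.sum_add_distrib, Finset.sum_mul,
      Finset.mul_sum, add_mul]
    have e1 : ∀ i j, S.Pi i j * (S.d i (S.d j a) * b) = S.Pi i j * S.d i (S.d j a) * b :=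
      fun i j => by ring
    have e2 : ∀ i j, S.Pi i j * (a * S.d i (S.d j b)) = a * (S.Pi i j * S.d i (S.d j b)) :=
      fun i j => by ring
    have e3 : ∀ i, S.V i * (S.d i a * b) = S.V i * S.d i a * b := fun i => by ring
    have e4 : ∀ i, S.V i * (a * S.d i b) = a * (S.V i * S.d i b) := fun i => by ring
    have e5 : ∀ i j, S.Pi i j * (S.d j a * S.d i b) = S.Pi i j * (S.d i b * S.d j a) :=
      fun i j => by ring
    simp only [e1, e2, e3, e4, e5]
    ring
  rw [h1, S.Gam_comm b a]; ring

/-- commuting a derivative with `L` -/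
lemma L_der (k : ι) (a : R) : S.L (S.d k a) = S.d k (S.L a)
    - ∑ i, ∑ j, S.P k i j * S.d i (S.d j a) := by
  simp only [L, map_add, map_sum, der_mul, Finset.sum_add_distrib, S.hV, zero_mul, zero_add, P,
    mD_apply]
  have e : ∀ i j, S.d k (S.d i (S.d j a)) = S.d i (S.d j (S.d k a)) := fun i j => by
    rw [S.comm k i, S.comm k j]
  have e' : ∀ i, S.d k (S.d i a) = S.d i (S.d k a) := fun i => S.comm k i a
  simp only [e, e']
  ring

lemma P_symm (i : ι) : (S.P i).transpose = S.P i := by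
  rw [P, ← mD_transpose, S.symm]

lemma P_idem (i : ι) : S.P i * S.Pi + S.Pi * S.P i = S.P i := by
  have := congrArg (mD (S.d i)) S.idem
  rwa [mD_mul] at this

/-- Matrix of mixed products of derivatives of two matrices, contracted with the projection -/
def mGam (M M' : Matrix ι ι R) : Matrix ι ι R :=
  ∑ i, ∑ j, S.Pi i j • (mD (S.d i) M * mD (S.d j) M')

lemma mL_mul (M M' : Matrix ι ι R) : S.mL (M * M') = S.mL M * M' + M * S.mL M'
    + (2 : R) • S.mGam M M' := by
  ext a b
  simp only [mL_apply, Matrix.mul_apply, L_sum, L_mul, Matrix.add_apply, Finset.sum_add_distrib,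
    Matrix.smul_apply, mGam, Matrix.sum_apply, smul_eq_mul, Gam, mD_apply]
  congr 1
  rw [← Finset.mul_sum, Finset.sum_comm]
  congr 1
  refine Finset.sum_congr rfl fun i _ => ?_
  rw [Finset.sum_comm]
  refine Finset.sum_congr rfl fun j _ => ?_
  rw [Finset.mul_sum]

/-- `Q = ∑ Pi i j P i P j` -/
def Q : Matrix ι ι R := S.mGam S.Pi S.Pi

lemma PF_eq (i : ι) : S.P i * S.F = mD (S.d i) S.F - S.Pi * mD (S.d i) S.F := by
  have := congrArg (mD (S.d i)) S.PiF
  rw [mD_mul] at this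
  rw [eq_sub_iff_add_eq]
  exact this

end GData
end Alg
end GTB

namespace GTB
section Alg
variable {R : Type*} [CommRing R] [Algebra ℝ R]
  {ι : Type*} [Fintype ι] [DecidableEq ι]
namespace GData
variable (S : GData R ι)

lemma FF : S.F * S.F = S.F := by
  calc S.F * S.F = S.F * (S.Pi * S.F) := by rw [S.PiF]
    _ = S.F := by rw [← mul_assoc, S.FPi, S.PiF]

lemma dF_eq (i : ι) : mD (S.d i) S.F = S.P i * S.F - S.F * S.P i * S.F := by
  have h1 := congrArg (mD (S.d i)) S.FF
  rw [mD_mul, S.FdF, add_zero] at h1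
  have h2 := congrArg (mD (S.d i)) S.FPi
  rw [mD_mul] at h2
  have h3 : mD (S.d i) S.F * S.Pi = S.P i - S.F * S.P i := by
    rw [eq_sub_iff_add_eq]; exact h2
  calc mD (S.d i) S.F = mD (S.d i) S.F * S.Pi * S.F := by rw [mul_assoc, S.PiF, h1]
    _ = _ := by rw [h3, sub_mul]

lemma PF_cod (i j a : ι) : (S.P i * S.F) a j = (S.P j * S.F) a i := by
  rw [PF_eq, PF_eq]
  simp only [Matrix.sub_apply, Matrix.mul_apply, mD_apply]
  rw [S.cod i j]
  congr 1
  exact Finset.sum_congr rfl fun b _ => by rw [S.cod i j]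

lemma mul_dF_cod (M : Matrix ι ι R) (i j a : ι) :
    (M * mD (S.d i) S.F) a j = (M * mD (S.d j) S.F) a i := by
  simp only [Matrix.mul_apply, mD_apply]
  exact Finset.sum_congr rfl fun b _ => by rw [S.cod i j]

lemma P_Pi (k : ι) : S.P k * S.Pi = S.P k - S.Pi * S.P k := by
  rw [eq_sub_iff_add_eq]; exact S.P_idem k

lemma Pi_P_Pi (k : ι) : S.Pi * S.P k * S.Pi = 0 := by
  rw [mul_assoc, P_Pi, mul_sub, ← mul_assoc, S.idem, sub_self]

lemma F_P_Pi (k : ι) : S.F * (S.P k * S.Pi) = - (S.Pi * mD (S.d k) S.F * S.Pi) := by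
  have : S.P k * S.Pi = S.P k * S.F * S.Pi := by rw [mul_assoc, S.FPi]
  rw [this, PF_eq, sub_mul, mul_sub, ← mul_assoc, S.FdF, zero_mul, zero_sub, ← mul_assoc,
    ← mul_assoc, S.FPi]

lemma sum_P_c (k a : ι) : ∑ i, ∑ j, S.P k i j * (S.P i * S.F) a j
    = -2 * ∑ j, (S.P j * (S.Pi * mD (S.d k) S.F * S.Pi)) a j := by
  have e1 : ∀ i j, S.P k i j = (S.P k * S.Pi) i j + (S.P k * S.Pi) j i := by
    intro i j
    have h1 : (S.P k * S.Pi) j i = (S.Pi * S.P k) i j := by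
      have : (S.P k * S.Pi).transpose = S.Pi * S.P k := by
        rw [Matrix.transpose_mul, S.symm, S.P_symm]
      rw [← this]; rfl
    rw [h1, ← Matrix.add_apply, S.P_idem]
  have e2 : ∑ i, ∑ j, S.P k i j * (S.P i * S.F) a j
      = 2 * ∑ i, ∑ j, (S.P k * S.Pi) i j * (S.P i * S.F) a j := by
    simp only [e1, add_mul, Finset.sum_add_distrib]
    rw [two_mul]
    congr 1
    rw [Finset.sum_comm]
    refine Finset.sum_congr rfl fun i _ => Finset.sum_congr rfl fun j _ => ?_
    rw [S.PF_cod]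
  rw [e2, neg_mul, ← mul_neg, ← Finset.sum_neg_distrib, Finset.sum_comm]
  congr 1
  refine Finset.sum_congr rfl fun j _ => ?_
  have e3 : -(S.P j * (S.Pi * mD (S.d k) S.F * S.Pi)) a j
      = (S.P j * S.F * (S.P k * S.Pi)) a j := by
    rw [← Matrix.neg_apply, ← Matrix.mul_neg, ← F_P_Pi, mul_assoc (S.P j)]
  rw [e3, Matrix.mul_apply (M := S.P j * S.F)]
  refine Finset.sum_congr rfl fun i _ => ?_
  rw [S.PF_cod i j]; ring

lemma Pi_mGam : S.mGam S.Pi S.F - S.Pi * S.mGam S.Pi S.F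
    = ∑ i, ∑ j, S.Pi i j • (S.P i * S.Pi * mD (S.d j) S.F) := by
  rw [mGam, Finset.mul_sum, ← Finset.sum_sub_distrib]
  refine Finset.sum_congr rfl fun i _ => ?_
  rw [Finset.mul_sum, ← Finset.sum_sub_distrib]
  refine Finset.sum_congr rfl fun j _ => ?_
  rw [Matrix.mul_smul, ← smul_sub, S.P_Pi, sub_mul, mul_assoc S.Pi]
  rfl

lemma key1 : S.mL S.F - S.Pi * S.mL S.F
    = (2 : R) • (S.mGam S.Pi S.F - S.Pi * S.mGam S.Pi S.F) := by
  rw [Pi_mGam]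
  ext a k
  have hLF : ∀ b, S.mL S.F b k = - ∑ i, ∑ j, S.P k i j * S.d i (S.F b j) :=
    fun b => S.LF b k
  have h1 : (S.mL S.F - S.Pi * S.mL S.F) a k = - ∑ i, ∑ j, S.P k i j * (S.P i * S.F) a j := by
    rw [Matrix.sub_apply, Matrix.mul_apply]
    simp only [hLF, PF_eq, Matrix.sub_apply]
    simp only [Matrix.mul_apply, mD_apply, mul_sub,
      Finset.sum_sub_distrib, mul_neg, Finset.mul_sum, Finset.sum_neg_distrib]
    have : ∑ b, ∑ i, ∑ j, S.Pi a b * (S.P k i j * S.d i (S.F b j))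
        = ∑ i, ∑ j, ∑ b, S.P k i j * (S.Pi a b * S.d i (S.F b j)) := by
      rw [Finset.sum_comm]
      refine Finset.sum_congr rfl fun i _ => ?_
      rw [Finset.sum_comm]
      exact Finset.sum_congr rfl fun j _ => Finset.sum_congr rfl fun b _ => by ring
    rw [this]; ring
  rw [h1, sum_P_c, neg_mul, neg_neg, Matrix.smul_apply, smul_eq_mul]
  congr 1
  rw [Matrix.sum_apply]
  refine Finset.sum_congr rfl fun i _ => ?_
  rw [Matrix.sum_apply, ← mul_assoc, Matrix.mul_apply (N := S.Pi)]
  refine Finset.sum_congr rfl fun j _ => ?_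
  rw [Matrix.smul_apply, smul_eq_mul, S.mul_dF_cod, S.Pi_symm, mul_comm, ← mul_assoc]

lemma offdiag : S.mL S.Pi * S.Pi = S.Pi * S.mL S.Pi * S.Pi := by
  have h := S.mL_mul S.Pi S.F
  rw [S.PiF] at h
  have h2 : S.mL S.Pi * S.F = S.mL S.F - S.Pi * S.mL S.F - (2 : R) • S.mGam S.Pi S.F := by
    generalize S.mL S.F = A at h ⊢
    generalize S.mL S.Pi * S.F = B at h ⊢
    rw [sub_sub, eq_sub_iff_add_eq, ← add_assoc]; exact h.symm
  have h3 : S.mL S.Pi * S.F = S.Pi * (S.mL S.Pi * S.F) := by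
    rw [h2, mul_sub, mul_sub, ← mul_assoc S.Pi S.Pi, S.idem, sub_self, zero_sub, key1, smul_sub,
      Matrix.mul_smul]
    abel
  calc S.mL S.Pi * S.Pi = S.mL S.Pi * S.F * S.Pi := by rw [mul_assoc, S.FPi]
    _ = S.Pi * (S.mL S.Pi * S.F) * S.Pi := by rw [← h3]
    _ = _ := by rw [mul_assoc, mul_assoc, S.FPi, mul_assoc]

lemma mL_symm : (S.mL S.Pi).transpose = S.mL S.Pi := by
  ext a b
  rw [Matrix.transpose_apply, mL_apply, mL_apply, S.Pi_symm]

lemma offdiag' : S.Pi * S.mL S.Pi = S.Pi * S.mL S.Pi * S.Pi := by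
  have := congrArg Matrix.transpose S.offdiag
  simp only [Matrix.transpose_mul, S.symm, S.mL_symm] at this
  rw [← mul_assoc] at this; exact this

lemma PP_comm (i j : ι) : S.Pi * (S.P i * S.P j) = S.P i * S.P j * S.Pi := by
  have h1 := S.P_Pi i
  have h2 := S.P_Pi j
  have h3 : S.Pi * S.P i = S.P i - S.P i * S.Pi := by rw [h1]; abel
  rw [← mul_assoc, h3, sub_mul, mul_assoc (S.P i), mul_assoc (S.P i), h2, mul_sub]

lemma Q_comm : S.Pi * S.Q = S.Q * S.Pi := by
  rw [Q, mGam, Finset.mul_sum, Finset.sum_mul]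
  refine Finset.sum_congr rfl fun i _ => ?_
  rw [Finset.mul_sum, Finset.sum_mul]
  refine Finset.sum_congr rfl fun j _ => ?_
  rw [Matrix.mul_smul, Matrix.smul_mul]
  congr 1
  exact S.PP_comm i j

/-- The Gauss map is (V-)harmonic. -/
lemma mL_Pi : S.mL S.Pi = (2 : R) • S.Q - (4 : R) • (S.Pi * S.Q) := by
  have h := S.mL_mul S.Pi S.Pi
  rw [S.idem] at h
  change _ = _ + (2 : R) • S.Q at h
  have h1 := S.offdiag
  have h2 := S.offdiag'
  have h : S.mL S.Pi = S.Pi * S.mL S.Pi * S.Pi + S.Pi * S.mL S.Pi * S.Pi + (2 : R) • S.Q := by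
    rw [← h2]; rw [h1, ← h2] at h; exact h
  have h3 : S.Pi * S.mL S.Pi * S.Pi = -((2 : R) • (S.Pi * S.Q)) := by
    have := congrArg (fun M => S.Pi * M * S.Pi) h
    simp only [mul_add, add_mul] at this
    have e : S.Pi * (S.Pi * S.mL S.Pi * S.Pi) * S.Pi = S.Pi * S.mL S.Pi * S.Pi := by
      rw [mul_assoc, mul_assoc, mul_assoc, S.idem, ← mul_assoc, ← mul_assoc, S.idem, mul_assoc]
    have e2 : S.Pi * ((2 : R) • S.Q) * S.Pi = (2 : R) • (S.Pi * S.Q) := by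
      rw [Matrix.mul_smul, Matrix.smul_mul, Q_comm, mul_assoc, S.idem]
    rw [e, e2] at this
    generalize S.Pi * S.mL S.Pi * S.Pi = A at this ⊢
    generalize (2 : R) • (S.Pi * S.Q) = B at this ⊢
    have h5 : A + (A + B) = A + 0 := by rw [add_zero, ← add_assoc]; exact this.symm
    exact eq_neg_of_add_eq_zero_left (add_left_cancel h5)
  rw [h3] at h
  rw [h]
  have : (4 : R) • (S.Pi * S.Q) = (2 : R) • (S.Pi * S.Q) + (2 : R) • (S.Pi * S.Q) := by
    rw [← add_smul]; norm_num
  rw [this]; abel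

end GData
end Alg
end GTB

namespace GTB
section Alg
variable {R : Type*} [CommRing R] [Algebra ℝ R]
  {ι : Type*} [Fintype ι] [DecidableEq ι]
namespace GData
variable (S : GData R ι)

/-- tangential derivatives of the projection -/
def X (A : ι) : Matrix ι ι R := ∑ i, S.Pi A i • S.P i

lemma sum_Pi (f : ι → ι → R) : ∑ i, ∑ j, S.Pi i j * f i j
    = ∑ A, ∑ i, ∑ j, S.Pi A i * (S.Pi A j * f i j) := by
  have : ∀ i j, S.Pi i j = ∑ A, S.Pi A i * S.Pi A j := by
    intro i j
    conv_lhs => rw [← S.idem, Matrix.mul_apply]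
    exact Finset.sum_congr rfl fun A _ => by rw [S.Pi_symm i A]
  have h2 : ∀ i j, S.Pi i j * f i j = ∑ A, S.Pi A i * (S.Pi A j * f i j) := by
    intro i j
    rw [this i j, Finset.sum_mul]
    exact Finset.sum_congr rfl fun A _ => by ring
  rw [Finset.sum_congr rfl fun i _ => Finset.sum_congr rfl fun j _ => h2 i j]
  rw [Finset.sum_comm_cycle]

lemma Q_trace : S.Q.trace = 2 * (S.Q * S.Pi).trace := by
  have e : ∀ i j, (S.P i * S.P j).trace
      = (S.P i * S.P j * S.Pi).trace + (S.P j * S.P i * S.Pi).trace := by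
    intro i j
    have h : S.P i * S.P j = S.P i * S.P j * S.Pi + S.P i * (S.Pi * S.P j) := by
      rw [mul_assoc, ← mul_add, S.P_idem]
    have h2 : (S.P i * (S.Pi * S.P j)).trace = (S.P j * S.P i * S.Pi).trace := by
      rw [← mul_assoc, Matrix.trace_mul_comm, mul_assoc]
    rw [← h2, ← Matrix.trace_add, ← h]
  have q1 : S.Q.trace = ∑ i, ∑ j, S.Pi i j * (S.P i * S.P j).trace := by
    simp only [Q, mGam, Matrix.trace_sum, Matrix.trace_smul, smul_eq_mul]; rfl
  have q2 : (S.Q * S.Pi).trace = ∑ i, ∑ j, S.Pi i j * (S.P i * S.P j * S.Pi).trace := by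
    simp only [Q, mGam, Finset.sum_mul, Matrix.smul_mul, Matrix.trace_sum, Matrix.trace_smul,
      smul_eq_mul]; rfl
  rw [q1, q2]
  simp only [e, mul_add, Finset.sum_add_distrib]
  rw [two_mul]
  congr 1
  rw [Finset.sum_comm]
  exact Finset.sum_congr rfl fun i _ => Finset.sum_congr rfl fun j _ => by rw [S.Pi_symm]

lemma Q_F : (S.Q * S.F).trace = (S.Q * S.Pi).trace := by
  calc (S.Q * S.F).trace = (S.Q * (S.Pi * S.F)).trace := by rw [S.PiF]
    _ = (S.Pi * (S.Q * S.F)).trace := by rw [← mul_assoc, ← Q_comm, mul_assoc]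
    _ = (S.Q * S.F * S.Pi).trace := by rw [Matrix.trace_mul_comm]
    _ = _ := by rw [mul_assoc, S.FPi]

lemma L_trace_F : (S.mL S.Pi * S.F).trace = - S.Q.trace := by
  rw [mL_Pi, sub_mul, Matrix.smul_mul, Matrix.smul_mul, Q_comm, mul_assoc, S.PiF,
    Matrix.trace_sub, Matrix.trace_smul, Matrix.trace_smul, Q_F, Q_trace]
  simp only [smul_eq_mul]; ring

lemma mL_eq (M : Matrix ι ι R) : S.mL M = ∑ i, ∑ j, S.Pi i j • mD (S.d i) (mD (S.d j) M)
    + ∑ i, S.V i • mD (S.d i) M := by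
  ext a b
  simp [mL_apply, L, Matrix.sum_apply]

lemma L_w (w : R) (hw : ∀ i, S.d i w = w * (S.P i * S.F).trace) :
    2 * S.L w = w * (- S.Q.trace + 2 * ∑ A, ((S.X A * S.F).trace ^ 2
      - (S.X A * S.F * (S.X A * S.F)).trace)) := by
  have e1 : ∀ i j, S.d i (S.d j w) = w * ((S.P i * S.F).trace * (S.P j * S.F).trace
      + (mD (S.d i) (S.P j) * S.F).trace + (S.P j * S.P i * S.F).trace
      - (S.P i * S.F * (S.P j * S.F)).trace) := by
    intro i j
    rw [Matrix.trace_mul_comm (S.P i * S.F), hw j, der_mul, hw i, mD_trace, mD_mul, dF_eq, Matrix.trace_add, mul_sub, Matrix.trace_sub]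
    simp only [mul_assoc]
    ring
  have e2 : S.L w = w * (∑ i, ∑ j, S.Pi i j * ((S.P i * S.F).trace * (S.P j * S.F).trace
      - (S.P i * S.F * (S.P j * S.F)).trace) + (S.mL S.Pi * S.F).trace + (S.Q * S.F).trace) := by
    rw [mL_eq, add_mul, Matrix.trace_add]
    have q2 : (S.Q * S.F).trace = ∑ i, ∑ j, S.Pi i j * (S.P j * S.P i * S.F).trace := by
      rw [Finset.sum_comm]
      simp only [Q, mGam, Finset.sum_mul, Matrix.smul_mul, Matrix.trace_sum, Matrix.trace_smul,
        smul_eq_mul]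
      exact Finset.sum_congr rfl fun i _ => Finset.sum_congr rfl fun j _ => by
        rw [S.Pi_symm]; rfl
    rw [q2]
    simp only [L, e1]
    simp only [hw, Finset.sum_mul, Matrix.smul_mul, Matrix.trace_sum, Matrix.trace_smul,
      smul_eq_mul, mul_add, Finset.mul_sum, mul_sub, Finset.sum_add_distrib,
      Finset.sum_sub_distrib]
    have c2 : ∀ i j, mD (S.d i) (mD (S.d j) S.Pi) = mD (S.d i) (S.P j) := fun i j => rfl
    have c3 : ∀ i, mD (S.d i) S.Pi = S.P i := fun i => rfl
    have c4 : ∀ (i j) (r : R), w * (S.Pi i j * r) = S.Pi i j * (w * r) := fun i j r => by ring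
    have c5 : ∀ (i) (r : R), w * (S.V i * r) = S.V i * (w * r) := fun i r => by ring
    simp only [c2, c3, c4, c5]
    ring
  have e3 : ∑ i, ∑ j, S.Pi i j * ((S.P i * S.F).trace * (S.P j * S.F).trace
      - (S.P i * S.F * (S.P j * S.F)).trace) = ∑ A, ((S.X A * S.F).trace ^ 2
      - (S.X A * S.F * (S.X A * S.F)).trace) := by
    rw [sum_Pi]
    refine Finset.sum_congr rfl fun A _ => ?_
    simp only [X, Finset.sum_mul, Finset.mul_sum, Matrix.smul_mul, Matrix.mul_smul,
      Matrix.trace_sum, Matrix.trace_smul, smul_eq_mul, sq]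
    rw [Finset.sum_comm, ← Finset.sum_sub_distrib]
    refine Finset.sum_congr rfl fun i _ => ?_
    rw [← Finset.sum_sub_distrib]
    refine Finset.sum_congr rfl fun j _ => ?_
    rw [Matrix.trace_mul_comm (S.P j * S.F)]
    ring
  rw [e2, e3, L_trace_F, Q_F, Q_trace]
  ring

end GData
end Alg
end GTB

namespace GTB
section Alg
variable {R : Type*} [CommRing R] [Algebra ℝ R]
  {ι : Type*} [Fintype ι] [DecidableEq ι]

lemma trace_key (X Pi D Q : Matrix ι ι R) (h1 : Pi * Pi = Pi) (h2 : X * Pi + Pi * X = X)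
    (h3 : Pi * Q = Q * Pi)
    (h4 : D * Pi + ((2 : R) • Q - (4 : R) • (Pi * Q)) * X
      = X * ((2 : R) • Q - (4 : R) • (Pi * Q)) + Pi * D) :
    (X * D).trace = -4 * (X * X * Q).trace := by
  have h0 : Pi * X * Pi = 0 := by
    have := congrArg (fun M => Pi * M) h2
    simp only [mul_add, ← mul_assoc, h1] at this
    simpa using this
  set a := (X * X * (Pi * Q)).trace with ha
  set b := (X * X * Q).trace with hb
  have hPR : Pi * ((2 : R) • Q - (4 : R) • (Pi * Q)) = (-2 : R) • (Pi * Q) := by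
    rw [mul_sub, Matrix.mul_smul, Matrix.mul_smul, ← mul_assoc, h1, ← sub_smul]; norm_num
  set Rm := (2 : R) • Q - (4 : R) • (Pi * Q) with hR
  have hXXR : (X * X * Rm).trace = 2 * b - 4 * a := by
    rw [hR, mul_sub, Matrix.mul_smul, Matrix.mul_smul, Matrix.trace_sub, Matrix.trace_smul,
      Matrix.trace_smul]; rfl
  have hXXPR : (X * X * (Pi * Rm)).trace = -2 * a := by
    rw [hPR, Matrix.mul_smul, Matrix.trace_smul]; rfl
  have e1 : (X * (Pi * D)).trace = -2 * b := by
    have := congrArg (fun M => (X * Pi * M).trace) h4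
    simp only [mul_add, Matrix.trace_add] at this
    have t1 : (X * Pi * (D * Pi)).trace = 0 := by
      rw [← mul_assoc, Matrix.trace_mul_comm, ← mul_assoc, ← mul_assoc, h0, zero_mul,
        Matrix.trace_zero]
    have t2 : (X * Pi * (Rm * X)).trace = -2 * a := by
      rw [← hXXPR, ← mul_assoc, Matrix.trace_mul_comm]; simp only [mul_assoc]
    have t3 : X * Pi * (X * Rm) = X * X * Rm - X * X * (Pi * Rm) := by
      have : Pi * X = X - X * Pi := by rw [eq_sub_iff_add_eq, add_comm]; exact h2
      rw [mul_assoc, ← mul_assoc Pi, this]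
      noncomm_ring
    have t4 : X * Pi * (Pi * D) = X * (Pi * D) := by
      rw [mul_assoc, ← mul_assoc Pi Pi, h1]
    rw [t1, t2, t3, t4, Matrix.trace_sub, hXXR, hXXPR] at this
    linear_combination -this
  have e2 : (Pi * X * D).trace = -2 * b := by
    rw [mul_assoc, Matrix.trace_mul_comm, mul_assoc]
    have : D * Pi = X * Rm + Pi * D - Rm * X := by rw [← h4]; abel
    rw [this, mul_sub, mul_add, Matrix.trace_sub, Matrix.trace_add, e1, ← mul_assoc, ← mul_assoc]
    rw [Matrix.trace_mul_comm (X * Rm), ← mul_assoc]; ring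
  calc (X * D).trace = ((X * Pi + Pi * X) * D).trace := by rw [h2]
    _ = (X * (Pi * D)).trace + (Pi * X * D).trace := by
      rw [add_mul, Matrix.trace_add, mul_assoc]
    _ = _ := by rw [e1, e2]; ring

namespace GData
variable (S : GData R ι)

lemma X_symm (A : ι) : (S.X A).transpose = S.X A := by
  simp only [X, Matrix.transpose_sum, Matrix.transpose_smul, S.P_symm]

lemma X_idem (A : ι) : S.X A * S.Pi + S.Pi * S.X A = S.X A := by
  simp only [X, Finset.sum_mul, Finset.mul_sum, ← Finset.sum_add_distrib, Matrix.smul_mul,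
    Matrix.mul_smul, ← smul_add, S.P_idem]

lemma sum_Pi_Pi (A i : ι) : ∑ B, S.Pi A B * S.Pi B i = S.Pi A i := by
  rw [← Matrix.mul_apply, S.idem]

lemma Pi_X (A : ι) : ∑ B, S.Pi A B • S.X B = S.X A := by
  simp only [X, Finset.smul_sum, smul_smul]
  rw [Finset.sum_comm]
  refine Finset.sum_congr rfl fun i _ => ?_
  rw [← Finset.sum_smul, sum_Pi_Pi]

lemma X_cod (A B C : ι) : (S.Pi * S.X A) B C = (S.Pi * S.X B) A C := by
  have e : ∀ i B C, (S.Pi * S.P i) B C = ∑ j, (S.P i * S.F) C j * S.Pi B j := by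
    intro i B C
    have : (S.P i * S.Pi).transpose = S.Pi * S.P i := by
      rw [Matrix.transpose_mul, S.symm, S.P_symm]
    have h2 : S.P i * S.Pi = S.P i * S.F * S.Pi := by rw [mul_assoc, S.FPi]
    rw [← this, Matrix.transpose_apply, h2, Matrix.mul_apply]
    exact Finset.sum_congr rfl fun j _ => by rw [S.Pi_symm]
  have e2 : ∀ A B C, (S.Pi * S.X A) B C
      = ∑ i, ∑ j, S.Pi A i * ((S.P i * S.F) C j * S.Pi B j) := by
    intro A B C
    simp only [X, Finset.mul_sum, Matrix.mul_smul, Matrix.sum_apply, Matrix.smul_apply, e,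
      smul_eq_mul]
  rw [e2, e2, Finset.sum_comm]
  refine Finset.sum_congr rfl fun i _ => Finset.sum_congr rfl fun j _ => ?_
  rw [S.PF_cod]; ring

lemma Q_eq : S.Q = ∑ A, S.X A * S.X A := by
  ext a b
  have h1 : S.Q a b = ∑ i, ∑ j, S.Pi i j * (S.P i * S.P j) a b := by
    simp only [Q, mGam, Matrix.sum_apply, Matrix.smul_apply, smul_eq_mul]; rfl
  rw [h1, sum_Pi, Matrix.sum_apply]
  refine Finset.sum_congr rfl fun A _ => ?_
  simp only [X, Finset.sum_mul, Finset.mul_sum, Matrix.smul_mul, Matrix.mul_smul,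
      Matrix.sum_apply, Matrix.smul_apply, smul_eq_mul]
  rw [Finset.sum_comm]
  exact Finset.sum_congr rfl fun i _ => Finset.sum_congr rfl fun j _ => by ring

lemma PP_symm (k l : ι) : mD (S.d k) (S.P l) = mD (S.d l) (S.P k) := by
  ext a b; exact S.comm k l _

lemma mL_P (i : ι) : S.mL (S.P i) = mD (S.d i) (S.mL S.Pi)
    - ∑ k, ∑ l, S.P i k l • mD (S.d k) (S.P l) := by
  ext a b
  simp only [mL_apply, Matrix.sub_apply, Matrix.sum_apply, Matrix.smul_apply, smul_eq_mul]
  exact S.L_der i (S.Pi a b)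

lemma mL_X (A : ι) : S.mL (S.X A) = ∑ i, S.mL S.Pi A i • S.P i
    + ∑ i, S.Pi A i • mD (S.d i) (S.mL S.Pi)
    - ∑ k, ∑ l, S.X A k l • mD (S.d k) (S.P l)
    + (2 : R) • ∑ i, ∑ l, S.X l A i • mD (S.d l) (S.P i) := by
  have h0 : ∀ k l, S.X A k l = ∑ i, S.Pi A i * S.P i k l := by
    intro k l; simp only [X, Matrix.sum_apply, Matrix.smul_apply, smul_eq_mul]
  have h1 : S.mL (S.X A) = ∑ i, S.mL S.Pi A i • S.P i + ∑ i, S.Pi A i • S.mL (S.P i)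
      + (2 : R) • ∑ i, ∑ l, S.X l A i • mD (S.d l) (S.P i) := by
    ext a b
    have hX : S.X A a b = ∑ i, S.Pi A i * S.P i a b := h0 a b
    rw [mL_apply, hX]
    simp only [L_sum, L_mul, Finset.sum_add_distrib, Matrix.add_apply, Matrix.sum_apply,
      Matrix.smul_apply, smul_eq_mul, mL_apply, ← Finset.mul_sum]
    congr 2
    refine Finset.sum_congr rfl fun i _ => ?_
    rw [Gam, Finset.sum_comm]
    refine Finset.sum_congr rfl fun l _ => ?_
    have : S.X l A i = ∑ k, S.Pi k l * S.P k A i := by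
      simp only [X, Matrix.sum_apply, Matrix.smul_apply, smul_eq_mul]
      exact Finset.sum_congr rfl fun k _ => by rw [S.Pi_symm]
    rw [this, Finset.sum_mul]
    exact Finset.sum_congr rfl fun k _ => by simp only [P, mD_apply]; ring
  have h2 : ∑ i, S.Pi A i • S.mL (S.P i) = ∑ i, S.Pi A i • mD (S.d i) (S.mL S.Pi)
    - ∑ k, ∑ l, S.X A k l • mD (S.d k) (S.P l) := by
    simp only [mL_P, smul_sub, Finset.sum_sub_distrib, h0, Finset.sum_smul, Finset.smul_sum,
      smul_smul]
    congr 1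
    rw [← Finset.sum_comm_cycle]
  rw [h1, h2]
  abel

end GData
end Alg
end GTB

namespace GTB
section Alg
variable {R : Type*} [CommRing R] [Algebra ℝ R]
  {ι : Type*} [Fintype ι] [DecidableEq ι]
namespace GData
variable (S : GData R ι)

lemma Pi_mL : S.Pi * S.mL S.Pi = (-2 : R) • (S.Q * S.Pi) := by
  rw [mL_Pi, mul_sub, Matrix.mul_smul, Matrix.mul_smul, ← mul_assoc, S.idem, ← sub_smul, Q_comm]
  norm_num

/-- replacing `X A` by `∑ Π X B` -/
lemma sum_X_tr (c : ι → R) (M : Matrix ι ι R) :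
    ∑ A, c A * (S.X A * M).trace = ∑ B, (∑ A, S.Pi B A * c A) * (S.X B * M).trace := by
  have : ∀ A, (S.X A * M).trace = ∑ B, S.Pi A B * (S.X B * M).trace := by
    intro A
    conv_lhs => rw [← S.Pi_X A]
    simp only [Finset.sum_mul, Matrix.smul_mul, Matrix.trace_sum, Matrix.trace_smul, smul_eq_mul]
  rw [Finset.sum_congr rfl fun A _ => by rw [this A]]
  simp only [Finset.mul_sum, Finset.sum_mul]
  rw [Finset.sum_comm]
  exact Finset.sum_congr rfl fun B _ => Finset.sum_congr rfl fun A _ => by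
    rw [S.Pi_symm A B]; ring

lemma simons_t1 : ∑ A, ∑ i, S.mL S.Pi A i * (S.X A * S.P i).trace
    = -2 * ∑ B, ∑ E, S.Q B E * (S.X B * S.X E).trace := by
  rw [Finset.sum_comm]
  have h1 : ∀ i, ∑ A, S.mL S.Pi A i * (S.X A * S.P i).trace
      = ∑ B, (-2 * (S.Q * S.Pi) B i) * (S.X B * S.P i).trace := by
    intro i
    rw [S.sum_X_tr (fun A => S.mL S.Pi A i)]
    refine Finset.sum_congr rfl fun B _ => ?_
    have := congrFun (congrFun S.Pi_mL B) i
    rw [Matrix.mul_apply, Matrix.smul_apply, smul_eq_mul] at this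
    rw [this]
  simp only [h1]
  rw [Finset.sum_comm, Finset.mul_sum]
  refine Finset.sum_congr rfl fun B _ => ?_
  have h2 : ∀ E, (S.X B * S.X E).trace = ∑ i, S.Pi E i * (S.X B * S.P i).trace := by
    intro E
    simp only [X, Finset.mul_sum, Matrix.mul_smul, Matrix.trace_sum, Matrix.trace_smul,
      smul_eq_mul]
  simp only [h2, Matrix.mul_apply, Finset.mul_sum, Finset.sum_mul]
  rw [Finset.sum_comm]
  exact Finset.sum_congr rfl fun B _ => Finset.sum_congr rfl fun A _ => by ring

lemma simons_tR (A : ι) : (S.X A * ∑ i, S.Pi A i • mD (S.d i) (S.mL S.Pi)).trace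
    = -4 * (S.X A * S.X A * S.Q).trace := by
  refine trace_key (S.X A) S.Pi _ S.Q S.idem (S.X_idem A) S.Q_comm ?_
  rw [← mL_Pi]
  have h : S.mL S.Pi * S.Pi = S.Pi * S.mL S.Pi := by rw [S.offdiag, ← S.offdiag']
  have h2 : ∀ i, mD (S.d i) (S.mL S.Pi) * S.Pi + S.mL S.Pi * S.P i
      = S.P i * S.mL S.Pi + S.Pi * mD (S.d i) (S.mL S.Pi) := by
    intro i
    have := congrArg (mD (S.d i)) h
    rwa [mD_mul, mD_mul] at this
  simp only [X, Finset.sum_mul, Finset.mul_sum, ← Finset.sum_add_distrib, Matrix.smul_mul,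
    Matrix.mul_smul, ← smul_add, h2]

lemma X_split (A k l : ι) : S.X A k l = (S.Pi * S.X A) k l + (S.Pi * S.X A) l k := by
  have h1 : (S.Pi * S.X A) l k = (S.X A * S.Pi) k l := by
    have : (S.Pi * S.X A).transpose = S.X A * S.Pi := by
      rw [Matrix.transpose_mul, S.symm, S.X_symm]
    rw [← this]; rfl
  rw [h1, add_comm, ← Matrix.add_apply, S.X_idem]

lemma simons_PP : ∑ A, ∑ k, ∑ l, S.X A k l * (S.X A * mD (S.d k) (S.P l)).trace
    = 2 * ∑ A, ∑ i, ∑ l, S.X l A i * (S.X A * mD (S.d l) (S.P i)).trace := by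
  have h1 : ∑ A, ∑ k, ∑ l, S.X A k l * (S.X A * mD (S.d k) (S.P l)).trace
      = 2 * ∑ A, ∑ k, ∑ l, (S.Pi * S.X A) k l * (S.X A * mD (S.d k) (S.P l)).trace := by
    rw [Finset.mul_sum]
    refine Finset.sum_congr rfl fun A _ => ?_
    simp only [X_split, add_mul, Finset.sum_add_distrib]
    rw [two_mul]
    congr 1
    rw [Finset.sum_comm]
    refine Finset.sum_congr rfl fun i _ => Finset.sum_congr rfl fun j _ => ?_
    rw [S.PP_symm]
  rw [h1]
  congr 1
  have key : ∀ i l, ∑ A, S.X l A i * (S.X A * mD (S.d l) (S.P i)).trace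
      = ∑ B, (S.Pi * S.X B) l i * (S.X B * mD (S.d l) (S.P i)).trace := by
    intro i l
    rw [S.sum_X_tr (fun B => S.X l B i)]
    refine Finset.sum_congr rfl fun B _ => ?_
    rw [← Matrix.mul_apply, S.X_cod]
  have r : ∀ f : ι → ι → ι → R, ∑ A, ∑ i, ∑ l, f A i l = ∑ i, ∑ l, ∑ A, f A i l := by
    intro f
    rw [Finset.sum_comm]
    exact Finset.sum_congr rfl fun i _ => Finset.sum_comm
  rw [r (fun A i l => S.X l A i * (S.X A * mD (S.d l) (S.P i)).trace), r]
  simp only [key]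
  rw [Finset.sum_comm]

lemma simons_T : ∑ A, (S.X A * S.mL (S.X A)).trace
    = -2 * ∑ B, ∑ E, S.Q B E * (S.X B * S.X E).trace - 4 * (S.Q * S.Q).trace := by
  have h : ∀ A, (S.X A * S.mL (S.X A)).trace
      = ∑ i, S.mL S.Pi A i * (S.X A * S.P i).trace
      + (-4 * (S.X A * S.X A * S.Q).trace)
      - ∑ k, ∑ l, S.X A k l * (S.X A * mD (S.d k) (S.P l)).trace
      + 2 * ∑ i, ∑ l, S.X l A i * (S.X A * mD (S.d l) (S.P i)).trace := by
    intro A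
    rw [← simons_tR, mL_X, mul_add, mul_sub, mul_add]
    simp only [Matrix.trace_add, Matrix.trace_sub, Finset.mul_sum, Matrix.mul_smul,
      Matrix.trace_sum, Matrix.trace_smul, smul_eq_mul]
  simp only [h, Finset.sum_add_distrib, Finset.sum_sub_distrib, ← Finset.mul_sum]
  rw [simons_t1, simons_PP]
  have : ∑ A, (S.X A * S.X A * S.Q).trace = (S.Q * S.Q).trace := by
    rw [← Matrix.trace_sum, ← Finset.sum_mul, ← Q_eq]
  rw [this]; ring

/-- tangential second derivatives -/
def Y (D A : ι) : Matrix ι ι R := ∑ i, S.Pi D i • mD (S.d i) (S.X A)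

lemma trace_mL (M : Matrix ι ι R) : S.L M.trace = (S.mL M).trace := by
  simp only [Matrix.trace, L_sum]; rfl

lemma L_W : S.L S.Q.trace = 2 * (-2 * ∑ B, ∑ E, S.Q B E * (S.X B * S.X E).trace
      - 4 * (S.Q * S.Q).trace) + 2 * ∑ D, ∑ A, (S.Y D A * S.Y D A).trace := by
  rw [← simons_T, S.Q_eq, Matrix.trace_sum, L_sum, Finset.sum_comm (f := fun D A => _),
    Finset.mul_sum, Finset.mul_sum, ← Finset.sum_add_distrib]
  refine Finset.sum_congr rfl fun A _ => ?_
  rw [trace_mL, mL_mul, Matrix.trace_add, Matrix.trace_add, Matrix.trace_mul_comm (S.mL _),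
    Matrix.trace_smul, smul_eq_mul, ← two_mul]
  congr 2
  rw [mGam]
  simp only [Matrix.trace_sum, Matrix.trace_smul, smul_eq_mul]
  rw [sum_Pi]
  refine Finset.sum_congr rfl fun D _ => ?_
  simp only [Y, Finset.sum_mul, Finset.mul_sum, Matrix.smul_mul, Matrix.mul_smul,
      Matrix.trace_sum, Matrix.trace_smul, smul_eq_mul]
  rw [Finset.sum_comm]
  refine Finset.sum_congr rfl fun i _ => Finset.sum_congr rfl fun j _ => ?_
  ring

/-- tangential derivative -/
def del (D : ι) (a : R) : R := ∑ i, S.Pi D i * S.d i a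

lemma Gam_eq (a b : R) : S.Gam a b = ∑ D, S.del D a * S.del D b := by
  rw [Gam, sum_Pi]
  refine Finset.sum_congr rfl fun D _ => ?_
  rw [del, del, Finset.sum_mul_sum]
  refine Finset.sum_congr rfl fun i _ => Finset.sum_congr rfl fun j _ => ?_
  ring

lemma del_W (D : ι) : S.del D S.Q.trace = 2 * ∑ A, (S.X A * S.Y D A).trace := by
  rw [Q_eq]
  simp only [del, Y, Matrix.trace_sum, map_sum, mD_trace, mD_mul, Matrix.trace_add,
    Finset.mul_sum, Matrix.mul_smul, Matrix.trace_smul, smul_eq_mul]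
  rw [Finset.sum_comm]
  refine Finset.sum_congr rfl fun i _ => Finset.sum_congr rfl fun j _ => ?_
  rw [Matrix.trace_mul_comm (S.X i)]; ring

lemma Y_symm (D A : ι) : (S.Y D A).transpose = S.Y D A := by
  simp only [Y, Matrix.transpose_sum, Matrix.transpose_smul, ← mD_transpose, S.X_symm]

lemma Y_1 (D A : ι) : S.Y D A = ∑ B, S.X D A B • S.X B + ∑ B, S.Pi A B • S.Y D B := by
  have h : ∀ i, mD (S.d i) (S.X A) = ∑ B, S.P i A B • S.X B + ∑ B, S.Pi A B • mD (S.d i) (S.X B) := by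
    intro i
    conv_lhs => rw [← S.Pi_X A]
    rw [mD_sum, ← Finset.sum_add_distrib]
    exact Finset.sum_congr rfl fun B _ => by rw [mD_smul]; rfl
  have h0 : ∀ k l, S.X D k l = ∑ i, S.Pi D i * S.P i k l := by
    intro k l; simp only [X, Matrix.sum_apply, Matrix.smul_apply, smul_eq_mul]
  conv_lhs => rw [Y]
  simp only [h, h0, smul_add, Finset.sum_add_distrib, Finset.sum_smul, Finset.smul_sum, smul_smul,
    Y]
  congr 1
  · rw [Finset.sum_comm]
  · rw [Finset.sum_comm]
    refine Finset.sum_congr rfl fun i _ => Finset.sum_congr rfl fun j _ => ?_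
    rw [mul_comm]

lemma Y_2 (D A : ι) : S.Y D A * S.Pi + S.Pi * S.Y D A + S.X A * S.X D + S.X D * S.X A
    = S.Y D A := by
  have h : ∀ i, mD (S.d i) (S.X A) * S.Pi + S.Pi * mD (S.d i) (S.X A) + S.X A * S.P i
      + S.P i * S.X A = mD (S.d i) (S.X A) := by
    intro i
    have := congrArg (mD (S.d i)) (S.X_idem A)
    rw [mD_add, mD_mul, mD_mul] at this
    conv_rhs => rw [← this]
    change _ = _ + S.X A * S.P i + (S.P i * S.X A + _)
    abel
  have hX : S.X D = ∑ i, S.Pi D i • S.P i := rfl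
  rw [hX]
  conv_rhs => rw [Y]
  simp only [Y, Finset.sum_mul, Finset.mul_sum, ← Finset.sum_add_distrib, Matrix.smul_mul,
    Matrix.mul_smul, ← smul_add, h]

end GData
end Alg
end GTB

namespace GTB
section Real1
variable {ι : Type*} [Fintype ι] [DecidableEq ι]
open Matrix

lemma tr_sq_eq (A : Matrix ι ι ℝ) : (A * Aᵀ).trace = ∑ i, ∑ j, A i j ^ 2 := by
  simp only [Matrix.trace, Matrix.diag, Matrix.mul_apply, Matrix.transpose_apply, sq]

lemma comm_diag (l : ι → ℝ) (B : Matrix ι ι ℝ) (hB : Bᵀ = B) :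
    (diagonal l * diagonal l * (B * B)).trace - (diagonal l * B * (diagonal l * B)).trace
      ≤ (diagonal l * diagonal l).trace * (B * B).trace := by
  have hb : ∀ i j, B i j = B j i := fun i j => congrFun (congrFun hB.symm i) j
  have h1 : (diagonal l * diagonal l * (B * B)).trace = ∑ i, ∑ j, l i ^ 2 * B i j ^ 2 := by
    simp only [diagonal_mul_diagonal, Matrix.trace, Matrix.diag, Matrix.diagonal_mul,
      Matrix.mul_apply (M := B), Finset.mul_sum]
    exact Finset.sum_congr rfl fun i _ => Finset.sum_congr rfl fun j _ => by rw [hb j i]; ring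
  have h1' : (diagonal l * diagonal l * (B * B)).trace = ∑ i, ∑ j, l j ^ 2 * B i j ^ 2 := by
    rw [h1, Finset.sum_comm]
    exact Finset.sum_congr rfl fun i _ => Finset.sum_congr rfl fun j _ => by rw [hb j i]
  have h2 : (diagonal l * B * (diagonal l * B)).trace = ∑ i, ∑ j, l i * l j * B i j ^ 2 := by
    simp only [Matrix.trace, Matrix.diag, Matrix.mul_apply (M := diagonal l * B),
      Matrix.diagonal_mul]
    exact Finset.sum_congr rfl fun i _ => Finset.sum_congr rfl fun j _ => by rw [hb j i]; ring
  have h3 : (diagonal l * diagonal l).trace = ∑ k, l k ^ 2 := by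
    simp [diagonal_mul_diagonal, Matrix.trace, sq]
  have h4 : (B * B).trace = ∑ i, ∑ j, B i j ^ 2 := by
    rw [← tr_sq_eq, hB]
  have key : ∀ i j, (l i ^ 2 + l j ^ 2 - 2 * (l i * l j)) ≤ 2 * ∑ k, l k ^ 2 := by
    intro i j
    by_cases hij : i = j
    · subst hij
      have : 0 ≤ ∑ k, l k ^ 2 := Finset.sum_nonneg fun _ _ => sq_nonneg _
      nlinarith
    · have : l i ^ 2 + l j ^ 2 ≤ ∑ k, l k ^ 2 := by
        rw [← Finset.sum_pair (f := fun k => l k ^ 2) hij]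
        exact Finset.sum_le_sum_of_subset_of_nonneg (Finset.subset_univ _)
          fun _ _ _ => sq_nonneg _
      nlinarith [sq_nonneg (l i + l j)]
  have h5 : ∑ i, ∑ j, l i ^ 2 * B i j ^ 2 + ∑ i, ∑ j, l j ^ 2 * B i j ^ 2
      - 2 * ∑ i, ∑ j, l i * l j * B i j ^ 2 ≤ 2 * ((∑ k, l k ^ 2) * ∑ i, ∑ j, B i j ^ 2) := by
    generalize ∑ k, l k ^ 2 = s at key
    have e : ∑ i, ∑ j, (l i ^ 2 + l j ^ 2 - 2 * (l i * l j)) * B i j ^ 2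
        ≤ ∑ i, ∑ j, 2 * s * B i j ^ 2 :=
      Finset.sum_le_sum fun i _ => Finset.sum_le_sum fun j _ =>
        mul_le_mul_of_nonneg_right (key i j) (sq_nonneg (B i j))
    simp only [add_mul, sub_mul, Finset.sum_add_distrib, Finset.sum_sub_distrib,
      ← Finset.mul_sum, mul_assoc (2 : ℝ)] at e
    simp only [← Finset.mul_sum]
    linarith
  rw [← h1, ← h1', ← h2, ← h3, ← h4] at h5
  linarith

lemma comm_ineq (A B : Matrix ι ι ℝ) (hA : Aᵀ = A) (hB : Bᵀ = B) :
    (A * A * (B * B)).trace - (A * B * (A * B)).trace ≤ (A * A).trace * (B * B).trace := by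
  have hH : A.IsHermitian := by rw [Matrix.IsHermitian, conjTranspose_eq_transpose_of_trivial, hA]
  obtain ⟨U, l, hU, hU', hAe⟩ : ∃ (U : Matrix ι ι ℝ) (l : ι → ℝ), U * Uᵀ = 1 ∧ Uᵀ * U = 1 ∧
      A = U * diagonal l * Uᵀ := by
    refine ⟨hH.eigenvectorUnitary, hH.eigenvalues, ?_, ?_, ?_⟩
    · have := Unitary.coe_mul_star_self hH.eigenvectorUnitary
      rwa [Unitary.coe_star, Matrix.star_eq_conjTranspose, conjTranspose_eq_transpose_of_trivial] at this
    · have := Unitary.coe_star_mul_self hH.eigenvectorUnitary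
      rwa [Matrix.star_eq_conjTranspose, conjTranspose_eq_transpose_of_trivial] at this
    · have := hH.spectral_theorem
      conv_lhs => rw [this]
      simp [Unitary.conjStarAlgAut_apply, Matrix.star_eq_conjTranspose,
        conjTranspose_eq_transpose_of_trivial]
  obtain ⟨C, hC⟩ : ∃ C, C = Uᵀ * B * U := ⟨_, rfl⟩
  have hBC : B = U * C * Uᵀ := by
    rw [hC]; simp only [← mul_assoc, hU, one_mul]; rw [mul_assoc, hU, mul_one]
  have hCs : Cᵀ = C := by rw [hC]; simp [Matrix.transpose_mul, hB, mul_assoc]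
  have hm : ∀ M N : Matrix ι ι ℝ, U * M * Uᵀ * (U * N * Uᵀ) = U * (M * N) * Uᵀ := by
    intro M N
    calc _ = U * M * (Uᵀ * U) * N * Uᵀ := by simp only [mul_assoc]
      _ = _ := by rw [hU']; simp only [mul_one, mul_assoc]
  have ht : ∀ M : Matrix ι ι ℝ, (U * M * Uᵀ).trace = M.trace := by
    intro M; rw [Matrix.trace_mul_comm, ← mul_assoc, hU', one_mul]
  rw [hAe, hBC]
  simp only [hm, ht]
  exact comm_diag l C hCs

/-- a symmetric family of matrices `h A B C` -/
lemma H_ineq (H : ι → Matrix ι ι ℝ) (hH : ∀ C, (H C)ᵀ = H C) :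
    2 * (∑ C, ∑ F, (H C * H C * (H F * H F)).trace - ∑ C, ∑ F, (H C * H F * (H C * H F)).trace)
      + ∑ C, ∑ F, (H C * H F).trace ^ 2 ≤ 3 * (∑ C, (H C * H C).trace) ^ 2 := by
  have hb : (∑ C, (H C * H C).trace) ^ 2 = ∑ C, ∑ F, (H C * H C).trace * (H F * H F).trace := by
    rw [sq, Finset.sum_mul_sum]
  have h1 : ∑ C, ∑ F, (H C * H C * (H F * H F)).trace - ∑ C, ∑ F, (H C * H F * (H C * H F)).trace
      ≤ (∑ C, (H C * H C).trace) ^ 2 := by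
    rw [hb]
    simp only [← Finset.sum_sub_distrib]
    exact Finset.sum_le_sum fun C _ => Finset.sum_le_sum fun F _ => comm_ineq _ _ (hH C) (hH F)
  have h2 : ∑ C, ∑ F, (H C * H F).trace ^ 2 ≤ (∑ C, (H C * H C).trace) ^ 2 := by
    rw [hb]
    refine Finset.sum_le_sum fun C _ => Finset.sum_le_sum fun F _ => ?_
    have e : ∀ F, (H C * H F).trace = ∑ p : ι × ι, H C p.1 p.2 * H F p.1 p.2 := by
      intro F
      conv_lhs => rw [← hH F]
      simp only [Matrix.trace, Matrix.diag, Matrix.mul_apply, Matrix.transpose_apply,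
        Fintype.sum_prod_type]
    have e' : ∀ F, (H F * H F).trace = ∑ p : ι × ι, H F p.1 p.2 ^ 2 := by
      intro F
      conv_lhs => rw [← hH F]
      nth_rewrite 1 [hH F]
      rw [tr_sq_eq, Fintype.sum_prod_type]
    rw [e, e', e']
    exact Finset.sum_mul_sq_le_sq_mul_sq _ _ _
  linarith

/-- pointwise data over the reals -/
structure RData (ι : Type*) [Fintype ι] [DecidableEq ι] where
  Pi : Matrix ι ι ℝ
  X : ι → Matrix ι ι ℝ
  symm : Piᵀ = Pi
  idem : Pi * Pi = Pi
  X_symm : ∀ A, (X A)ᵀ = X A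
  X_idem : ∀ A, X A * Pi + Pi * X A = X A
  X_cod : ∀ A B C, (Pi * X A) B C = (Pi * X B) A C
  Pi_X : ∀ A, ∑ B, Pi A B • X B = X A

namespace RData
variable (S : RData ι)

def B (A : ι) : Matrix ι ι ℝ := S.Pi * S.X A

lemma PiX (A : ι) : S.Pi * S.X A = S.X A - S.X A * S.Pi := by
  rw [eq_sub_iff_add_eq, add_comm]; exact S.X_idem A

lemma B_Pi (A : ι) : S.B A * S.Pi = 0 := by
  rw [B, PiX, sub_mul, mul_assoc, S.idem, sub_self]

lemma Pi_B (A : ι) : S.Pi * S.B A = S.B A := by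
  rw [B, ← mul_assoc, S.idem]

lemma BT (A : ι) : (S.B A)ᵀ = S.X A * S.Pi := by
  rw [B, Matrix.transpose_mul, S.symm, S.X_symm]

lemma X_eq (A : ι) : S.X A = S.B A + (S.B A)ᵀ := by
  rw [BT, B, add_comm, S.X_idem]

lemma BB (A E : ι) : S.B A * S.B E = 0 := by
  rw [← Pi_B S E, ← mul_assoc, B_Pi, zero_mul]

lemma BTBT (A E : ι) : (S.B A)ᵀ * (S.B E)ᵀ = 0 := by
  rw [← Matrix.transpose_mul, BB, Matrix.transpose_zero]

def H (C : ι) : Matrix ι ι ℝ := Matrix.of fun A B => S.B A B C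

lemma H_symm (C : ι) : (S.H C)ᵀ = S.H C := by
  ext A B
  exact S.X_cod B A C

lemma H_comm (C A B : ι) : S.H C A B = S.H C B A := S.X_cod A B C

def Q : Matrix ι ι ℝ := ∑ A, S.X A * S.X A
def M : Matrix ι ι ℝ := ∑ A, S.B A * (S.B A)ᵀ
def N : Matrix ι ι ℝ := ∑ A, (S.B A)ᵀ * S.B A

lemma Q_eq : S.Q = S.M + S.N := by
  rw [Q, M, N, ← Finset.sum_add_distrib]
  refine Finset.sum_congr rfl fun A _ => ?_
  rw [X_eq]
  simp only [add_mul, mul_add, BB, BTBT]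
  abel

lemma MN : S.M * S.N = 0 := by
  simp only [M, N, Finset.sum_mul, Finset.mul_sum]
  refine Finset.sum_eq_zero fun A _ => Finset.sum_eq_zero fun E _ => ?_
  rw [mul_assoc, ← mul_assoc (S.B E)ᵀ, BTBT, zero_mul, mul_zero]

lemma NM : S.N * S.M = 0 := by
  simp only [M, N, Finset.sum_mul, Finset.mul_sum]
  refine Finset.sum_eq_zero fun A _ => Finset.sum_eq_zero fun E _ => ?_
  rw [mul_assoc, ← mul_assoc (S.B E), BB, zero_mul, mul_zero]

lemma M_symm : S.Mᵀ = S.M := by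
  simp only [M, Matrix.transpose_sum, Matrix.transpose_mul, Matrix.transpose_transpose]

lemma M_H : S.M = ∑ C, S.H C * S.H C := by
  ext P E
  simp only [M, Matrix.sum_apply, Matrix.mul_apply, Matrix.transpose_apply]
  rw [Finset.sum_comm]
  refine Finset.sum_congr rfl fun C _ => Finset.sum_congr rfl fun A _ => ?_
  rw [S.H_comm C P A]; rfl

lemma N_H (C F : ι) : S.N C F = (S.H C * S.H F).trace := by
  conv_rhs => rw [← S.H_symm C]
  simp only [N, Matrix.sum_apply, Matrix.mul_apply, Matrix.transpose_apply, Matrix.trace,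
    Matrix.diag]
  rw [Finset.sum_comm]; rfl

lemma tr_XX (A E : ι) : (S.X A * S.X E).trace = 2 * S.M A E := by
  have h : (S.B A * (S.B E)ᵀ).trace = S.M A E := by
    rw [M_H]
    simp only [Matrix.sum_apply, Matrix.mul_apply, Matrix.transpose_apply, Matrix.trace,
      Matrix.diag]
    rw [Finset.sum_comm]
    refine Finset.sum_congr rfl fun C _ => Finset.sum_congr rfl fun P _ => ?_
    rw [S.H_comm C P E]; rfl
  have h' : ((S.B A)ᵀ * S.B E).trace = S.M A E := by
    rw [← h, ← Matrix.trace_transpose, Matrix.transpose_mul, Matrix.transpose_transpose,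
      Matrix.trace_mul_comm]
  rw [X_eq, X_eq]
  simp only [add_mul, mul_add, BB, BTBT, Matrix.trace_add, h, h', Matrix.trace_zero]
  ring

lemma N_symm : S.Nᵀ = S.N := by
  simp only [N, Matrix.transpose_sum, Matrix.transpose_mul, Matrix.transpose_transpose]

lemma q_eq : ∑ A, ∑ E, S.Q A E * (S.X A * S.X E).trace = 2 * (S.M * S.M).trace := by
  have h : (S.M * S.M).trace = (S.Q * S.Mᵀ).trace := by
    rw [M_symm, Q_eq, add_mul, NM, add_zero]
  rw [h]
  simp only [tr_XX]
  simp only [Matrix.trace, Matrix.diag, Matrix.mul_apply, Finset.mul_sum,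
    Matrix.transpose_apply]
  exact Finset.sum_congr rfl fun i _ => Finset.sum_congr rfl fun j _ => by ring

lemma t_eq : (S.Q * S.Q).trace = (S.M * S.M).trace + ∑ C, ∑ F, (S.H C * S.H F).trace ^ 2 := by
  rw [Q_eq]
  simp only [add_mul, mul_add, MN, NM, Matrix.trace_add, Matrix.trace_zero]
  have : (S.N * S.N).trace = ∑ C, ∑ F, S.N C F ^ 2 := by
    rw [← tr_sq_eq, N_symm]
  rw [this]
  simp only [N_H]
  ring

lemma m2 (f : ι → ι → ι → ℝ) : ∑ a, ∑ b, ∑ c, f a b c = ∑ c, ∑ a, ∑ b, f a b c :=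
  (Finset.sum_congr rfl fun _ _ => Finset.sum_comm).trans Finset.sum_comm

lemma m4 (f : ι → ι → ι → ι → ι → ℝ) : ∑ a, ∑ b, ∑ x, ∑ y, ∑ c, f a b x y c
    = ∑ c, ∑ a, ∑ b, ∑ x, ∑ y, f a b x y c := by
  rw [← m2 (fun a b c => ∑ x, ∑ y, f a b x y c)]
  refine Finset.sum_congr rfl fun a _ => Finset.sum_congr rfl fun b _ => ?_
  exact m2 _

lemma r1 : ∑ A, ∑ D, (S.B A * (S.B D)ᵀ * (S.B A * (S.B D)ᵀ)).trace
    = ∑ C, ∑ F, (S.H C * S.H F * (S.H C * S.H F)).trace := by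
  simp only [Matrix.trace, Matrix.diag, Matrix.mul_apply, Matrix.transpose_apply,
    Finset.sum_mul_sum]
  rw [m4]
  refine Finset.sum_congr rfl fun C _ => ?_
  rw [m4]
  refine Finset.sum_congr rfl fun F _ => ?_
  rw [m2]
  refine Finset.sum_congr rfl fun P _ => ?_
  rw [m2]
  refine Finset.sum_congr rfl fun P' _ => Finset.sum_congr rfl fun A _ =>
    Finset.sum_congr rfl fun D _ => ?_
  rw [S.H_comm C P A, S.H_comm C P' D]
  change S.H C A P * S.H C D P' * (S.H F A P' * S.H F D P) = _
  ring

lemma r_eq : ∑ A, ∑ D, (S.X A * S.X D * (S.X A * S.X D)).trace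
    = 2 * ∑ C, ∑ F, (S.H C * S.H F * (S.H C * S.H F)).trace := by
  have h : ∀ A D, (S.X A * S.X D * (S.X A * S.X D)).trace
      = (S.B A * (S.B D)ᵀ * (S.B A * (S.B D)ᵀ)).trace
      + (S.B D * (S.B A)ᵀ * (S.B D * (S.B A)ᵀ)).trace := by
    intro A D
    have e1 : S.X A * S.X D = S.B A * (S.B D)ᵀ + (S.B A)ᵀ * S.B D := by
      rw [X_eq, X_eq]
      simp only [add_mul, mul_add, BB, BTBT]
      abel
    have e2 : S.B A * (S.B D)ᵀ * ((S.B A)ᵀ * S.B D) = 0 := by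
      rw [mul_assoc, ← mul_assoc (S.B D)ᵀ, BTBT, zero_mul, mul_zero]
    have e3 : (S.B A)ᵀ * S.B D * (S.B A * (S.B D)ᵀ) = 0 := by
      rw [mul_assoc, ← mul_assoc (S.B D), BB, zero_mul, mul_zero]
    rw [e1]
    simp only [add_mul, mul_add, e2, e3, Matrix.trace_add, add_zero, zero_add]
    congr 1
    rw [mul_assoc, Matrix.trace_mul_comm]
    simp only [mul_assoc]
  simp only [h, Finset.sum_add_distrib]
  rw [Finset.sum_comm (f := fun A D => (S.B D * (S.B A)ᵀ * (S.B D * (S.B A)ᵀ)).trace), r1]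
  ring

lemma W_eq : S.Q.trace = 2 * ∑ C, (S.H C * S.H C).trace := by
  have : S.Q.trace = ∑ A, (S.X A * S.X A).trace := by rw [Q, Matrix.trace_sum]
  have h2 : ∑ C, (S.H C * S.H C).trace = S.M.trace := by rw [M_H, Matrix.trace_sum]
  rw [this, h2]
  simp only [tr_XX]
  simp only [← Finset.mul_sum, Matrix.trace, Matrix.diag]

/-- the algebraic curvature estimate -/
lemma curv : -3 * S.Q.trace ^ 2 ≤ -2 * ∑ A, ∑ E, S.Q A E * (S.X A * S.X E).trace
    - 4 * (S.Q * S.Q).trace + 4 * ∑ A, ∑ D, (S.X A * S.X D * (S.X A * S.X D)).trace := by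
  rw [q_eq, t_eq, r_eq, W_eq]
  have h := H_ineq S.H S.H_symm
  have h2 : (S.M * S.M).trace = ∑ C, ∑ F, (S.H C * S.H C * (S.H F * S.H F)).trace := by
    rw [M_H, Finset.sum_mul_sum, Matrix.trace_sum]
    simp only [Matrix.trace_sum]
  rw [← h2] at h
  nlinarith

end RData
end Real1
end GTB

namespace GTB
section Real2
variable {ι : Type*} [Fintype ι] [DecidableEq ι]
open Matrix

lemma tr_offdiag (Pi X M : Matrix ι ι ℝ) (hi : Pi * Pi = Pi) (hX : X * Pi + Pi * X = X)
    (hM : Pi * M = M * Pi) : (X * M).trace = 0 := by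
  have h0 : Pi * X * Pi = 0 := by
    have := congrArg (fun M => Pi * M) hX
    simp only [mul_add, ← mul_assoc, hi] at this
    simpa using this
  have h1 : (X * Pi * M).trace = 0 := by
    calc (X * Pi * M).trace = (X * (Pi * Pi) * M).trace := by rw [hi]
      _ = (X * Pi * (M * Pi)).trace := by rw [← hM]; simp only [mul_assoc]
      _ = (Pi * X * Pi * M).trace := by
        rw [← mul_assoc, Matrix.trace_mul_comm]; simp only [mul_assoc]
      _ = 0 := by rw [h0, zero_mul, Matrix.trace_zero]
  have h2 : (Pi * X * M).trace = 0 := by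
    rw [← h1, mul_assoc, Matrix.trace_mul_comm, mul_assoc, ← hM, mul_assoc]
  calc (X * M).trace = ((X * Pi + Pi * X) * M).trace := by rw [hX]
    _ = 0 := by rw [add_mul, Matrix.trace_add, h1, h2, add_zero]

lemma tr_sq_nonneg (A : Matrix ι ι ℝ) (h : Aᵀ = A) : 0 ≤ (A * A).trace := by
  nth_rewrite 2 [← h]
  rw [tr_sq_eq]
  exact Finset.sum_nonneg fun _ _ => Finset.sum_nonneg fun _ _ => sq_nonneg _

namespace RData
variable (S : RData ι)

lemma Pi_symm (i j : ι) : S.Pi i j = S.Pi j i := congrFun (congrFun S.symm.symm i) j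

lemma PXP (A : ι) : S.Pi * S.X A * S.Pi = 0 := S.B_Pi A

lemma X_comm (A i j : ι) : S.X A i j = S.X A j i := congrFun (congrFun (S.X_symm A).symm i) j

def n1 (D A : ι) : Matrix ι ι ℝ := ∑ B, S.X D A B • S.X B
def n0 (D A : ι) : Matrix ι ι ℝ := S.X A * S.X D + S.X D * S.X A
def n2 (D A : ι) : Matrix ι ι ℝ := (1 - (2 : ℝ) • S.Pi) * S.n0 D A

lemma n1_symm (D A : ι) : (S.n1 D A)ᵀ = S.n1 D A := by
  simp only [n1, Matrix.transpose_sum, Matrix.transpose_smul, S.X_symm]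

lemma n0_symm (D A : ι) : (S.n0 D A)ᵀ = S.n0 D A := by
  simp only [n0, Matrix.transpose_add, Matrix.transpose_mul, S.X_symm]
  abel

lemma n0_comm (D A : ι) : S.Pi * S.n0 D A = S.n0 D A * S.Pi := by
  have h : ∀ A D, S.Pi * (S.X A * S.X D) = S.X A * S.X D * S.Pi := by
    intro A D
    have h2 : S.Pi * S.X D = S.X D - S.X D * S.Pi := S.PiX D
    rw [← mul_assoc, PiX, sub_mul, mul_assoc, h2, mul_sub]
    simp only [mul_assoc]
    abel
  rw [n0, mul_add, add_mul, h, h]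

lemma n2_symm (D A : ι) : (S.n2 D A)ᵀ = S.n2 D A := by
  rw [n2, Matrix.transpose_mul, n0_symm, Matrix.transpose_sub, Matrix.transpose_smul, S.symm,
    Matrix.transpose_one, mul_sub, sub_mul, Matrix.mul_smul, Matrix.smul_mul, n0_comm, one_mul,
    mul_one]

lemma n2_comm (D A : ι) : S.Pi * S.n2 D A = S.n2 D A * S.Pi := by
  have h : S.Pi * (1 - (2 : ℝ) • S.Pi) = (1 - (2 : ℝ) • S.Pi) * S.Pi := by
    rw [mul_sub, sub_mul, Matrix.mul_smul, Matrix.smul_mul, one_mul, mul_one]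
  rw [n2, ← mul_assoc, h, mul_assoc, n0_comm, mul_assoc]

lemma Pi_n1 (D B : ι) : ∑ A, S.Pi B A • S.n1 D A = 0 := by
  have h : ∑ A, S.Pi B A • S.n1 D A = ∑ C, (S.Pi * S.X D) B C • S.X C := by
    simp only [n1, Finset.smul_sum, smul_smul, Matrix.mul_apply, Finset.sum_smul]
    rw [Finset.sum_comm]
  rw [h]
  have h2 : ∑ C, (S.Pi * S.X D) B C • S.X C = ∑ C, (S.Pi * S.X D * S.Pi) B C • S.X C := by
    rw [Finset.sum_congr rfl fun C _ => by rw [← S.Pi_X C]]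
    simp only [Finset.smul_sum, smul_smul, Matrix.mul_apply (N := S.Pi), Finset.sum_smul]
    rw [Finset.sum_comm]
  rw [h2, PXP]
  simp

lemma tr_n1_X (D : ι) : ∑ A, (S.n1 D A * S.X A).trace = 0 := by
  have h : ∑ A, (S.n1 D A * S.X A) = ∑ B, (∑ A, S.Pi B A • S.n1 D A) * S.X B := by
    rw [Finset.sum_congr rfl fun C _ => by rw [← S.Pi_X C]]
    simp only [Finset.mul_sum, Finset.sum_mul, Matrix.mul_smul, Matrix.smul_mul]
    rw [Finset.sum_comm]
    refine Finset.sum_congr rfl fun i _ => Finset.sum_congr rfl fun j _ => ?_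
    rw [Pi_symm]
  rw [← Matrix.trace_sum, h]
  simp [Pi_n1]

lemma tr_n2_X (D A B : ι) : (S.X B * S.n2 D A).trace = 0 :=
  tr_offdiag S.Pi _ _ S.idem (S.X_idem B) (S.n2_comm D A)

lemma tr_n1_n2 (D A : ι) : (S.n1 D A * S.n2 D A).trace = 0 := by
  simp only [n1, Finset.sum_mul, Matrix.smul_mul, Matrix.trace_sum, Matrix.trace_smul, tr_n2_X,
    smul_zero, Finset.sum_const_zero]

lemma JJ : (1 - (2 : ℝ) • S.Pi) * (1 - (2 : ℝ) • S.Pi) = 1 := by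
  simp only [mul_sub, sub_mul, Matrix.mul_smul, Matrix.smul_mul, S.idem, one_mul, mul_one]
  module

lemma n2_n2 (D A : ι) : (S.n2 D A * S.n2 D A).trace = (S.n0 D A * S.n0 D A).trace := by
  have : S.n2 D A = S.n0 D A * (1 - (2 : ℝ) • S.Pi) := by
    rw [n2, mul_sub, sub_mul, Matrix.mul_smul, Matrix.smul_mul, n0_comm, one_mul, mul_one]
  nth_rewrite 1 [this]
  rw [n2, mul_assoc, ← mul_assoc (1 - (2 : ℝ) • S.Pi), JJ, one_mul]

lemma sum_n1 : ∑ D, ∑ A, (S.n1 D A * S.n1 D A).trace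
    = ∑ B, ∑ E, S.Q B E * (S.X B * S.X E).trace := by
  have h : ∀ D A, (S.n1 D A * S.n1 D A).trace
      = ∑ B, ∑ E, S.X D A B * S.X D A E * (S.X B * S.X E).trace := by
    intro D A
    simp only [n1, Finset.sum_mul_sum, Matrix.smul_mul, Matrix.mul_smul, Matrix.trace_sum,
      Matrix.trace_smul, smul_eq_mul]
    exact Finset.sum_congr rfl fun i _ => Finset.sum_congr rfl fun j _ => by ring
  simp only [h]
  rw [m2]
  refine Finset.sum_congr rfl fun B _ => ?_
  rw [m2]
  refine Finset.sum_congr rfl fun E _ => ?_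
  simp only [Q, Matrix.sum_apply, Matrix.mul_apply, Finset.sum_mul]
  exact Finset.sum_congr rfl fun D _ => Finset.sum_congr rfl fun A _ => by rw [S.X_comm D B A]

lemma sum_n2 : ∑ D, ∑ A, (S.n2 D A * S.n2 D A).trace
    = 2 * (S.Q * S.Q).trace + 2 * ∑ A, ∑ D, (S.X A * S.X D * (S.X A * S.X D)).trace := by
  have h : ∀ D A, (S.n2 D A * S.n2 D A).trace = 2 * (S.X D * S.X D * (S.X A * S.X A)).trace
      + 2 * (S.X D * S.X A * (S.X D * S.X A)).trace := by
    intro D A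
    rw [n2_n2, n0]
    simp only [mul_add, add_mul, Matrix.trace_add]
    have e1 : (S.X A * S.X D * (S.X A * S.X D)).trace = (S.X D * S.X A * (S.X D * S.X A)).trace := by
      rw [mul_assoc, Matrix.trace_mul_comm]; simp only [mul_assoc]
    have e2 : (S.X D * S.X A * (S.X A * S.X D)).trace = (S.X D * S.X D * (S.X A * S.X A)).trace := by
      rw [← mul_assoc, Matrix.trace_mul_comm]; simp only [mul_assoc]
    have e3 : (S.X A * S.X D * (S.X D * S.X A)).trace = (S.X D * S.X D * (S.X A * S.X A)).trace := by
      rw [mul_assoc, Matrix.trace_mul_comm]; simp only [mul_assoc]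
    rw [e1, e2, e3]; ring
  simp only [h, Finset.sum_add_distrib, ← Finset.mul_sum]
  congr 2
  simp only [Q, Finset.sum_mul_sum, Matrix.trace_sum]

/-- the full Simons-type inequality -/
lemma simons (Y : ι → ι → Matrix ι ι ℝ) (Ys : ∀ D A, (Y D A)ᵀ = Y D A)
    (Y1 : ∀ D A, Y D A = ∑ B, S.X D A B • S.X B + ∑ B, S.Pi A B • Y D B)
    (Y2 : ∀ D A, Y D A * S.Pi + S.Pi * Y D A + S.X A * S.X D + S.X D * S.X A = Y D A) :
    ∑ D, (2 * ∑ A, (S.X A * Y D A).trace) ^ 2 - 6 * S.Q.trace ^ 3 ≤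
      2 * S.Q.trace * (2 * (-2 * ∑ B, ∑ E, S.Q B E * (S.X B * S.X E).trace
      - 4 * (S.Q * S.Q).trace) + 2 * ∑ D, ∑ A, (Y D A * Y D A).trace) := by
  have a1 : ∀ D, ∑ A, (Y D A * S.n1 D A).trace = ∑ A, (S.n1 D A * S.n1 D A).trace := by
    intro D
    have h : ∑ A, (Y D A * S.n1 D A) = ∑ A, S.n1 D A * S.n1 D A
        + ∑ B, Y D B * ∑ A, S.Pi B A • S.n1 D A := by
      have : ∀ A, Y D A * S.n1 D A = S.n1 D A * S.n1 D A + (∑ B, S.Pi A B • Y D B) * S.n1 D A := by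
        intro A; rw [← add_mul]; congr 1; exact Y1 D A
      rw [Finset.sum_congr rfl fun A _ => this A, Finset.sum_add_distrib]
      congr 1
      simp only [Finset.mul_sum, Finset.sum_mul, Matrix.mul_smul, Matrix.smul_mul]
      rw [Finset.sum_comm]
      refine Finset.sum_congr rfl fun i _ => Finset.sum_congr rfl fun j _ => ?_
      rw [Pi_symm]
    rw [← Matrix.trace_sum, h]
    simp [Pi_n1, Matrix.trace_sum]
  have a2 : ∀ D A, (Y D A * S.n2 D A).trace = (S.n2 D A * S.n2 D A).trace := by
    intro D A
    rw [n2_n2]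
    have h := congrArg (fun M => (M * S.n0 D A).trace) (Y2 D A)
    simp only [add_assoc (Y D A * S.Pi + S.Pi * Y D A)] at h
    change ((_ + S.n0 D A) * _).trace = _ at h
    simp only [add_mul, Matrix.trace_add] at h
    have e : (S.Pi * Y D A * S.n0 D A).trace = (Y D A * S.Pi * S.n0 D A).trace := by
      rw [mul_assoc, Matrix.trace_mul_comm, mul_assoc, ← n0_comm, mul_assoc]
    have e2 : (Y D A * S.n2 D A).trace = (Y D A * S.n0 D A).trace
        - 2 * (Y D A * S.Pi * S.n0 D A).trace := by
      rw [n2, sub_mul, mul_sub, one_mul, Matrix.trace_sub, Matrix.smul_mul, Matrix.mul_smul,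
        Matrix.trace_smul, smul_eq_mul, mul_assoc]
    rw [e] at h
    rw [e2]; linarith
  obtain ⟨c, hc⟩ : ∃ c : ι → ℝ, ∀ D, c D = ∑ A, (S.X A * Y D A).trace := ⟨_, fun _ => rfl⟩
  have hW : S.Q.trace = ∑ A, (S.X A * S.X A).trace := by rw [Q, Matrix.trace_sum]
  obtain ⟨W, hWd⟩ : ∃ W, W = S.Q.trace := ⟨_, rfl⟩
  have hW0 : 0 ≤ W := by
    rw [hWd, hW]; exact Finset.sum_nonneg fun A _ => tr_sq_nonneg _ (S.X_symm A)
  -- the sum of squares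
  have key : ∀ D (s : ℝ), 0 ≤ ∑ A, (Y D A * Y D A).trace - ∑ A, (S.n1 D A * S.n1 D A).trace
      - ∑ A, (S.n2 D A * S.n2 D A).trace - 2 * s * c D + s ^ 2 * W := by
    intro D s
    have h0 : ∀ A, 0 ≤ ((Y D A - S.n1 D A - S.n2 D A - s • S.X A)
        * (Y D A - S.n1 D A - S.n2 D A - s • S.X A)).trace := by
      intro A
      apply tr_sq_nonneg
      simp only [Matrix.transpose_sub, Matrix.transpose_smul, Ys, n1_symm, n2_symm, S.X_symm]
    have h1 : ∀ A, ((Y D A - S.n1 D A - S.n2 D A - s • S.X A)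
        * (Y D A - S.n1 D A - S.n2 D A - s • S.X A)).trace
        = (Y D A * Y D A).trace - 2 * (Y D A * S.n1 D A).trace + (S.n1 D A * S.n1 D A).trace
          - (S.n2 D A * S.n2 D A).trace - 2 * s * (S.X A * Y D A).trace
          + 2 * s * (S.n1 D A * S.X A).trace + s ^ 2 * (S.X A * S.X A).trace := by
      intro A
      have f0 := a2 D A
      have f1 := S.tr_n1_n2 D A
      have f2 := S.tr_n2_X D A A
      have f3 := Matrix.trace_mul_comm (S.n1 D A) (Y D A)
      have f4 := Matrix.trace_mul_comm (S.n2 D A) (Y D A)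
      have f5 := Matrix.trace_mul_comm (Y D A) (S.X A)
      have f6 := Matrix.trace_mul_comm (S.X A) (S.n1 D A)
      have f7 := Matrix.trace_mul_comm (S.n2 D A) (S.X A)
      have f8 := Matrix.trace_mul_comm (S.n2 D A) (S.n1 D A)
      simp only [mul_sub, sub_mul, Matrix.trace_sub, Matrix.mul_smul, Matrix.smul_mul,
        Matrix.trace_smul, smul_eq_mul, f3, f4, f5, f6, f7, f8, f0, f1, f2]
      ring
    have h2 := Finset.sum_nonneg fun A (_ : A ∈ Finset.univ) => h0 A
    simp only [h1, Finset.sum_add_distrib, Finset.sum_sub_distrib, ← Finset.mul_sum, a1,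
      tr_n1_X, ← hW, ← hc, ← hWd] at h2
    linarith
  have key2 : ∀ D, c D ^ 2 ≤ W * (∑ A, (Y D A * Y D A).trace - ∑ A, (S.n1 D A * S.n1 D A).trace
      - ∑ A, (S.n2 D A * S.n2 D A).trace) := by
    intro D
    have h := key D
    generalize ∑ A, (Y D A * Y D A).trace - ∑ A, (S.n1 D A * S.n1 D A).trace
      - ∑ A, (S.n2 D A * S.n2 D A).trace = E at h ⊢
    rcases hW0.eq_or_lt with h0 | h0
    · rw [← h0] at h ⊢
      by_cases hcD : c D = 0
      · simp [hcD]
      · have := h ((E + 1) / (2 * c D))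
        have e : 2 * ((E + 1) / (2 * c D)) * c D = E + 1 := by field_simp
        rw [e] at this; linarith
    · have := h (c D / W)
      have e : E - 2 * (c D / W) * c D + (c D / W) ^ 2 * W = E - c D ^ 2 / W := by
        field_simp; ring
      rw [e, sub_nonneg, div_le_iff₀ h0] at this
      linarith
  have key3 := Finset.sum_le_sum fun D (_ : D ∈ Finset.univ) => key2 D
  rw [← Finset.mul_sum] at key3
  simp only [Finset.sum_sub_distrib, sum_n1, sum_n2] at key3
  have hcurv := mul_le_mul_of_nonneg_left S.curv hW0
  rw [← hWd] at hcurv ⊢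
  have : ∑ D, (2 * ∑ A, (S.X A * Y D A).trace) ^ 2 = 4 * ∑ D, c D ^ 2 := by
    rw [Finset.mul_sum]
    exact Finset.sum_congr rfl fun D _ => by rw [hc]; ring
  rw [this]
  nlinarith

end RData
end Real2
end GTB

namespace GTB
section Real3
variable {ι : Type*} [Fintype ι] [DecidableEq ι]
open Matrix

lemma sum_swap13 (f : ι → ι → ι → ι → ℝ) :
    ∑ a, ∑ b, ∑ c, ∑ d, f a b c d = ∑ a, ∑ b, ∑ c, ∑ d, f c b a d := by
  rw [RData.m2 (fun a b c => ∑ d, f a b c d)]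
  exact Finset.sum_congr rfl fun c _ => Finset.sum_comm

lemma tr_e2 (C Z : Matrix ι ι ℝ) :
    (C * Z).trace ^ 2 - (C * Z * (C * Z)).trace ≤ (C * Cᵀ).trace * (Z * Zᵀ).trace := by
  have t1 : (C * Z).trace ^ 2 = ∑ a, ∑ b, ∑ c, ∑ d, C a b * C c d * (Z b a * Z d c) := by
    simp only [Matrix.trace, Matrix.diag, Matrix.mul_apply, sq]
    simp only [Finset.sum_mul, Finset.mul_sum]
    exact Finset.sum_congr rfl fun a _ => Finset.sum_congr rfl fun b _ =>
      Finset.sum_congr rfl fun c _ => Finset.sum_congr rfl fun d _ => by ring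
  have t2 : (C * Z * (C * Z)).trace = ∑ a, ∑ b, ∑ c, ∑ d, C a b * C c d * (Z b c * Z d a) := by
    simp only [Matrix.trace, Matrix.diag, Matrix.mul_apply]
    simp only [Finset.sum_mul, Finset.mul_sum]
    refine Finset.sum_congr rfl fun a _ => ?_
    rw [Finset.sum_comm]
    rw [Finset.sum_comm]
    refine (Finset.sum_congr rfl fun c _ => Finset.sum_comm).trans ?_
    rw [Finset.sum_comm]
    exact Finset.sum_congr rfl fun b _ =>
      Finset.sum_congr rfl fun c _ => Finset.sum_congr rfl fun d _ => by ring
  have t1' := t1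
  have t2' := t2
  rw [sum_swap13] at t1' t2'
  have sq4 : ∀ C : Matrix ι ι ℝ, ∑ a, ∑ b, ∑ c, ∑ d, (C a b * C c d - C c b * C a d) ^ 2
      ≤ 2 * (C * Cᵀ).trace ^ 2 := by
    intro C
    have s1 : (C * Cᵀ).trace ^ 2 = ∑ a, ∑ b, ∑ c, ∑ d, (C a b * C c d) ^ 2 := by
      rw [tr_sq_eq, sq]
      simp only [Finset.sum_mul, Finset.mul_sum]
      exact Finset.sum_congr rfl fun a _ => Finset.sum_congr rfl fun b _ =>
        Finset.sum_congr rfl fun c _ => Finset.sum_congr rfl fun d _ => by ring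
    have s1' := s1
    rw [sum_swap13] at s1'
    have s2 : 0 ≤ ∑ a, ∑ b, ∑ c, ∑ d, (C a b * C c d) * (C c b * C a d) := by
      have : ∑ a, ∑ b, ∑ c, ∑ d, (C a b * C c d) * (C c b * C a d)
          = ∑ a, ∑ c, (∑ b, C a b * C c b) ^ 2 := by
        refine Finset.sum_congr rfl fun a _ => ?_
        rw [Finset.sum_comm]
        refine Finset.sum_congr rfl fun c _ => ?_
        rw [sq, Finset.sum_mul_sum]
        exact Finset.sum_congr rfl fun b _ => Finset.sum_congr rfl fun d _ => by ring
      rw [this]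
      exact Finset.sum_nonneg fun _ _ => Finset.sum_nonneg fun _ _ => sq_nonneg _
    have : ∑ a, ∑ b, ∑ c, ∑ d, (C a b * C c d - C c b * C a d) ^ 2
        = ∑ a, ∑ b, ∑ c, ∑ d, (C a b * C c d) ^ 2 + ∑ a, ∑ b, ∑ c, ∑ d, (C c b * C a d) ^ 2
        - 2 * ∑ a, ∑ b, ∑ c, ∑ d, (C a b * C c d) * (C c b * C a d) := by
      rw [Finset.mul_sum, ← Finset.sum_add_distrib, ← Finset.sum_sub_distrib]
      refine Finset.sum_congr rfl fun a _ => ?_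
      rw [Finset.mul_sum, ← Finset.sum_add_distrib, ← Finset.sum_sub_distrib]
      refine Finset.sum_congr rfl fun b _ => ?_
      rw [Finset.mul_sum, ← Finset.sum_add_distrib, ← Finset.sum_sub_distrib]
      refine Finset.sum_congr rfl fun c _ => ?_
      rw [Finset.mul_sum, ← Finset.sum_add_distrib, ← Finset.sum_sub_distrib]
      exact Finset.sum_congr rfl fun d _ => by ring
    rw [this, ← s1, ← s1']
    linarith
  have sZ : ∑ a, ∑ b, ∑ c, ∑ d, (Z b a * Z d c - Z b c * Z d a) ^ 2
      ≤ 2 * (Z * Zᵀ).trace ^ 2 := by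
    have := sq4 Zᵀ
    rw [Matrix.transpose_transpose, Matrix.trace_mul_comm] at this
    exact this
  have hGK : ∑ a, ∑ b, ∑ c, ∑ d, (C a b * C c d - C c b * C a d) * (Z b a * Z d c - Z b c * Z d a)
      = 2 * ((C * Z).trace ^ 2 - (C * Z * (C * Z)).trace) := by
    have : 2 * ((C * Z).trace ^ 2 - (C * Z * (C * Z)).trace) = (C * Z).trace ^ 2
      - (C * Z * (C * Z)).trace - (C * Z * (C * Z)).trace + (C * Z).trace ^ 2 := by ring
    rw [this]
    nth_rewrite 1 [t1]
    nth_rewrite 1 [t2]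
    rw [t1', t2']
    simp only [← Finset.sum_add_distrib, ← Finset.sum_sub_distrib]
    exact Finset.sum_congr rfl fun a _ => Finset.sum_congr rfl fun b _ =>
      Finset.sum_congr rfl fun c _ => Finset.sum_congr rfl fun d _ => by ring
  have cs := Finset.sum_mul_sq_le_sq_mul_sq (Finset.univ : Finset (ι × ι × ι × ι))
    (fun p => C p.1 p.2.1 * C p.2.2.1 p.2.2.2 - C p.2.2.1 p.2.1 * C p.1 p.2.2.2)
    (fun p => Z p.2.1 p.1 * Z p.2.2.2 p.2.2.1 - Z p.2.1 p.2.2.1 * Z p.2.2.2 p.1)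
  simp only [Fintype.sum_prod_type] at cs
  rw [hGK] at cs
  have hC : 0 ≤ (C * Cᵀ).trace := by
    rw [tr_sq_eq]; exact Finset.sum_nonneg fun _ _ => Finset.sum_nonneg fun _ _ => sq_nonneg _
  have hZ : 0 ≤ (Z * Zᵀ).trace := by
    rw [tr_sq_eq]; exact Finset.sum_nonneg fun _ _ => Finset.sum_nonneg fun _ _ => sq_nonneg _
  have h5 := cs.trans (mul_le_mul (sq4 C) sZ (Finset.sum_nonneg fun _ _ =>
    Finset.sum_nonneg fun _ _ => Finset.sum_nonneg fun _ _ => Finset.sum_nonneg fun _ _ =>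
    sq_nonneg _) (by positivity))
  refine le_of_abs_le (abs_le_of_sq_le_sq ?_ (by positivity))
  nlinarith

lemma RData.w_ineq (S : RData ι) (F : Matrix ι ι ℝ) (h1 : S.Pi * F = F) (h2 : F * S.Pi = S.Pi)
    (A : ι) : (S.X A * F).trace ^ 2 - (S.X A * F * (S.X A * F)).trace
      ≤ 1 / 2 * (S.X A * S.X A).trace * ((F * Fᵀ).trace - F.trace) := by
  obtain ⟨Z, hZ⟩ : ∃ Z, Z = F - S.Pi := ⟨_, rfl⟩
  have hF : F = Z + S.Pi := by rw [hZ]; abel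
  have hPZ : S.Pi * Z = Z := by rw [hZ, mul_sub, h1, S.idem]
  have hXP : (S.X A * S.Pi).trace = 0 := tr_offdiag S.Pi _ _ S.idem (S.X_idem A) rfl
  have hXF : (S.X A * F).trace = (S.X A * S.Pi * Z).trace := by
    rw [hF, mul_add, Matrix.trace_add, hXP, add_zero, mul_assoc, hPZ]
  have e0 : S.X A * S.Pi * (S.X A * S.Pi) = 0 := by
    rw [mul_assoc, ← mul_assoc S.Pi, S.PXP, mul_zero]
  have e1 : (S.X A * Z * (S.X A * S.Pi)).trace = 0 := by
    have : S.X A * Z = S.X A * S.Pi * Z := by rw [mul_assoc, hPZ]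
    rw [this, mul_assoc, Matrix.trace_mul_comm, mul_assoc, mul_assoc, ← mul_assoc (S.X A), e0,
      mul_zero, Matrix.trace_zero]
  have hXFXF : (S.X A * F * (S.X A * F)).trace
      = (S.X A * S.Pi * Z * (S.X A * S.Pi * Z)).trace := by
    rw [mul_assoc (S.X A) S.Pi Z, hPZ, hF]
    simp only [mul_add, add_mul, Matrix.trace_add, e0, e1, Matrix.trace_zero]
    rw [Matrix.trace_mul_comm (S.X A * S.Pi), e1]
    ring
  have hC : (S.X A * S.Pi * (S.X A * S.Pi)ᵀ).trace = 1 / 2 * (S.X A * S.X A).trace := by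
    have q : S.X A * S.Pi * (S.X A * S.Pi)ᵀ = S.X A * S.Pi * S.X A := by
      rw [Matrix.transpose_mul, S.symm, S.X_symm, mul_assoc, ← mul_assoc S.Pi, S.idem, mul_assoc]
    have q2 : (S.X A * S.X A).trace = (S.X A * S.Pi * S.X A).trace + (S.X A * S.Pi * S.X A).trace := by
      conv_lhs => rw [← S.X_idem A]
      rw [mul_add, add_mul, add_mul, e0, zero_add, Matrix.trace_add, Matrix.trace_add]
      have q3 : (S.Pi * S.X A * (S.Pi * S.X A)).trace = 0 := by
        rw [← mul_assoc, S.PXP, zero_mul, Matrix.trace_zero]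
      have q4 : (S.Pi * S.X A * (S.X A * S.Pi)).trace = (S.X A * S.Pi * S.X A).trace := by
        rw [Matrix.trace_mul_comm, mul_assoc, ← mul_assoc S.Pi, S.idem, mul_assoc]
      have q5 : S.X A * S.Pi * (S.Pi * S.X A) = S.X A * S.Pi * S.X A := by
        rw [mul_assoc, ← mul_assoc S.Pi, S.idem, mul_assoc]
      rw [q3, q4, q5]
      ring
    rw [q, q2]; ring
  have hZZ : (Z * Zᵀ).trace = (F * Fᵀ).trace - F.trace := by
    have q : F.trace = S.Pi.trace := by
      conv_rhs => rw [← h2, Matrix.trace_mul_comm, h1]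
    have q2 : (S.Pi * Fᵀ).trace = S.Pi.trace := by
      rw [← Matrix.trace_transpose, Matrix.transpose_mul, Matrix.transpose_transpose, S.symm, h2]
    rw [hZ, Matrix.transpose_sub, S.symm]
    simp only [mul_sub, sub_mul, Matrix.trace_sub, h2, q2, q, S.idem]
    ring
  rw [hXF, hXFXF, ← hC, ← hZZ]
  exact tr_e2 _ _

lemma det_one_add_ge (A : Matrix ι ι ℝ) (hA : A.PosSemidef) : 1 + A.trace ≤ (1 + A).det := by
  have hH := hA.1
  have e1 : A.trace = ∑ i, hH.eigenvalues i := by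
    simpa using hH.trace_eq_sum_eigenvalues
  have e2 : (1 + A).det = ∏ i, (1 + hH.eigenvalues i) := by
    have := hH.spectral_theorem
    rw [Unitary.conjStarAlgAut_apply] at this
    have h3 : 1 + A = (hH.eigenvectorUnitary : Matrix ι ι ℝ) *
        (diagonal fun i => 1 + hH.eigenvalues i) *
        ((star hH.eigenvectorUnitary : unitaryGroup ι ℝ) : Matrix ι ι ℝ) := by
      have h4 : (diagonal fun i => 1 + hH.eigenvalues i) = 1 + diagonal (RCLike.ofReal ∘ hH.eigenvalues) := by
        rw [← diagonal_one, diagonal_add]; rfl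
      rw [h4, mul_add, add_mul, mul_one, Unitary.coe_mul_star_self]
      conv_lhs => rw [this]
      rfl
    rw [h3, det_mul, det_mul, mul_right_comm, ← det_mul, Unitary.coe_mul_star_self, det_one,
      one_mul, det_diagonal]
  rw [e1, e2]
  have h0 := fun i => hA.eigenvalues_nonneg i
  generalize hH.eigenvalues = l at h0 ⊢
  have : ∀ s : Finset ι, 1 + ∑ i ∈ s, l i ≤ ∏ i ∈ s, (1 + l i) := by
    intro s
    induction s using Finset.induction_on with
    | empty => simp
    | insert a s ha ih =>
      rw [Finset.sum_insert ha, Finset.prod_insert ha]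
      have := mul_le_mul_of_nonneg_left ih (by linarith [h0 a] : 0 ≤ 1 + l a)
      nlinarith [h0 a, Finset.sum_nonneg fun i (_ : i ∈ s) => h0 i, mul_nonneg (h0 a) (Finset.sum_nonneg fun i (_ : i ∈ s) => h0 i)]
  exact this _

end Real3
end GTB

namespace GTB
section Ev
variable {R : Type*} [CommRing R] [Algebra ℝ R]
  {ι : Type*} [Fintype ι] [DecidableEq ι]
open Matrix

lemma ev_trace (ev : R →+* ℝ) (M : Matrix ι ι R) : ev M.trace = (ev.mapMatrix M).trace := by
  simp [Matrix.trace, map_sum]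

lemma ev_smul (ev : R →+* ℝ) (r : R) (M : Matrix ι ι R) :
    ev.mapMatrix (r • M) = ev r • ev.mapMatrix M := by
  ext a b; simp

lemma ev_transpose (ev : R →+* ℝ) (M : Matrix ι ι R) :
    (ev.mapMatrix M)ᵀ = ev.mapMatrix Mᵀ := rfl

lemma ev_apply (ev : R →+* ℝ) (M : Matrix ι ι R) (a b : ι) : ev.mapMatrix M a b = ev (M a b) := rfl

namespace GData
variable (S : GData R ι) (ev : R →+* ℝ)

def rd : RData ι where
  Pi := ev.mapMatrix S.Pi
  X := fun A => ev.mapMatrix (S.X A)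
  symm := by rw [ev_transpose, S.symm]
  idem := by rw [← map_mul, S.idem]
  X_symm := fun A => by rw [ev_transpose, S.X_symm]
  X_idem := fun A => by rw [← map_mul, ← map_mul, ← map_add, S.X_idem]
  X_cod := fun A B C => by rw [← map_mul, ← map_mul, ev_apply, S.X_cod]; rfl
  Pi_X := fun A => by
    simp only [ev_apply, ← ev_smul, ← map_sum, S.Pi_X]

lemma rd_Q : (S.rd ev).Q = ev.mapMatrix S.Q := by
  rw [S.Q_eq, map_sum]
  simp only [map_mul]; rfl

lemma ev_W : ev S.Q.trace = (S.rd ev).Q.trace := by rw [rd_Q, ev_trace]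

lemma ev_W_nonneg : 0 ≤ ev S.Q.trace := by
  rw [ev_W, RData.Q, Matrix.trace_sum]
  exact Finset.sum_nonneg fun A _ => tr_sq_nonneg _ ((S.rd ev).X_symm A)

lemma ev_simons : ev (S.Gam S.Q.trace S.Q.trace) - 6 * ev S.Q.trace ^ 3
    ≤ 2 * ev S.Q.trace * ev (S.L S.Q.trace) := by
  have h := (S.rd ev).simons (fun D A => ev.mapMatrix (S.Y D A))
    (fun D A => by rw [ev_transpose, S.Y_symm])
    (fun D A => by
      conv_lhs => rw [S.Y_1]
      simp only [map_add, map_sum, ev_smul]; rfl)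
    (fun D A => by
      conv_rhs => rw [← S.Y_2]
      simp only [map_add, map_mul]; rfl)
  have e1 : ev (S.Gam S.Q.trace S.Q.trace)
      = ∑ D, (2 * ∑ A, ((S.rd ev).X A * ev.mapMatrix (S.Y D A)).trace) ^ 2 := by
    rw [S.Gam_eq, map_sum]
    refine Finset.sum_congr rfl fun D _ => ?_
    rw [S.del_W, ← sq]
    simp only [map_pow, map_mul, map_sum, ev_trace, map_ofNat]
    rfl
  rw [e1, S.L_W]
  rw [rd_Q, ← ev_trace] at h
  have e2 : ev (2 * (-2 * ∑ B, ∑ E, S.Q B E * (S.X B * S.X E).trace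
      - 4 * (S.Q * S.Q).trace) + 2 * ∑ D, ∑ A, (S.Y D A * S.Y D A).trace)
      = (2 * (-2 * ∑ B, ∑ E, (ev.mapMatrix S.Q) B E * ((S.rd ev).X B * (S.rd ev).X E).trace
      - 4 * ((ev.mapMatrix S.Q) * (ev.mapMatrix S.Q)).trace)
      + 2 * ∑ D, ∑ A, ((ev.mapMatrix (S.Y D A)) * (ev.mapMatrix (S.Y D A))).trace) := by
    simp only [map_add, map_sub, map_mul, map_sum, ev_trace, map_ofNat, map_neg, ev_apply]
    rfl
  rw [e2]
  exact h

lemma ev_w (w : R) (hw : ∀ i, S.d i w = w * (S.P i * S.F).trace) (h0 : 0 ≤ ev w) :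
    2 * ev (S.L w) ≤ ev w * ev S.Q.trace * (-1 + (ev (S.F * S.Fᵀ).trace - ev S.F.trace)) := by
  have h := congrArg ev (S.L_w w hw)
  have h1 : ∀ A, ev ((S.X A * S.F).trace ^ 2 - (S.X A * S.F * (S.X A * S.F)).trace)
      ≤ 1 / 2 * ((S.rd ev).X A * (S.rd ev).X A).trace
        * (ev (S.F * S.Fᵀ).trace - ev S.F.trace) := by
    intro A
    have := (S.rd ev).w_ineq (ev.mapMatrix S.F)
      (by change ev.mapMatrix _ * _ = _; rw [← map_mul, S.PiF])
      (by change _ * ev.mapMatrix _ = ev.mapMatrix _; rw [← map_mul, S.FPi]) A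
    rw [ev_transpose, ← map_mul, ← ev_trace, ← ev_trace] at this
    refine le_trans (le_of_eq ?_) this
    simp only [map_sub, map_pow, map_mul, ev_trace]
    rfl
  have h2 := Finset.sum_le_sum fun A (_ : A ∈ Finset.univ) => h1 A
  rw [← Finset.sum_mul, ← Finset.mul_sum, ← Matrix.trace_sum] at h2
  change _ ≤ 1 / 2 * (S.rd ev).Q.trace * _ at h2
  rw [← ev_W, ← map_sum] at h2
  simp only [map_mul, map_add, map_neg, map_ofNat] at h
  rw [h, mul_assoc]
  refine mul_le_mul_of_nonneg_left ?_ h0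
  linarith

end GData
end Ev
end GTB

namespace GTB
section Graph
variable {R : Type*} [CommRing R] [Algebra ℝ R]
  {κ μ : Type*} [Fintype κ] [DecidableEq κ] [Fintype μ] [DecidableEq μ]
open Matrix

lemma tr_fromBlocks (A : Matrix κ κ R) (B : Matrix κ μ R) (C : Matrix μ κ R) (D : Matrix μ μ R) :
    (fromBlocks A B C D).trace = A.trace + D.trace := by
  simp [Matrix.trace, Fintype.sum_sum_type]

lemma eq_zero_of_tr_sq {ι : Type*} [Fintype ι] [DecidableEq ι] (M : Matrix ι ι ℝ) (hs : Mᵀ = M)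
    (h : (M * M).trace = 0) : M = 0 := by
  have h0 : (M * M).trace = ∑ a, ∑ b, M a b ^ 2 := by
    simp only [Matrix.trace, Matrix.diag, Matrix.mul_apply]
    refine Finset.sum_congr rfl fun a _ => Finset.sum_congr rfl fun b _ => ?_
    rw [← congrFun (congrFun hs b) a, Matrix.transpose_apply, sq]
  rw [h0] at h
  ext a b
  have h1 := (Finset.sum_eq_zero_iff_of_nonneg (fun _ _ => Finset.sum_nonneg fun _ _ =>
      sq_nonneg _)).mp h a (Finset.mem_univ a)
  have h2 := (Finset.sum_eq_zero_iff_of_nonneg (fun _ _ => sq_nonneg _)).mp h1 b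
    (Finset.mem_univ b)
  simpa using h2

/-- abstract graph data -/
structure GrData (R : Type*) [CommRing R] [Algebra ℝ R] (κ μ : Type*) [Fintype κ] [DecidableEq κ]
    [Fintype μ] [DecidableEq μ] where
  dd : κ → Derivation ℝ R R
  comm : ∀ i j a, dd i (dd j a) = dd j (dd i a)
  p : Matrix μ κ R
  hp : ∀ i j α, dd i (p α j) = dd j (p α i)
  Gi : Matrix κ κ R
  hGi : (1 + pᵀ * p) * Gi = 1
  Vt : κ → R
  Vn : μ → R
  hVt : ∀ i j, dd i (Vt j) = 0
  hVn : ∀ i j, dd i (Vn j) = 0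
  pde : ∀ α, ∑ i, ∑ j, Gi i j * dd i (p α j) = Vn α - ∑ i, p α i * Vt i

namespace GrData
variable (T : GrData R κ μ)

lemma hGi' : T.Gi * (1 + T.pᵀ * T.p) = 1 := mul_eq_one_comm.mp T.hGi

lemma Gi_symm : T.Giᵀ = T.Gi := by
  have h : T.Giᵀ * (1 + T.pᵀ * T.p) = 1 := by
    have := congrArg Matrix.transpose T.hGi
    simpa only [Matrix.transpose_mul, Matrix.transpose_add, Matrix.transpose_one,
      Matrix.transpose_transpose] using this
  calc T.Giᵀ = T.Giᵀ * ((1 + T.pᵀ * T.p) * T.Gi) := by rw [T.hGi, mul_one]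
    _ = T.Gi := by rw [← mul_assoc, h, one_mul]

def d : κ ⊕ μ → Derivation ℝ R R := Sum.elim T.dd (fun _ => 0)

@[simp] lemma d_inl (i : κ) : T.d (Sum.inl i) = T.dd i := rfl
@[simp] lemma d_inr (i : μ) : T.d (Sum.inr i) = 0 := rfl

def F : Matrix (κ ⊕ μ) (κ ⊕ μ) R := fromBlocks 1 0 T.p 0

def Pi : Matrix (κ ⊕ μ) (κ ⊕ μ) R :=
  fromBlocks T.Gi (T.Gi * T.pᵀ) (T.p * T.Gi) (T.p * T.Gi * T.pᵀ)

lemma Gpp : T.Gi + T.Gi * T.pᵀ * T.p = 1 := by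
  have := T.hGi'
  rwa [mul_add, mul_one, ← Matrix.mul_assoc] at this

lemma mD_F (i : κ ⊕ μ) : mD (T.d i) T.F = fromBlocks 0 0 (mD (T.d i) T.p) 0 := by
  have h1 := mD_one (ι := κ) (T.d i)
  ext a b
  rcases a with a | a <;> rcases b with b | b
  · exact congrFun (congrFun h1 a) b
  · simp [F]
  · simp [F]
  · simp [F]

lemma dF_inl (i : κ ⊕ μ) (a : κ) (b : κ ⊕ μ) : T.d i (T.F (Sum.inl a) b) = 0 := by
  have := congrFun (congrFun (T.mD_F i) (Sum.inl a)) b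
  rw [mD_apply] at this
  rw [this]
  rcases b with b | b <;> simp

def toG : GData R (κ ⊕ μ) where
  d := T.d
  Pi := T.Pi
  F := T.F
  V := Sum.elim T.Vt (fun _ => 0)
  comm := by
    rintro (i | i) (j | j) a 
    · exact T.comm i j a
    all_goals simp
  hV := by
    rintro (i | i) (j | j) <;> simp [T.hVt]
  symm := by
    simp only [Pi, fromBlocks_transpose, Matrix.transpose_mul, Matrix.transpose_transpose,
      Gi_symm, Matrix.mul_assoc]
  idem := by
    have h : T.Gi * T.Gi + T.Gi * T.pᵀ * (T.p * T.Gi) = T.Gi := by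
      rw [← Matrix.mul_assoc, ← add_mul, T.Gpp, one_mul]
    simp only [Pi, fromBlocks_multiply]
    congr 1
    · calc _ = (T.Gi * T.Gi + T.Gi * T.pᵀ * (T.p * T.Gi)) * T.pᵀ := by
            simp only [Matrix.add_mul, Matrix.mul_assoc]
        _ = _ := by rw [h]
    · calc _ = T.p * (T.Gi * T.Gi + T.Gi * T.pᵀ * (T.p * T.Gi)) := by
            simp only [Matrix.mul_add, Matrix.mul_assoc]
        _ = _ := by rw [h]
    · calc _ = T.p * (T.Gi * T.Gi + T.Gi * T.pᵀ * (T.p * T.Gi)) * T.pᵀ := by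
            simp only [Matrix.mul_add, Matrix.add_mul, Matrix.mul_assoc]
        _ = _ := by rw [h]
  PiF := by
    simp only [Pi, F, fromBlocks_multiply, Matrix.mul_zero, Matrix.mul_one, add_zero]
    congr 1
    · exact T.Gpp
    · calc _ = T.p * (T.Gi + T.Gi * T.pᵀ * T.p) := by simp only [Matrix.mul_add, Matrix.mul_assoc]
        _ = _ := by rw [T.Gpp, Matrix.mul_one]
  FPi := by
    simp only [Pi, F, fromBlocks_multiply, Matrix.zero_mul, Matrix.one_mul, add_zero,
      Matrix.mul_assoc]
  FdF := by
    intro i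
    rw [mD_F]
    simp [F, fromBlocks_multiply]
  cod := by
    rintro (i | i) (j | j) (a | a)
    · exact (T.dF_inl (Sum.inl i) a (Sum.inl j)).trans (T.dF_inl (Sum.inl j) a (Sum.inl i)).symm
    · exact T.hp i j a
    all_goals simp [F]
  LF := by
    rintro (a | a) (k | k)
    · simp [dF_inl]
    · simp [dF_inl]
    · have h := congrArg (T.dd k) (T.pde a)
      simp only [map_sum, map_sub, der_mul, T.hVn, T.hVt, Finset.sum_add_distrib, mul_zero,
        add_zero, zero_sub] at h
      have e1 : ∀ i j, T.dd k (T.dd i (T.p a j)) = T.dd i (T.dd j (T.p a k)) := by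
        intro i j; rw [T.comm k i, T.hp k j]
      have e2 : ∀ i, T.dd k (T.p a i) * T.Vt i = T.Vt i * T.dd i (T.p a k) := by
        intro i; rw [T.hp k i, mul_comm]
      simp only [e1, e2] at h
      simp only [Fintype.sum_sum_type, d_inl, d_inr, Derivation.coe_zero, Pi.zero_apply, mul_zero,
        map_zero, Finset.sum_const_zero, add_zero, Sum.elim_inl, zero_mul]
      simp only [F, Pi, fromBlocks_apply₁₁, fromBlocks_apply₂₁, fromBlocks_apply₂₂,
        Matrix.zero_apply, map_zero, mul_zero, Finset.sum_const_zero, add_zero]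
      linear_combination h
    · simp [F]

lemma mD_G (δ : Derivation ℝ R R) : mD δ (1 + T.pᵀ * T.p)
    = (mD δ T.p)ᵀ * T.p + T.pᵀ * mD δ T.p := by
  rw [mD_add, mD_one, mD_mul, zero_add, mD_transpose]

lemma hw (w : R) (h : w * w * (1 + T.pᵀ * T.p).det = 1) (i : κ ⊕ μ) :
    T.toG.d i w = w * (T.toG.P i * T.toG.F).trace := by
  have e1 : (T.toG.P i * T.toG.F).trace = - (T.Gi * T.pᵀ * mD (T.d i) T.p).trace := by
    rw [T.toG.PF_eq, Matrix.trace_sub]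
    change (mD (T.d i) T.F).trace - (T.Pi * mD (T.d i) T.F).trace = _
    rw [mD_F]
    simp [Pi, fromBlocks_multiply, tr_fromBlocks]
  have e2 : (T.Gi * mD (T.d i) (1 + T.pᵀ * T.p)).trace
      = 2 * (T.Gi * T.pᵀ * mD (T.d i) T.p).trace := by
    rw [mD_G, Matrix.mul_add, Matrix.trace_add, two_mul, Matrix.mul_assoc]
    congr 1
    rw [← Matrix.trace_transpose, Matrix.transpose_mul, Matrix.transpose_mul,
      Matrix.transpose_transpose, Gi_symm, Matrix.trace_mul_comm]
  have e3 := congrArg (T.d i) h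
  rw [der_mul, der_mul, der_det (T.d i) _ T.Gi T.hGi, e2, Derivation.map_one_eq_zero] at e3
  change T.d i w = _
  rw [e1]
  set t := (T.Gi * T.pᵀ * mD (T.d i) T.p).trace
  set D := (1 + T.pᵀ * T.p).det
  have e4 : (2 : R) * (T.d i w - w * -t) = 0 := by
    linear_combination w * e3 - 2 * (T.d i w + w * t) * h
  have h2 : algebraMap ℝ R (1 / 2) * (2 : R) = 1 := by
    rw [← map_ofNat (algebraMap ℝ R) 2, ← map_mul]; norm_num
  have e5 : T.d i w - w * -t = 0 := by
    linear_combination (algebraMap ℝ R (1 / 2)) * e4 - (T.d i w - w * -t) * h2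
  exact sub_eq_zero.mp e5

lemma trFF : (T.toG.F * T.toG.Fᵀ).trace - T.toG.F.trace = (T.pᵀ * T.p).trace := by
  change (T.F * T.Fᵀ).trace - T.F.trace = _
  simp [F, fromBlocks_transpose, fromBlocks_multiply, tr_fromBlocks]
  rw [Matrix.trace_mul_comm]

/-- if the Gauss map derivative vanishes then so do all second derivatives -/
lemma dp_zero (ev : R →+* ℝ) (h : ev T.toG.Q.trace = 0) (i j : κ) (α : μ) :
    ev (T.dd i (T.p α j)) = 0 := by
  have hX : ∀ A, ev.mapMatrix (T.toG.X A) = 0 := by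
    rw [GData.ev_W, RData.Q, Matrix.trace_sum] at h
    have h' := (Finset.sum_eq_zero_iff_of_nonneg
      (fun A _ => tr_sq_nonneg _ ((T.toG.rd ev).X_symm A))).mp h
    intro A
    exact eq_zero_of_tr_sq _ ((T.toG.rd ev).X_symm A) (h' A (Finset.mem_univ A))
  have hP : T.toG.P (Sum.inl i) = ∑ A, T.F A (Sum.inl i) • T.toG.X A := by
    have hF : ∀ k, ∑ A, T.F A (Sum.inl i) * T.toG.Pi A k = T.F k (Sum.inl i) := by
      intro k
      have := congrFun (congrFun T.toG.PiF k) (Sum.inl i)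
      rw [Matrix.mul_apply] at this
      change _ = T.F k (Sum.inl i) at this
      rw [← this]
      exact Finset.sum_congr rfl fun A _ => by rw [T.toG.Pi_symm, mul_comm]; rfl
    simp only [GData.X, Finset.smul_sum, smul_smul]
    rw [Finset.sum_comm]
    simp only [← Finset.sum_smul, hF]
    rw [Fintype.sum_sum_type]
    have z : ∀ x : μ, T.toG.P (Sum.inr x) = 0 := by
      intro x; ext a b; simp [GData.P, toG]
    simp only [z, smul_zero, Finset.sum_const_zero, add_zero]
    rw [Finset.sum_eq_single i]
    · simp [F]
    · intro b _ hb; simp [F, hb]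
    · simp
  have h3 := congrArg ev.mapMatrix (T.toG.dF_eq (Sum.inl i))
  have h4 : ev.mapMatrix (T.toG.P (Sum.inl i)) = 0 := by
    rw [hP, map_sum]
    exact Finset.sum_eq_zero fun A _ => by rw [ev_smul, hX, smul_zero]
  rw [map_sub, map_mul, map_mul, map_mul, h4] at h3
  have h5 := congrFun (congrFun h3 (Sum.inr α)) (Sum.inl j)
  simpa [toG, F] using h5

end GrData
end Graph
end GTB

namespace GTB
section Smooth
variable {n : ℕ}

/-- the algebra of smooth functions -/
def Sm (n : ℕ) : Subalgebra ℝ ((Fin n → ℝ) → ℝ) where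
  carrier := {f | ContDiff ℝ (⊤ : ℕ∞) f}
  mul_mem' := by
    intro a b ha hb
    rw [Set.mem_ofPred_eq] at *
    exact ContDiff.mul ha hb
  add_mem' := by
    intro a b ha hb
    rw [Set.mem_ofPred_eq] at *
    exact ContDiff.add ha hb
  algebraMap_mem' := by
    intro c
    rw [Set.mem_ofPred_eq]
    exact contDiff_const

lemma scd (f : Sm n) : ContDiff ℝ (⊤ : ℕ∞) (f : (Fin n → ℝ) → ℝ) := f.2

lemma sdf (f : Sm n) : Differentiable ℝ (f : (Fin n → ℝ) → ℝ) := (scd f).differentiable (by simp)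

lemma cd_pd (f : (Fin n → ℝ) → ℝ) (hf : ContDiff ℝ (⊤ : ℕ∞) f) (v : Fin n → ℝ) :
    ContDiff ℝ (⊤ : ℕ∞) (fun x => fderiv ℝ f x v) :=
  (hf.fderiv_right (m := (⊤ : ℕ∞)) (by simp)).clm_apply contDiff_const

noncomputable def pd (i : Fin n) : Derivation ℝ (Sm n) (Sm n) :=
  Derivation.mk'
    { toFun := fun f => ⟨fun x => fderiv ℝ (f : (Fin n → ℝ) → ℝ) x (Pi.single i 1),
        cd_pd _ (scd f) _⟩
      map_add' := by
        intro f g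
        ext x
        change fderiv ℝ ((f : (Fin n → ℝ) → ℝ) + (g : (Fin n → ℝ) → ℝ)) x _ = _
        rw [fderiv_add (sdf f x) (sdf g x)]
        rfl
      map_smul' := by
        intro c f
        ext x
        change fderiv ℝ (c • (f : (Fin n → ℝ) → ℝ)) x _ = _
        rw [fderiv_const_smul (sdf f x)]
        rfl }
    (by
      intro f g
      ext x
      change fderiv ℝ ((f : (Fin n → ℝ) → ℝ) * (g : (Fin n → ℝ) → ℝ)) x _ = _
      rw [fderiv_mul (sdf f x) (sdf g x)]
      rfl)

lemma pd_apply (i : Fin n) (f : Sm n) (x : Fin n → ℝ) :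
    (pd i f : (Fin n → ℝ) → ℝ) x = fderiv ℝ (f : (Fin n → ℝ) → ℝ) x (Pi.single i 1) := rfl

lemma pd_comm (i j : Fin n) (f : Sm n) : pd i (pd j f) = pd j (pd i f) := by
  ext x
  have key : ∀ i j : Fin n, (pd i (pd j f) : (Fin n → ℝ) → ℝ) x
      = fderiv ℝ (fderiv ℝ (f : (Fin n → ℝ) → ℝ)) x (Pi.single i 1) (Pi.single j 1) := by
    intro i j
    rw [pd_apply]
    have h : DifferentiableAt ℝ (fderiv ℝ (f : (Fin n → ℝ) → ℝ)) x :=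
      (((scd f).fderiv_right (m := (⊤ : ℕ∞)) (by simp)).differentiable (by simp)) x
    have h2 := h.hasFDerivAt.clm_apply (hasFDerivAt_const (Pi.single j (1:ℝ) : Fin n → ℝ) x)
    have h3 : ((pd j f : Sm n) : (Fin n → ℝ) → ℝ)
      = fun y => fderiv ℝ (f : (Fin n → ℝ) → ℝ) y (Pi.single j 1) := rfl
    rw [h3, h2.fderiv]
    simp
  rw [key, key]
  have hs : IsSymmSndFDerivAt ℝ (f : (Fin n → ℝ) → ℝ) x :=
    (scd f).contDiffAt.isSymmSndFDerivAt (by simp; exact WithTop.coe_le_coe.mpr le_top)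
  exact hs _ _

def evx (x : Fin n → ℝ) : Sm n →+* ℝ := (Pi.evalRingHom (fun _ => ℝ) x).comp (Sm n).toSubring.subtype

lemma evx_apply (x : Fin n → ℝ) (f : Sm n) : evx x f = (f : (Fin n → ℝ) → ℝ) x := rfl

lemma evx_alg (x : Fin n → ℝ) (c : ℝ) : evx x (algebraMap ℝ (Sm n) c) = c := rfl

lemma Sm_ext {f g : Sm n} (h : ∀ x, evx x f = evx x g) : f = g := by
  ext x; exact h x

lemma evx_pd (i : Fin n) (f : Sm n) (x : Fin n → ℝ) :
    evx x (pd i f) = fderiv ℝ (f : (Fin n → ℝ) → ℝ) x (Pi.single i 1) := rfl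

lemma evx_cont (f : Sm n) : Continuous (fun x => evx x f) := (scd f).continuous

lemma sm_unit (f : Sm n) (h : ∀ x, evx x f ≠ 0) : ∃ g : Sm n, f * g = 1 := by
  refine ⟨⟨fun x => (evx x f)⁻¹, ?_⟩, ?_⟩
  · exact ContDiff.inv (scd f) h
  · ext x
    exact mul_inv_cancel₀ (h x)

lemma sm_sqrt (f : Sm n) (h : ∀ x, 0 < evx x f) :
    ∃ g : Sm n, ∀ x, evx x g = Real.sqrt (evx x f) := by
  refine ⟨⟨fun x => Real.sqrt (evx x f), ?_⟩, fun x => rfl⟩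
  exact ContDiff.sqrt (scd f) (fun x => (h x).ne')

lemma line_deriv (f : Sm n) (x ξ : Fin n → ℝ) (t : ℝ) :
    HasDerivAt (fun s : ℝ => evx (x + s • ξ) f) (∑ i, ξ i * evx (x + t • ξ) (pd i f)) t := by
  have h1 : HasDerivAt (fun s : ℝ => x + s • ξ) ξ t := by
    simpa using ((hasDerivAt_id t).smul_const ξ).const_add x
  have h2 := (sdf f (x + t • ξ)).hasFDerivAt.comp_hasDerivAt t h1
  refine h2.congr_deriv ?_
  have : ξ = ∑ i, ξ i • (Pi.single i (1:ℝ) : Fin n → ℝ) := by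
    ext j; simp [Finset.sum_apply, Pi.single_apply]
  conv_lhs => rw [this]
  rw [map_sum]
  refine Finset.sum_congr rfl fun i _ => ?_
  rw [map_smul, ← this]; rfl

lemma snd_test (f : Sm n) (x ξ : Fin n → ℝ) (h : IsLocalMax (fun y => evx y f) x) :
    ∑ i, ∑ j, ξ i * ξ j * evx x (pd i (pd j f)) ≤ 0 := by
  by_contra hc
  push Not at hc
  set φ : ℝ → ℝ := fun s => evx (x + s • ξ) f with hφ
  have d1 : deriv φ = fun t => ∑ i, ξ i * evx (x + t • ξ) (pd i f) := by
    ext t; exact (line_deriv f x ξ t).deriv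
  have d2 : deriv (deriv φ) 0 = ∑ i, ∑ j, ξ i * ξ j * evx x (pd i (pd j f)) := by
    rw [d1]
    have := HasDerivAt.fun_sum (u := Finset.univ) (fun i _ => (line_deriv (pd i f) x ξ 0).const_mul (ξ i))
    rw [this.deriv]
    simp only [zero_smul, add_zero, Finset.mul_sum]
    refine Finset.sum_congr rfl fun i _ => Finset.sum_congr rfl fun j _ => ?_
    rw [pd_comm]; ring
  have hmax : IsLocalMax φ 0 := by
    have hc : ContinuousAt (fun s : ℝ => x + s • ξ) 0 := by fun_prop
    have hx : Filter.Tendsto (fun s : ℝ => x + s • ξ) (nhds 0) (nhds x) := by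
      have := hc.tendsto; simpa using this
    have := hx.eventually h
    filter_upwards [this] with s hs
    simpa [hφ] using hs
  have hmin : IsLocalMin φ 0 := isLocalMin_of_deriv_deriv_pos (by rw [d2]; exact hc)
    hmax.deriv_eq_zero (line_deriv f x ξ 0).continuousAt
  have hcst : φ =ᶠ[nhds 0] fun _ => φ 0 := by
    filter_upwards [hmax, hmin] with s h1 h2
    exact le_antisymm h1 h2
  have := hcst.deriv.deriv_eq
  rw [d2] at this
  simp at this
  linarith

lemma fst_test (f : Sm n) (x : Fin n → ℝ) (h : IsLocalMax (fun y => evx y f) x) (i : Fin n) :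
    evx x (pd i f) = 0 := by
  have := h.fderiv_eq_zero
  rw [evx_pd]
  change fderiv ℝ (fun y => evx y f) x _ = 0
  rw [this]; rfl

variable {μ : Type*} [Fintype μ] [DecidableEq μ]

/-- maximum principle -/
lemma max_L (T : GrData (Sm n) (Fin n) μ) (hT : T.dd = pd) (f : Sm n) (x : Fin n → ℝ)
    (h : IsLocalMax (fun y => evx y f) x) : evx x (T.toG.L f) ≤ 0 := by
  have h0 : ∀ i, evx x (T.toG.d i f) = 0 := by
    rintro (i | i)
    · change evx x (T.dd i f) = 0
      rw [hT]; exact fst_test f x h i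
    · exact map_zero _
  rw [GData.L, map_add, map_sum, map_sum]
  simp only [map_sum, map_mul, h0, mul_zero, Finset.sum_const_zero, add_zero]
  have hPi : ∀ i j, evx x (T.toG.Pi i j) = ∑ C, evx x (T.toG.Pi C i) * evx x (T.toG.Pi C j) := by
    intro i j
    conv_lhs => rw [← T.toG.idem]
    rw [Matrix.mul_apply, map_sum]
    exact Finset.sum_congr rfl fun C _ => by rw [map_mul, T.toG.Pi_symm]
  rw [Finset.sum_congr rfl fun i _ => Finset.sum_congr rfl fun j _ => by
    rw [hPi i j, Finset.sum_mul]]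
  have : ∀ i, ∑ j, ∑ C, evx x (T.toG.Pi C i) * evx x (T.toG.Pi C j) * evx x (T.toG.d i (T.toG.d j f))
      = ∑ C, ∑ j, evx x (T.toG.Pi C i) * evx x (T.toG.Pi C j) * evx x (T.toG.d i (T.toG.d j f)) :=
    fun i => Finset.sum_comm
  simp only [this]
  rw [Finset.sum_comm]
  refine Finset.sum_nonpos fun C _ => ?_
  have hs := snd_test f x (fun i => evx x (T.toG.Pi C (Sum.inl i))) h
  rw [Fintype.sum_sum_type]
  have e1 : ∀ i a, T.toG.d (Sum.inr i) a = 0 := fun i a => rfl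
  have e2 : ∀ i a, T.toG.d (Sum.inl i) a = pd i a := fun i a => by rw [← hT]; rfl
  simp only [Fintype.sum_sum_type, e1, e2, map_zero, mul_zero, Finset.sum_const_zero, add_zero]
  exact hs

end Smooth
end GTB

namespace GTB
namespace GData
section Log
variable {R : Type*} [CommRing R] [Algebra ℝ R]
  {ι : Type*} [Fintype ι] [DecidableEq ι] (S : GData R ι) (ev : R →+* ℝ)

lemma del_mul (D : ι) (a b : R) : S.del D (a * b) = S.del D a * b + a * S.del D b := by
  simp only [del, der_mul, Finset.sum_mul, Finset.mul_sum, ← Finset.sum_add_distrib]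
  exact Finset.sum_congr rfl fun i _ => by ring

/-- logarithmic gradient -/
noncomputable def lam (D : ι) (a : R) : ℝ := ev (S.del D a) / ev a

/-- `L log a` -/
noncomputable def ell (a : R) : ℝ := ev (S.L a) / ev a - ev (S.Gam a a) / ev a ^ 2

lemma lam_mul (D : ι) (a b : R) (ha : ev a ≠ 0) (hb : ev b ≠ 0) :
    S.lam ev D (a * b) = S.lam ev D a + S.lam ev D b := by
  simp only [lam, del_mul, map_add, map_mul]
  field_simp

lemma Gam_mul (a b c : R) : S.Gam (a * b) c = a * S.Gam b c + b * S.Gam a c := by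
  simp only [Gam, der_mul, Finset.mul_sum, ← Finset.sum_add_distrib]
  exact Finset.sum_congr rfl fun i _ => Finset.sum_congr rfl fun j _ => by ring

lemma ell_mul (a b : R) (ha : ev a ≠ 0) (hb : ev b ≠ 0) :
    S.ell ev (a * b) = S.ell ev a + S.ell ev b := by
  simp only [ell, L_mul, Gam_mul, S.Gam_comm _ (a * b), map_add, map_mul, S.Gam_comm b a]
  rw [map_ofNat]
  field_simp
  ring

lemma lam_pow (D : ι) (a : R) (ha : ev a ≠ 0) (k : ℕ) :
    S.lam ev D (a ^ k) = k * S.lam ev D a := by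
  induction k with
  | zero =>
    have : S.del D (1 : R) = 0 := by simp [del]
    simp [lam, this]
  | succ k ih =>
    rw [pow_succ, lam_mul _ _ _ _ _ (by rw [map_pow]; exact pow_ne_zero _ ha) ha, ih]
    push_cast; ring

lemma ell_one : S.ell ev 1 = 0 := by
  simp [ell, L, Gam]

lemma ell_pow (a : R) (ha : ev a ≠ 0) (k : ℕ) :
    S.ell ev (a ^ k) = k * S.ell ev a := by
  induction k with
  | zero => simp [ell_one]
  | succ k ih =>
    rw [pow_succ, ell_mul _ _ _ _ (by rw [map_pow]; exact pow_ne_zero _ ha) ha, ih]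
    push_cast; ring

lemma ev_Gam (a : R) (ha : ev a ≠ 0) :
    ev (S.Gam a a) / ev a ^ 2 = ∑ D, S.lam ev D a ^ 2 := by
  rw [Gam_eq, map_sum, Finset.sum_div]
  exact Finset.sum_congr rfl fun D _ => by rw [map_mul, lam, div_pow, ← sq (ev (S.del D a))]

/-- the key pointwise inequality at a maximum point -/
lemma key_max (k κ η : R) (hk : k * κ = 1) (K : ℝ)
    (hW : 0 < ev S.Q.trace) (hk0 : 0 < ev k) (hη : 0 < ev η)
    (hLk : ev (S.L k) ≤ - (K / 2) * ev S.Q.trace * ev k)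
    (hd : ∀ D, ev (S.del D (S.Q.trace ^ 5 * κ ^ 8 * η ^ 10)) = 0)
    (hL : ev (S.L (S.Q.trace ^ 5 * κ ^ 8 * η ^ 10)) ≤ 0) :
    (4 * K - 15) * ev S.Q.trace ≤ - 10 * (ev (S.L η) / ev η)
      + 60 * (ev (S.Gam η η) / ev η ^ 2) := by
  set W := S.Q.trace with hWdef
  have hκ : ev k * ev κ = 1 := by rw [← map_mul, hk, map_one]
  have hκ0 : ev κ ≠ 0 := right_ne_zero_of_mul_eq_one hκ
  have hκp : 0 < ev κ := by
    by_contra h; push Not at h; nlinarith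
  have n1 : ev (W ^ 5) ≠ 0 := by rw [map_pow]; positivity
  have n2 : ev (κ ^ 8) ≠ 0 := by rw [map_pow]; positivity
  have n3 : ev (η ^ 10) ≠ 0 := by rw [map_pow]; positivity
  have n12 : ev (W ^ 5 * κ ^ 8) ≠ 0 := by rw [map_mul]; exact mul_ne_zero n1 n2
  have lk : ∀ D, S.lam ev D κ = - S.lam ev D k := by
    intro D
    have h := S.lam_mul ev D k κ hk0.ne' hκ0
    have h1 : S.lam ev D (k * κ) = 0 := by rw [hk]; simp [lam, del]
    linarith
  have ek : S.ell ev κ = - S.ell ev k := by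
    have h := S.ell_mul ev k κ hk0.ne' hκ0
    rw [hk, ell_one] at h
    linarith
  have lφ : ∀ D, 5 * S.lam ev D W - 8 * S.lam ev D k + 10 * S.lam ev D η = 0 := by
    intro D
    have h : S.lam ev D (W ^ 5 * κ ^ 8 * η ^ 10) = 0 := by rw [lam, hd, zero_div]
    rw [lam_mul _ _ _ _ _ n12 n3, lam_mul _ _ _ _ _ n1 n2, lam_pow _ _ _ _ hW.ne',
      lam_pow _ _ _ _ hκ0, lam_pow _ _ _ _ hη.ne', lk] at h
    push_cast at h
    linarith
  have eφ : 5 * S.ell ev W - 8 * S.ell ev k + 10 * S.ell ev η ≤ 0 := by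
    have h : S.ell ev (W ^ 5 * κ ^ 8 * η ^ 10) ≤ 0 := by
      rw [ell, Gam_eq, map_sum]
      simp only [map_mul ev (S.del _ _), hd, mul_zero, Finset.sum_const_zero, zero_div, sub_zero]
      refine div_nonpos_of_nonpos_of_nonneg hL ?_
      simp only [map_mul, map_pow]; positivity
    rw [ell_mul _ _ _ _ n12 n3, ell_mul _ _ _ _ n1 n2, ell_pow _ _ _ hW.ne',
      ell_pow _ _ _ hκ0, ell_pow _ _ _ hη.ne', ek] at h
    push_cast at h
    linarith
  have eW : S.ell ev W ≥ - (1 / 2) * ∑ D, S.lam ev D W ^ 2 - 3 * ev W := by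
    rw [← ev_Gam _ _ _ hW.ne', ell]
    have h := S.ev_simons ev
    rw [← hWdef] at h
    have : ev (S.L W) / ev W ≥ 1 / 2 * (ev (S.Gam W W) / ev W ^ 2) - 3 * ev W := by
      rw [ge_iff_le, le_div_iff₀ hW]
      have e : (1 / 2 * (ev (S.Gam W W) / ev W ^ 2) - 3 * ev W) * ev W
        = (ev (S.Gam W W) - 6 * ev W ^ 3) / (2 * ev W) := by
        field_simp; ring
      rw [e, div_le_iff₀ (by positivity)]
      linarith
    linarith
  have eK : S.ell ev k ≤ - (K / 2) * ev W - ∑ D, S.lam ev D k ^ 2 := by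
    rw [← ev_Gam _ _ _ hk0.ne', ell]
    have : ev (S.L k) / ev k ≤ - (K / 2) * ev W := by
      rw [div_le_iff₀ hk0]; exact hLk
    linarith
  have eη : S.ell ev η = ev (S.L η) / ev η - ev (S.Gam η η) / ev η ^ 2 := rfl
  have hG := S.ev_Gam ev η hη.ne'
  have young : 5 / 2 * ∑ D, S.lam ev D W ^ 2
      ≤ 8 * ∑ D, S.lam ev D k ^ 2 + 50 * ∑ D, S.lam ev D η ^ 2 := by
    rw [Finset.mul_sum, Finset.mul_sum, Finset.mul_sum, ← Finset.sum_add_distrib]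
    refine Finset.sum_le_sum fun D _ => ?_
    have h := lφ D
    have h1 : S.lam ev D W = (8 * S.lam ev D k - 10 * S.lam ev D η) / 5 := by linarith
    rw [h1]
    nlinarith [sq_nonneg (2 * S.lam ev D k + 10 * S.lam ev D η)]
  rw [hG] at eη ⊢
  linarith
end Log
end GData
end GTB

namespace GTB
section Cst
variable {R : Type*} [CommRing R] [Algebra ℝ R]
  {ι : Type*} [Fintype ι] [DecidableEq ι] (S : GData R ι)

lemma L_cst (c : ℝ) (a : R) : S.L (algebraMap ℝ _ c - a) = - S.L a := by
  simp only [GData.L, map_sub, Derivation.map_algebraMap, zero_sub, map_neg, mul_neg,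
    Finset.sum_neg_distrib]
  ring

lemma L_cst' (c : ℝ) (a : R) : S.L (a - algebraMap ℝ _ c) = S.L a := by
  simp only [GData.L, map_sub, Derivation.map_algebraMap, sub_zero]

lemma Gam_cst (c : ℝ) (a : R) : S.Gam (algebraMap ℝ _ c - a) (algebraMap ℝ _ c - a)
    = S.Gam a a := by
  simp only [GData.Gam, map_sub, Derivation.map_algebraMap, zero_sub, neg_mul_neg]

end Cst

section Liou
variable {n : ℕ} {μ : Type*} [Fintype μ] [DecidableEq μ]

/-- coordinate functions -/
def co (i : Fin n) : Sm n := ⟨fun x => x i, (contDiff_apply ℝ ℝ i : ContDiff ℝ (⊤ : ℕ∞) fun x : Fin n → ℝ => x i)⟩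

lemma evx_co (i : Fin n) (x : Fin n → ℝ) : evx x (co i) = x i := rfl

lemma pd_co (i j : Fin n) : pd i (co j) = if i = j then 1 else 0 := by
  apply Sm_ext
  intro x
  rw [evx_pd]
  have h : ((co j : Sm n) : (Fin n → ℝ) → ℝ) = (ContinuousLinearMap.proj j : (Fin n → ℝ) →L[ℝ] ℝ) := rfl
  rw [h, ContinuousLinearMap.fderiv]
  simp only [ContinuousLinearMap.proj_apply, Pi.single_apply]
  by_cases hij : i = j
  · subst hij; simp
  · simp [hij, Ne.symm hij]

/-- squared radius -/
def qq (n : ℕ) : Sm n := ∑ i, co i * co i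

lemma evx_qq (x : Fin n → ℝ) : evx x (qq n) = ∑ i, x i ^ 2 := by
  simp only [qq, map_sum, map_mul, evx_co, sq]

lemma pd_qq (i : Fin n) : pd i (qq n) = 2 * co i := by
  simp only [qq, map_sum, der_mul, pd_co]
  simp [Finset.sum_add_distrib, two_mul]

lemma pd2_qq (i j : Fin n) : pd i (pd j (qq n)) = if i = j then 2 else 0 := by
  rw [pd_qq, two_mul, map_add, pd_co, ← two_mul]; split_ifs <;> simp

lemma proj_diag {ι : Type*} [Fintype ι] [DecidableEq ι] {R : Type*} [CommRing R] [Algebra ℝ R]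
    (S : GData R ι) (ev : R →+* ℝ) (i : ι) : ev (S.Pi i i) ≤ 1 := by
  have h : ev (S.Pi i i) = ∑ C, ev (S.Pi i C) ^ 2 := by
    conv_lhs => rw [← S.idem]
    rw [Matrix.mul_apply, map_sum]
    exact Finset.sum_congr rfl fun C _ => by rw [map_mul, S.Pi_symm C i, sq]
  have h2 : ev (S.Pi i i) ^ 2 ≤ ev (S.Pi i i) := by
    conv_rhs => rw [h]
    exact Finset.single_le_sum (f := fun C => ev (S.Pi i C) ^ 2) (fun _ _ => sq_nonneg _)
      (Finset.mem_univ i)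
  nlinarith

lemma proj_quad {ι : Type*} [Fintype ι] [DecidableEq ι] {R : Type*} [CommRing R] [Algebra ℝ R]
    (S : GData R ι) (ev : R →+* ℝ) (y : ι → ℝ) :
    ∑ i, ∑ j, ev (S.Pi i j) * (y i * y j) ≤ ∑ i, y i ^ 2 := by
  have h : ∀ i j, ev (S.Pi i j) = ∑ C, ev (S.Pi C i) * ev (S.Pi C j) := by
    intro i j
    conv_lhs => rw [← S.idem]
    rw [Matrix.mul_apply, map_sum]
    exact Finset.sum_congr rfl fun C _ => by rw [map_mul, S.Pi_symm C i]
  have e1 : ∑ C, (∑ i, ev (S.Pi C i) * y i) ^ 2 = ∑ i, ∑ j, ev (S.Pi i j) * (y i * y j) := by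
    have : ∀ C, (∑ i, ev (S.Pi C i) * y i) ^ 2
        = ∑ i, ∑ j, ev (S.Pi C i) * ev (S.Pi C j) * (y i * y j) := by
      intro C
      rw [sq, Finset.sum_mul_sum]
      exact Finset.sum_congr rfl fun i _ => Finset.sum_congr rfl fun j _ => by ring
    simp only [this]
    rw [Finset.sum_comm]
    refine Finset.sum_congr rfl fun i _ => ?_
    rw [Finset.sum_comm]
    refine Finset.sum_congr rfl fun j _ => ?_
    rw [h i j, Finset.sum_mul]
  have e2 : ∑ C, y C * (∑ i, ev (S.Pi C i) * y i) = ∑ i, ∑ j, ev (S.Pi i j) * (y i * y j) := by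
    refine Finset.sum_congr rfl fun i _ => ?_
    rw [Finset.mul_sum]
    exact Finset.sum_congr rfl fun j _ => by ring
  have e3 : 0 ≤ ∑ C, (y C - ∑ i, ev (S.Pi C i) * y i) ^ 2 :=
    Finset.sum_nonneg fun _ _ => sq_nonneg _
  have e4 : ∑ C, (y C - ∑ i, ev (S.Pi C i) * y i) ^ 2 = ∑ C, y C ^ 2
      - 2 * ∑ C, y C * (∑ i, ev (S.Pi C i) * y i) + ∑ C, (∑ i, ev (S.Pi C i) * y i) ^ 2 := by
    rw [Finset.mul_sum, ← Finset.sum_sub_distrib, ← Finset.sum_add_distrib]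
    exact Finset.sum_congr rfl fun i _ => by ring
  linarith

variable (T : GrData (Sm n) (Fin n) μ)

lemma d_inl_pd (hT : T.dd = pd) (i : Fin n) (a : Sm n) : T.toG.d (Sum.inl i) a = pd i a := by rw [← hT]; rfl

lemma d_inr_pd (i : μ) (a : Sm n) : T.toG.d (Sum.inr i) a = 0 := rfl

lemma Gam_qq (hT : T.dd = pd) (x : Fin n → ℝ) : evx x (T.toG.Gam (qq n) (qq n)) ≤ 4 * ∑ i, x i ^ 2 := by
  have h := proj_quad T.toG (evx x) (Sum.elim (fun i => 2 * x i) (fun _ => 0))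
  have e : ∀ i, evx x (T.toG.d i (qq n)) = (Sum.elim (fun i => 2 * x i) (fun _ => 0) : _ → ℝ) i := by
    rintro (i | i)
    · rw [d_inl_pd T hT, pd_qq, map_mul, evx_co, map_ofNat]; rfl
    · rw [d_inr_pd]; exact map_zero _
  have h2 : ∑ i, (Sum.elim (fun i => 2 * x i) (fun _ => 0) : Fin n ⊕ μ → ℝ) i ^ 2
      = 4 * ∑ i, x i ^ 2 := by
    rw [Fintype.sum_sum_type, Finset.mul_sum]
    simp only [Sum.elim_inl, Sum.elim_inr]
    simp [mul_pow]; norm_num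
  rw [h2] at h
  refine le_trans (le_of_eq ?_) h
  simp only [GData.Gam, map_sum, map_mul, e]

lemma L_qq (hT : T.dd = pd) (x : Fin n → ℝ) (hV : ∑ i, (evx x (T.Vt i)) ^ 2 ≤ 1) (r : ℝ) (hr : 0 ≤ r)
    (hx : ∑ i, x i ^ 2 ≤ r ^ 2) :
    evx x (T.toG.L (qq n)) ≤ 2 * n + 2 * r := by
  have e1 : evx x (T.toG.L (qq n)) = 2 * ∑ i, evx x (T.toG.Pi (Sum.inl i) (Sum.inl i))
      + 2 * ∑ i, evx x (T.Vt i) * x i := by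
    have hVl : ∀ i, T.toG.V (Sum.inl i) = T.Vt i := fun i => rfl
    simp only [GData.L, Fintype.sum_sum_type, d_inl_pd T hT, d_inr_pd, map_zero, mul_zero,
      Finset.sum_const_zero, add_zero, pd2_qq, hVl]
    simp only [pd_qq]
    simp only [map_add, map_sum, map_mul, evx_co, Finset.mul_sum]
    congr 1
    · refine Finset.sum_congr rfl fun i _ => ?_
      rw [Finset.sum_eq_single i]
      · rw [if_pos rfl, map_ofNat, mul_comm]
      · intro j _ hj; simp [Ne.symm hj]
      · simp
    · refine Finset.sum_congr rfl fun i _ => ?_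
      rw [map_ofNat]; ring
  have e2 : ∑ i, evx x (T.toG.Pi (Sum.inl i) (Sum.inl i)) ≤ n := by
    refine le_trans (Finset.sum_le_sum (g := fun _ => (1:ℝ)) fun i _ => proj_diag T.toG (evx x) _) ?_
    simp
  have e3 : ∑ i, evx x (T.Vt i) * x i ≤ r := by
    have h := Finset.sum_mul_sq_le_sq_mul_sq Finset.univ (fun i => evx x (T.Vt i)) x
    have h0 : 0 ≤ ∑ i, x i ^ 2 := Finset.sum_nonneg fun _ _ => sq_nonneg _
    exact le_of_sq_le_sq (by nlinarith) hr
  linarith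

lemma compact_ball (r : ℝ) : IsCompact {x : Fin n → ℝ | ∑ i, x i ^ 2 ≤ r ^ 2} := by
  refine Metric.isCompact_of_isClosed_isBounded ?_ ?_
  · exact isClosed_le (by fun_prop) continuous_const
  · refine (Metric.isBounded_closedBall (x := (0 : Fin n → ℝ)) (r := |r|)).subset ?_
    intro x hx
    rw [mem_closedBall_zero_iff, pi_norm_le_iff_of_nonneg (abs_nonneg r)]
    intro i
    rw [Real.norm_eq_abs]
    refine sq_le_sq.mp (le_trans ?_ hx)
    exact Finset.single_le_sum (f := fun i => x i ^ 2) (fun _ _ => sq_nonneg _) (Finset.mem_univ i)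

/-- local estimate -/
lemma local_est (hT : T.dd = pd) (hV : ∀ x, ∑ i, (evx x (T.Vt i)) ^ 2 ≤ 1)
    (k : Sm n) (c : ℝ) (hc0 : 0 < c) (hc : ∀ x, c ≤ evx x k) (hk1 : ∀ x, evx x k ≤ 1)
    (K : ℝ) (hK : 15 < 4 * K)
    (hLk : ∀ x, evx x (T.toG.L k) ≤ - (K / 2) * evx x T.toG.Q.trace * evx x k)
    (r : ℝ) (hr : 1 ≤ r) (y : Fin n → ℝ) (hy : ∑ i, y i ^ 2 ≤ r ^ 2 / 2) :
    evx y T.toG.Q.trace ≤ 4 * ((20 * n + 260) / (4 * K - 15)) / c ^ 2 / r := by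
  obtain ⟨κ, hκ⟩ := sm_unit k (fun x => (lt_of_lt_of_le hc0 (hc x)).ne')
  have hκx : ∀ x, evx x k * evx x κ = 1 := fun x => by rw [← map_mul, hκ, map_one]
  have hκ1 : ∀ x, 1 ≤ evx x κ := by
    intro x; have := hκx x; have := hc x; have := hk1 x
    by_contra h; push Not at h; nlinarith
  have hκ2 : ∀ x, evx x κ ≤ 1 / c := by
    intro x
    rw [le_div_iff₀ hc0]
    nlinarith [hκx x, hc x, hκ1 x]
  set W := T.toG.Q.trace with hWd
  have hW0 : ∀ x, 0 ≤ evx x W := fun x => T.toG.ev_W_nonneg (evx x)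
  set η : Sm n := algebraMap ℝ _ (r ^ 2) - qq n with hη
  have hηx : ∀ x, evx x η = r ^ 2 - ∑ i, x i ^ 2 := by
    intro x; rw [hη, map_sub, evx_alg, evx_qq]
  set φ := W ^ 5 * κ ^ 8 * η ^ 10 with hφ
  have hφx : ∀ x, evx x φ = (evx x W * evx x η ^ 2) ^ 5 * evx x κ ^ 8 := by
    intro x; simp only [hφ, map_mul, map_pow]; ring
  set C := (20 * (n:ℝ) + 260) / (4 * K - 15) with hC
  have hC0 : 0 < C := by
    rw [hC]; apply div_pos
    · positivity
    · linarith
  have hyB : y ∈ {x : Fin n → ℝ | ∑ i, x i ^ 2 ≤ r ^ 2} := by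
    have h : ∑ i, y i ^ 2 ≤ r ^ 2 := by nlinarith [sq_nonneg r]
    exact h
  obtain ⟨x, hxB, hx⟩ := (compact_ball (n := n) r).exists_isMaxOn ⟨y, hyB⟩ (evx_cont φ).continuousOn
  have hxy : evx y φ ≤ evx x φ := hx hyB
  have hηy : r ^ 2 / 2 ≤ evx y η := by rw [hηx]; linarith
  have hxB' : ∑ i, x i ^ 2 ≤ r ^ 2 := hxB
  have hηx0 : 0 ≤ evx x η := by rw [hηx]; linarith
  have hmain : evx x W * evx x η ^ 2 ≤ C * r ^ 3 := by
    by_cases hWx : evx x W = 0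
    · rw [hWx, zero_mul]; positivity
    by_cases hηz : evx x η = 0
    · rw [hηz]; simp; positivity
    have hWp : 0 < evx x W := lt_of_le_of_ne (hW0 x) (Ne.symm hWx)
    have hηp : 0 < evx x η := lt_of_le_of_ne hηx0 (Ne.symm hηz)
    have hloc : IsLocalMax (fun z => evx z φ) x := by
      have ho : IsOpen {z : Fin n → ℝ | 0 < evx z η} := isOpen_lt continuous_const (evx_cont η)
      filter_upwards [ho.mem_nhds hηp] with z hz
      refine hx ?_
      have hz' : 0 < evx z η := hz
      rw [hηx] at hz'
      exact (by linarith : ∑ i, z i ^ 2 ≤ r ^ 2)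
    have hL := max_L T hT φ x hloc
    have hd : ∀ D, evx x (T.toG.del D φ) = 0 := by
      intro D
      rw [GData.del, map_sum]
      refine Finset.sum_eq_zero fun i _ => ?_
      rcases i with i | i
      · rw [d_inl_pd T hT, map_mul, fst_test φ x hloc, mul_zero]
      · rw [d_inr_pd, mul_zero, map_zero]
    have hkey := T.toG.key_max (evx x) k κ η hκ K hWp (lt_of_lt_of_le hc0 (hc x)) hηp (hLk x) hd hL
    rw [hη, L_cst, Gam_cst, ← hη, map_neg, ← hWd] at hkey
    have g1 := L_qq T hT x (hV x) r (by linarith) hxB'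
    have g2 := Gam_qq T hT x
    have hηr : evx x η ≤ r ^ 2 := by
      rw [hηx]; have : 0 ≤ ∑ i, x i ^ 2 := Finset.sum_nonneg fun _ _ => sq_nonneg _
      linarith
    have h1 : (4 * K - 15) * (evx x W * evx x η ^ 2) ≤ 10 * (evx x (T.toG.L (qq n))) * evx x η
        + 60 * evx x (T.toG.Gam (qq n) (qq n)) := by
      calc _ = ((4 * K - 15) * evx x W) * evx x η ^ 2 := by ring
        _ ≤ _ := mul_le_mul_of_nonneg_right hkey (by positivity)
        _ = _ := by field_simp
    have h2 : (evx x (T.toG.L (qq n))) * evx x η ≤ (2 * n + 2 * r) * r ^ 2 := by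
      calc _ ≤ (2 * n + 2 * r) * evx x η := mul_le_mul_of_nonneg_right g1 hηx0
        _ ≤ _ := mul_le_mul_of_nonneg_left hηr (by positivity)
    have hr3 : r ^ 2 ≤ r ^ 3 := pow_le_pow_right₀ hr (by norm_num)
    have hn : (0:ℝ) ≤ n := Nat.cast_nonneg n
    have h3 : (4 * K - 15) * (evx x W * evx x η ^ 2) ≤ (20 * n + 260) * r ^ 3 := by
      have : (n:ℝ) * r ^ 2 ≤ n * r ^ 3 := mul_le_mul_of_nonneg_left hr3 hn
      nlinarith
    rw [hC, div_mul_eq_mul_div, le_div_iff₀ (by linarith)]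
    linarith
  have hA : (evx y W * evx y η ^ 2) ^ 5 ≤ (C * r ^ 3 / c ^ 2) ^ 5 := by
    have hp : 0 ≤ evx y W * evx y η ^ 2 := mul_nonneg (hW0 y) (sq_nonneg _)
    have hc1 : c ≤ 1 := (hc y).trans (hk1 y)
    calc (evx y W * evx y η ^ 2) ^ 5 ≤ evx y φ := by
          rw [hφx]
          exact le_mul_of_one_le_right (by positivity) (one_le_pow₀ (hκ1 y))
      _ ≤ evx x φ := hxy
      _ ≤ (C * r ^ 3) ^ 5 * (1 / c) ^ 8 := by
          rw [hφx]
          have := hW0 x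
          have := hκ1 x
          gcongr
          exact hκ2 x
      _ ≤ (C * r ^ 3) ^ 5 * (1 / c) ^ 10 := by
          have : (1 / c) ^ 8 ≤ (1 / c) ^ 10 :=
            pow_le_pow_right₀ (by rw [le_div_iff₀ hc0]; linarith) (by norm_num)
          gcongr
      _ = _ := by field_simp
  have hB : evx y W * evx y η ^ 2 ≤ C * r ^ 3 / c ^ 2 :=
    le_of_pow_le_pow_left₀ (by norm_num) (by positivity) hA
  have hD : evx y W * (r ^ 2 / 2) ^ 2 ≤ C * r ^ 3 / c ^ 2 := by
    refine le_trans ?_ hB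
    have := hW0 y
    gcongr
  have hrp : 0 < r := by linarith
  have e : C * r ^ 3 / c ^ 2 = (4 * C / c ^ 2 / r) * (r ^ 2 / 2) ^ 2 := by
    field_simp; ring
  rw [e] at hD
  exact le_of_mul_le_mul_right hD (by positivity)

theorem liouville (hT : T.dd = pd) (hV : ∀ x, ∑ i, (evx x (T.Vt i)) ^ 2 ≤ 1)
    (k : Sm n) (c : ℝ) (hc0 : 0 < c) (hc : ∀ x, c ≤ evx x k) (hk1 : ∀ x, evx x k ≤ 1)
    (K : ℝ) (hK : 15 < 4 * K)
    (hLk : ∀ x, evx x (T.toG.L k) ≤ - (K / 2) * evx x T.toG.Q.trace * evx x k)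
    (y : Fin n → ℝ) : evx y T.toG.Q.trace = 0 := by
  refine le_antisymm ?_ (T.toG.ev_W_nonneg _)
  have h : Filter.Tendsto (fun r : ℝ => 4 * ((20 * n + 260) / (4 * K - 15)) / c ^ 2 / r)
      Filter.atTop (nhds 0) := tendsto_const_nhds.div_atTop Filter.tendsto_id
  refine ge_of_tendsto h ?_
  filter_upwards [Filter.eventually_ge_atTop 1,
    Filter.eventually_ge_atTop (2 * ∑ i, y i ^ 2)] with r h1 h2
  exact local_est T hT hV k c hc0 hc hk1 K hK hLk r h1 y (by nlinarith)

end Liou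
end GTB

namespace GTB

lemma const_of_pd {n : ℕ} (f : Sm n) (h : ∀ i, pd i f = 0) (x : Fin n → ℝ) :
    evx x f = evx 0 f := by
  have h1 : ∀ y, fderiv ℝ (f : (Fin n → ℝ) → ℝ) y = 0 := by
    intro y
    ext v
    have hv : v = ∑ i, v i • (Pi.single i (1:ℝ) : Fin n → ℝ) := by
      ext j; simp [Finset.sum_apply, Pi.single_apply]
    rw [hv, map_sum]
    refine (Finset.sum_eq_zero fun i _ => ?_).trans rfl
    have h2 : evx y (pd i f) = 0 := by rw [h i]; exact map_zero _
    rw [evx_pd] at h2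
    rw [map_smul, h2, smul_zero]
  exact is_const_of_fderiv_eq_zero (sdf f) h1 x 0

lemma affine_of {n : ℕ} (f : Sm n) (h : ∀ i j, pd i (pd j f) = 0) (x : Fin n → ℝ) :
    evx x f = ∑ j, evx 0 (pd j f) * x j + evx 0 f := by
  have h1 : ∀ j, pd j f = algebraMap ℝ (Sm n) (evx 0 (pd j f)) := by
    intro j
    exact Sm_ext fun y => const_of_pd (pd j f) (fun i => h i j) y
  have h2 := const_of_pd (f - ∑ j, algebraMap ℝ (Sm n) (evx 0 (pd j f)) * co j) (by
    intro i
    rw [map_sub, map_sum]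
    simp only [der_mul, Derivation.map_algebraMap, pd_co, zero_mul, zero_add, mul_ite, mul_one,
      mul_zero, Finset.sum_ite_eq, Finset.mem_univ, if_true]
    exact sub_eq_zero.mpr (h1 i)) x
  simp only [map_sub, map_sum, map_mul, evx_alg, evx_co] at h2
  simp only [Pi.zero_apply, mul_zero, Finset.sum_const_zero, sub_zero] at h2
  linarith

lemma rpow_bd : (3 : ℝ) ^ ((2 : ℝ) / 3) ≤ 25 / 12 := by
  have h0 : (0 : ℝ) ≤ (3 : ℝ) ^ ((2 : ℝ) / 3) := by positivity
  have h : ((3 : ℝ) ^ ((2 : ℝ) / 3)) ^ 3 = 9 := by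
    rw [← Real.rpow_natCast, ← Real.rpow_mul (by norm_num)]
    norm_num
  by_contra hc
  push Not at hc
  have := pow_lt_pow_left₀ hc (by norm_num) (n := 3) (by norm_num)
  rw [h] at this
  norm_num at this

theorem main
    (n m : ℕ)
    (u : (Fin n → ℝ) → (Fin m → ℝ)) (hu : ContDiff ℝ (⊤ : ℕ∞) u)
    (g : (Fin n → ℝ) → Matrix (Fin n) (Fin n) ℝ)
    (hg : ∀ x i j, g x i j = (if i = j then (1 : ℝ) else 0)
        + ∑ α, fderiv ℝ (fun y => u y α) x (Pi.single i 1)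
            * fderiv ℝ (fun y => u y α) x (Pi.single j 1))
    (Vt : Fin n → ℝ) (Vn : Fin m → ℝ)
    (hV : ∑ i, (Vt i) ^ 2 + ∑ α, (Vn α) ^ 2 = 1)
    (heq : ∀ α, ∀ x, ∑ i, ∑ j, (g x)⁻¹ i j
          * fderiv ℝ (fun y => fderiv ℝ (fun z => u z α) y (Pi.single j 1)) x (Pi.single i 1)
        = Vn α - ∑ i, fderiv ℝ (fun y => u y α) x (Pi.single i 1) * Vt i)
    (v₁ : ℝ) (hv₁ : v₁ < 2 * (3 : ℝ) ^ ((2 : ℝ) / 3) / (1 + (3 : ℝ) ^ ((2 : ℝ) / 3)))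
    (hbound : ∀ x, Real.sqrt ((g x).det) ≤ v₁) :
    ∃ (A : Matrix (Fin m) (Fin n) ℝ) (b : Fin m → ℝ),
      ∀ x, u x = A.mulVec x + b := by
  -- the components as elements of the algebra
  have hua : ∀ α, ContDiff ℝ (⊤ : ℕ∞) (fun y => u y α) := fun α => contDiff_pi.mp hu α
  let uc : Fin m → Sm n := fun α => ⟨fun y => u y α, hua α⟩
  let p : Matrix (Fin m) (Fin n) (Sm n) := fun α i => pd i (uc α)
  have hpx : ∀ x α i, evx x (p α i) = fderiv ℝ (fun y => u y α) x (Pi.single i 1) :=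
    fun x α i => rfl
  set G : Matrix (Fin n) (Fin n) (Sm n) := 1 + p.transpose * p with hGd
  have hone : ∀ x i j, evx x ((1 : Matrix (Fin n) (Fin n) (Sm n)) i j) = if i = j then 1 else 0 := by
    intro x i j
    rw [Matrix.one_apply]; split_ifs
    · exact map_one _
    · exact map_zero _
  have hGx : ∀ x, (evx x).mapMatrix G = g x := by
    intro x
    ext i j
    rw [hg, RingHom.mapMatrix_apply, Matrix.map_apply, hGd, Matrix.add_apply, map_add, hone,
      Matrix.mul_apply, map_sum]
    congr 1
  have hdet : ∀ x, evx x G.det = (g x).det := by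
    intro x; rw [RingHom.map_det, hGx]
  have hpp : ∀ x, 1 + evx x (p.transpose * p).trace ≤ evx x G.det
      ∧ 0 ≤ evx x (p.transpose * p).trace := by
    intro x
    let P : Matrix (Fin m) (Fin n) ℝ := fun α i => evx x (p α i)
    have e1 : (evx x).mapMatrix (p.transpose * p) = P.conjTranspose * P := by
      ext i j
      rw [RingHom.mapMatrix_apply, Matrix.map_apply, Matrix.mul_apply, Matrix.mul_apply, map_sum]
      exact Finset.sum_congr rfl fun α _ => by rw [map_mul]; rfl
    have hps := Matrix.posSemidef_conjTranspose_mul_self P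
    rw [ev_trace, RingHom.map_det, hGd, map_add, map_one, e1]
    exact ⟨det_one_add_ge _ hps, hps.trace_nonneg⟩
  have hdet1 : ∀ x, 1 ≤ evx x G.det := fun x => by
    have := hpp x; linarith [this.1, this.2]
  obtain ⟨e, he⟩ := sm_unit G.det (fun x => by have := hdet1 x; intro h; linarith)
  have hGi : G * (e • G.adjugate) = 1 := by
    rw [Matrix.mul_smul, Matrix.mul_adjugate, smul_smul, mul_comm, he, one_smul]
  have hGix : ∀ x i j, evx x ((e • G.adjugate) i j) = (g x)⁻¹ i j := by
    intro x i j
    have h := congrArg (evx x).mapMatrix hGi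
    rw [map_mul, hGx, map_one] at h
    rw [Matrix.inv_eq_right_inv h]
    rfl
  let T : GrData (Sm n) (Fin n) (Fin m) :=
    { dd := pd
      comm := pd_comm
      p := p
      hp := fun i j α => pd_comm i j (uc α)
      Gi := e • G.adjugate
      hGi := hGi
      Vt := fun i => algebraMap ℝ _ (Vt i)
      Vn := fun i => algebraMap ℝ _ (Vn i)
      hVt := fun i j => Derivation.map_algebraMap _ _
      hVn := fun i j => Derivation.map_algebraMap _ _
      pde := by
        intro α
        apply Sm_ext
        intro x
        have h := heq α x
        rw [map_sub, evx_alg, map_sum, map_sum]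
        simp only [map_sum, map_mul, hGix, evx_alg, hpx]
        exact h }
  obtain ⟨s, hs⟩ := sm_sqrt G.det (fun x => lt_of_lt_of_le one_pos (hdet1 x))
  have hs1 : ∀ x, 1 ≤ evx x s := fun x => by rw [hs]; exact Real.one_le_sqrt.mpr (hdet1 x)
  have hs2 : ∀ x, evx x s ^ 2 = evx x G.det := fun x => by
    rw [hs, Real.sq_sqrt (by linarith [hdet1 x])]
  have hsv : ∀ x, evx x s ≤ v₁ := fun x => by rw [hs, hdet]; exact hbound x
  obtain ⟨w, hw⟩ := sm_unit s (fun x => by have := hs1 x; intro h; linarith)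
  have hwx : ∀ x, evx x s * evx x w = 1 := fun x => by rw [← map_mul, hw, map_one]
  have hww : w * w * (1 + T.p.transpose * T.p).det = 1 := by
    apply Sm_ext
    intro x
    change evx x (w * w * G.det) = evx x 1
    rw [map_mul, map_mul, ← hs2, map_one]
    have := hwx x
    calc _ = (evx x s * evx x w) ^ 2 := by ring
      _ = 1 := by rw [this, one_pow]
  have hv1 : 1 ≤ v₁ := (hs1 0).trans (hsv 0)
  have hv2 : 0.74 * v₁ < 1 := by
    have ht := rpow_bd
    have ht0 : 0 < (3 : ℝ) ^ ((2 : ℝ) / 3) := by positivity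
    set t := (3 : ℝ) ^ ((2 : ℝ) / 3)
    rw [lt_div_iff₀ (by positivity)] at hv₁
    by_contra hc
    push Not at hc
    nlinarith
  have hw0 : ∀ x, 1 / v₁ ≤ evx x w := by
    intro x
    rw [div_le_iff₀ (by linarith), ← hwx x, mul_comm]
    have : 0 ≤ evx x w := by
      by_contra h; push Not at h; nlinarith [hwx x, hs1 x]
    exact mul_le_mul_of_nonneg_left (hsv x) this
  have hc0 : 0 < 1 / v₁ - 0.74 := by
    rw [sub_pos, lt_div_iff₀ (by linarith)]; exact hv2
  have hw1 : ∀ x, evx x w ≤ 1 := by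
    intro x
    have h0 : 0 < evx x w := lt_of_lt_of_le (by positivity) (hw0 x)
    nlinarith [hwx x, hs1 x]
  set k : Sm n := w - algebraMap ℝ _ 0.74 with hk
  have hkx : ∀ x, evx x k = evx x w - 0.74 := fun x => by rw [hk, map_sub, evx_alg]
  have hW := liouville T rfl (by
      intro x
      change ∑ i, (evx x (algebraMap ℝ (Sm n) (Vt i))) ^ 2 ≤ 1
      simp only [evx_alg]
      have : 0 ≤ ∑ α, (Vn α) ^ 2 := Finset.sum_nonneg fun _ _ => sq_nonneg _
      linarith) k (1 / v₁ - 0.74) hc0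
    (fun x => by rw [hkx]; linarith [hw0 x])
    (fun x => by rw [hkx]; linarith [hw1 x])
    (50 / 13) (by norm_num) (by
      intro x
      rw [hk, L_cst', ← hk, hkx]
      have h0 : 0 < evx x w := lt_of_lt_of_le (by positivity) (hw0 x)
      have h1 := T.toG.ev_w (evx x) w (T.hw w hww) h0.le
      rw [← map_sub, T.trFF] at h1
      have h2 := (hpp x).1
      have hWn := T.toG.ev_W_nonneg (evx x)
      set W := evx x T.toG.Q.trace
      change 2 * evx x (T.toG.L w) ≤ evx x w * W * (-1 + evx x (p.transpose * p).trace) at h1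
      have h3 : evx x w * (-1 + evx x (p.transpose * p).trace)
          ≤ - (50 / 13) * (evx x w - 0.74) := by
        have h4 : evx x w * (-1 + evx x (p.transpose * p).trace)
            ≤ evx x w * (-2 + evx x s ^ 2) := by
          refine mul_le_mul_of_nonneg_left ?_ h0.le
          rw [hs2]; linarith
        refine h4.trans ?_
        have h5 := hwx x
        have h6 : evx x w * (-2 + evx x s ^ 2) = -2 * evx x w + evx x s := by
          linear_combination (evx x s) * h5
        rw [h6]
        have h7 : 0.74 ≤ evx x w := by linarith [hw0 x]
        have h8 := hw1 x
        refine le_of_mul_le_mul_right ?_ h0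
        nlinarith [mul_nonneg (sub_nonneg.mpr h8) (sub_nonneg.mpr h7)]
      nlinarith [mul_le_mul_of_nonneg_left h3 hWn])
  refine ⟨fun α j => evx 0 (pd j (uc α)), fun α => evx 0 (uc α), fun x => ?_⟩
  ext α
  have h := affine_of (uc α) (fun i j => Sm_ext fun y => by
    rw [map_zero]
    exact T.dp_zero (evx y) (hW y) i j α) x
  exact h

end GTB

/-- Bernstein-type rigidity theorem for graphic translating solitons in higher
codimension: if `u : ℝⁿ → ℝᵐ` (`m ≥ 2`) is a smooth entire solution of the translator
system `∑ g^{ij} ∂ᵢ∂ⱼ uᵅ = V_{n+α} − ∑ ∂ᵢuᵅ Vᵢ` for a unit vector `V ∈ ℝ^{n+m}`, where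
`g_{ij} = δ_{ij} + ∑_α ∂ᵢuᵅ ∂ⱼuᵅ`, and if the `v`-function `√(det g)` is bounded by some
constant `v₁ < 2·3^{2/3}/(1 + 3^{2/3})`, then `u` is affine linear. -/
theorem graphic_translator_bernstein
    (n m : ℕ) (hn : 1 ≤ n) (hm : 2 ≤ m)
    (u : (Fin n → ℝ) → (Fin m → ℝ)) (hu : ContDiff ℝ (⊤ : ℕ∞) u)
    (g : (Fin n → ℝ) → Matrix (Fin n) (Fin n) ℝ)
    (hg : ∀ x i j, g x i j = (if i = j then (1 : ℝ) else 0)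
        + ∑ α, fderiv ℝ (fun y => u y α) x (Pi.single i 1)
            * fderiv ℝ (fun y => u y α) x (Pi.single j 1))
    (Vt : Fin n → ℝ) (Vn : Fin m → ℝ)
    (hV : ∑ i, (Vt i) ^ 2 + ∑ α, (Vn α) ^ 2 = 1)
    (heq : ∀ α, ∀ x, ∑ i, ∑ j, (g x)⁻¹ i j
          * fderiv ℝ (fun y => fderiv ℝ (fun z => u z α) y (Pi.single j 1)) x (Pi.single i 1)
        = Vn α - ∑ i, fderiv ℝ (fun y => u y α) x (Pi.single i 1) * Vt i)
    (v₁ : ℝ) (hv₁ : v₁ < 2 * (3 : ℝ) ^ ((2 : ℝ) / 3) / (1 + (3 : ℝ) ^ ((2 : ℝ) / 3)))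
    (hbound : ∀ x, Real.sqrt ((g x).det) ≤ v₁) :
    ∃ (A : Matrix (Fin m) (Fin n) ℝ) (b : Fin m → ℝ),
      ∀ x, u x = A.mulVec x + b := by
  exact GTB.main n m u hu g hg Vt Vn hV heq v₁ hv₁ hbound
end
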